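/- Let (S, n) be a regular complete local ring. Then 𝓘(S) = { I ideal of S : Rad(I) = xS for some x ∈ S } ∪ { I ideal of S : 0 ≤ dim S/I ≤ 1 }. That is, an ideal I of S lies in 𝓘(S) if and only if either the radical of I is a principal ideal or dim S/I ≤ 1. -/

import Mathlib

universe u

open CategoryTheory

/-- An `R`-module `L` is `I`-cofinite if `Supp L ⊆ V(I)` and `Ext^i_R(R/I, L)` is a finitely
generated `R`-module for all `i ≥ 0`. -/
def IsCofinite {R : Type u} [CommRing R] (I : Ideal R) (L : ModuleCat.{u} R) : Prop :=
  Module.support R L ⊆ PrimeSpectrum.zeroLocus (I : Set R) ∧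
    ∀ i : ℕ, Module.Finite R
      (((Ext R (ModuleCat.{u} R) i).obj (Opposite.op (ModuleCat.of R (R ⧸ I)))).obj L)

/-- `I ∈ 𝓘(R)`: for every finitely generated `R`-module `M`, the local cohomology modules
`H^i_I(M)` are `I`-cofinite for all `i ≥ 0`. -/
def MemCofiniteClass (R : Type u) [CommRing R] (I : Ideal R) : Prop :=
  ∀ M : ModuleCat.{u} R, Module.Finite R M →
    ∀ i : ℕ, IsCofinite I ((localCohomology I i).obj M)

section Part1
open CategoryTheory

section Bridge

lemma homologyUnop_nat' {V : Type*} [Category V] [Abelian V] {ι : Type*} {c : ComplexShape ι}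
    {K L : HomologicalComplex Vᵒᵖ c} (φ : K ⟶ L) (i : ι) :
    (L.homologyUnop i).hom ≫ (HomologicalComplex.homologyMap φ i).unop =
      HomologicalComplex.homologyMap ((HomologicalComplex.unopFunctor V c).map φ.op) i ≫
        (K.homologyUnop i).hom :=
  (congrArg Quiver.Hom.unop (HomologicalComplex.homologyOp_hom_naturality
    ((HomologicalComplex.unopFunctor V c).map φ.op) i):)

variable {R : Type u} [CommRing R]

/-- The map of Hom-complexes induced by a map of complexes. -/
noncomputable def yonMap {P Q : ChainComplex (ModuleCat.{u} R) ℕ} (φ : P ⟶ Q) (Y : ModuleCat.{u} R) :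
    Q.linearYonedaObj R Y ⟶ P.linearYonedaObj R Y :=
  (HomologicalComplex.unopFunctor _ _).map
    (((((linearYoneda R (ModuleCat.{u} R)).obj Y).rightOp.mapHomologicalComplex _).map φ).op)

lemma isoExt_inv_nat {X X' : ModuleCat.{u} R} (P : ProjectiveResolution X)
    (Q : ProjectiveResolution X') (g : X ⟶ X') (φ : P.complex ⟶ Q.complex)
    (comm : φ.f 0 ≫ Q.π.f 0 = P.π.f 0 ≫ g) (n : ℕ) (Y : ModuleCat.{u} R) :
    (Q.isoExt (R := R) n Y).inv ≫ (((Ext R (ModuleCat.{u} R) n).map g.op).app Y) =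
      HomologicalComplex.homologyMap (yonMap φ Y) n ≫ (P.isoExt (R := R) n Y).inv := by
  have h1 := ProjectiveResolution.isoLeftDerivedObj_hom_naturality g P Q φ comm
    ((linearYoneda R (ModuleCat.{u} R)).obj Y).rightOp n
  have h1' := congrArg Quiver.Hom.unop h1
  have h2 := homologyUnop_nat'
     ((((linearYoneda R (ModuleCat.{u} R)).obj Y).rightOp.mapHomologicalComplex _).map φ) n
  refine (Category.assoc _ _ _).trans ?_
  refine (congrArg (fun t => (HomologicalComplex.homologyUnop _ _).hom ≫ t) h1').trans ?_
  refine Eq.trans ?_ (Category.assoc _ _ _)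
  refine Eq.trans ?_ (congrArg (fun t => t ≫ (P.isoLeftDerivedObj
    ((linearYoneda R (ModuleCat.{u} R)).obj Y).rightOp n).hom.unop) h2)
  exact (Category.assoc _ _ _).symm


/-- cocycles -/
noncomputable abbrev Zc {X : ModuleCat.{u} R} (P : ProjectiveResolution X) (Y : ModuleCat.{u} R) (n : ℕ) :
    Submodule R (P.complex.X n ⟶ Y) :=
  LinearMap.ker (Linear.leftComp R Y (P.complex.d (n+1) n))

lemma mem_Zc {X : ModuleCat.{u} R} (P : ProjectiveResolution X) (Y : ModuleCat.{u} R) (n : ℕ)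
    (f : P.complex.X n ⟶ Y) : f ∈ Zc P Y n ↔ P.complex.d (n+1) n ≫ f = 0 := Iff.rfl

/-- from cocycles to cycles in the Hom complex -/
noncomputable def oldCyc {X : ModuleCat.{u} R} (P : ProjectiveResolution X) (Y : ModuleCat.{u} R)
    (n : ℕ) : ModuleCat.of R (Zc P Y n) ⟶ (P.complex.linearYonedaObj R Y).cycles n :=
  HomologicalComplex.liftCycles _ (ModuleCat.ofHom (Zc P Y n).subtype) (n+1) (by simp)
    (by ext x; exact x.2)

lemma oldCyc_i {X : ModuleCat.{u} R} (P : ProjectiveResolution X) (Y : ModuleCat.{u} R) (n : ℕ)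
    (x : Zc P Y n) :
    (P.complex.linearYonedaObj R Y).iCycles n (oldCyc P Y n x) = x.1 := by
  have h := HomologicalComplex.liftCycles_i (P.complex.linearYonedaObj R Y)
    (ModuleCat.ofHom (Zc P Y n).subtype) (n+1) (by simp)
    (by ext x; exact x.2)
  exact congrArg (fun t => t.hom x) h

noncomputable def oldMk {X : ModuleCat.{u} R} (P : ProjectiveResolution X) (Y : ModuleCat.{u} R)
    (n : ℕ) : Zc P Y n →ₗ[R] (((Ext R (ModuleCat.{u} R) n).obj (Opposite.op X)).obj Y) :=
  (oldCyc P Y n ≫ (P.complex.linearYonedaObj R Y).homologyπ n ≫ (P.isoExt (R := R) n Y).inv).hom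

lemma oldCyc_surj {X : ModuleCat.{u} R} (P : ProjectiveResolution X) (Y : ModuleCat.{u} R) (n : ℕ) :
    Function.Surjective (oldCyc P Y n) := by
  intro c
  have hinj : Function.Injective ((P.complex.linearYonedaObj R Y).iCycles n) :=
    (ModuleCat.mono_iff_injective _).1 inferInstance
  have h0 : (P.complex.linearYonedaObj R Y).d n (n+1)
      ((P.complex.linearYonedaObj R Y).iCycles n c) = 0 := by
    have := HomologicalComplex.iCycles_d (P.complex.linearYonedaObj R Y) n (n+1)
    exact congrArg (fun t => t.hom c) this
  refine ⟨⟨(P.complex.linearYonedaObj R Y).iCycles n c, h0⟩, hinj ?_⟩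
  rw [oldCyc_i]

lemma oldMk_surj {X : ModuleCat.{u} R} (P : ProjectiveResolution X) (Y : ModuleCat.{u} R) (n : ℕ) :
    Function.Surjective (oldMk P Y n) := by
  have h1 : Function.Surjective ((P.complex.linearYonedaObj R Y).homologyπ n) :=
    (ModuleCat.epi_iff_surjective _).1 inferInstance
  have h2 : Function.Surjective (P.isoExt (R := R) n Y).inv :=
    (ModuleCat.epi_iff_surjective _).1 inferInstance
  exact (h2.comp h1).comp (oldCyc_surj P Y n)

lemma oldMk_eq_zero_iff {X : ModuleCat.{u} R} (P : ProjectiveResolution X) (Y : ModuleCat.{u} R)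
    (n : ℕ) (x : Zc P Y n) : oldMk P Y n x = 0 ↔
      ∃ y : P.complex.X ((ComplexShape.up ℕ).prev n) ⟶ Y,
        P.complex.d n ((ComplexShape.up ℕ).prev n) ≫ y = x.1 := by
  set K := P.complex.linearYonedaObj R Y with hK
  have h2 : Function.Injective (P.isoExt (R := R) n Y).inv :=
    (ModuleCat.mono_iff_injective _).1 inferInstance
  have hinj : Function.Injective (K.iCycles n) :=
    (ModuleCat.mono_iff_injective _).1 inferInstance
  have e1 : oldMk P Y n x = (P.isoExt (R := R) n Y).inv (K.homologyπ n (oldCyc P Y n x)) := rfl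
  rw [e1, map_eq_zero_iff _ h2]
  have hex : (ShortComplex.mk (K.toCycles ((ComplexShape.up ℕ).prev n) n) (K.homologyπ n)
      (by simp)).Exact :=
    ShortComplex.exact_of_g_is_cokernel _ (K.homologyIsCokernel _ n rfl)
  rw [ShortComplex.moduleCat_exact_iff] at hex
  constructor
  · intro h
    obtain ⟨y, hy⟩ := hex _ h
    refine ⟨y, ?_⟩
    have := congrArg (K.iCycles n) hy
    rw [oldCyc_i] at this
    rw [← this]
    have h3 := K.toCycles_i ((ComplexShape.up ℕ).prev n) n
    exact (congrArg (fun t => t.hom y) h3).symm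
  · rintro ⟨y, hy⟩
    have : oldCyc P Y n x = K.toCycles ((ComplexShape.up ℕ).prev n) n y := by
      apply hinj
      rw [oldCyc_i, ← hy]
      have h3 := K.toCycles_i ((ComplexShape.up ℕ).prev n) n
      exact (congrArg (fun t => t.hom y) h3).symm
    rw [this]
    have h4 := K.toCycles_comp_homologyπ ((ComplexShape.up ℕ).prev n) n
    exact congrArg (fun t => t.hom y) h4

lemma oldMk_nat {X X' : ModuleCat.{u} R} (P : ProjectiveResolution X)
    (Q : ProjectiveResolution X') (g : X ⟶ X') (φ : P.complex ⟶ Q.complex)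
    (comm : φ.f 0 ≫ Q.π.f 0 = P.π.f 0 ≫ g) (n : ℕ) (Y : ModuleCat.{u} R) (x : Zc Q Y n)
    (hx : φ.f n ≫ x.1 ∈ Zc P Y n) :
    (((Ext R (ModuleCat.{u} R) n).map g.op).app Y) (oldMk Q Y n x) =
      oldMk P Y n ⟨φ.f n ≫ x.1, hx⟩ := by
  have h := congrArg (fun t => t.hom ((Q.complex.linearYonedaObj R Y).homologyπ n (oldCyc Q Y n x)))
    (isoExt_inv_nat P Q g φ comm n Y)
  refine h.trans ?_
  change (P.isoExt (R := R) n Y).inv _ = (P.isoExt (R := R) n Y).inv _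
  congr 1
  have h5 := HomologicalComplex.homologyπ_naturality (yonMap φ Y) n
  refine (congrArg (fun t => t.hom (oldCyc Q Y n x)) h5).trans ?_
  change (P.complex.linearYonedaObj R Y).homologyπ n _ =
    (P.complex.linearYonedaObj R Y).homologyπ n _
  congr 1
  have hinj : Function.Injective ((P.complex.linearYonedaObj R Y).iCycles n) :=
    (ModuleCat.mono_iff_injective _).1 inferInstance
  apply hinj
  have h6 := HomologicalComplex.cyclesMap_i (yonMap φ Y) n
  refine (congrArg (fun t => t.hom (oldCyc Q Y n x)) h6).trans ?_
  refine Eq.trans ?_ (oldCyc_i P Y n ⟨_, hx⟩).symm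
  exact congrArg ((yonMap φ Y).f n) (oldCyc_i Q Y n x)

/-- the map from cocycles to the new Ext groups -/
noncomputable def newMk {X : ModuleCat.{u} R} (P : ProjectiveResolution X) (Y : ModuleCat.{u} R)
    (n : ℕ) : Zc P Y n →ₗ[R] Abelian.Ext X Y n where
  toFun x := P.extMk x.1 (n+1) rfl ((mem_Zc P Y n x.1).1 x.2)
  map_add' x y := (P.add_extMk _ _ _ _ _ _).symm
  map_smul' r x := by
    rw [RingHom.id_apply, Abelian.Ext.smul_eq_comp_mk₀, ProjectiveResolution.extMk_comp_mk₀]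
    congr 1

lemma newMk_surj {X : ModuleCat.{u} R} (P : ProjectiveResolution X) (Y : ModuleCat.{u} R) (n : ℕ) :
    Function.Surjective (newMk P Y n) := by
  intro a
  obtain ⟨f, hf, rfl⟩ := P.extMk_surjective a (n+1) rfl
  exact ⟨⟨f, hf⟩, rfl⟩

lemma newMk_eq_zero_iff {X : ModuleCat.{u} R} (P : ProjectiveResolution X) (Y : ModuleCat.{u} R)
    (n : ℕ) (x : Zc P Y n) : newMk P Y n x = 0 ↔
      ∃ y : P.complex.X ((ComplexShape.up ℕ).prev n) ⟶ Y,
        P.complex.d n ((ComplexShape.up ℕ).prev n) ≫ y = x.1 := by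
  rcases n with _ | n
  · have hd : ∀ m, P.complex.d 0 m = 0 := fun m => P.complex.shape _ _ (by simp)
    simp only [hd, Limits.zero_comp, exists_const]
    constructor
    · intro h
      have h' : P.extMk x.1 (0+1) rfl ((mem_Zc P Y 0 x.1).1 x.2) = 0 := h
      simp only [← P.extEquivCohomologyClass.apply_eq_iff_eq,
        ProjectiveResolution.extEquivCohomologyClass_extMk,
        ProjectiveResolution.extEquivCohomologyClass_zero,
        CochainComplex.HomComplex.CohomologyClass.mk_eq_zero_iff] at h'
      rw [CochainComplex.HomComplex.Cocycle.toSingleMk_mem_coboundaries_iff _ _ _ _ _ 1 (by simp)] at h'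
      obtain ⟨g, hg⟩ := h'
      have hz : P.cochainComplex.d (-((0:ℕ):ℤ)) 1 = 0 := by
        have : Limits.IsZero (P.cochainComplex.X 1) :=
          P.cochainComplex.isZero_of_isStrictlyLE 0 1 (by simp)
        exact this.eq_of_tgt _ _
      rw [hz, Limits.zero_comp] at hg
      exact (Preadditive.IsIso.comp_left_eq_zero _ _).1 hg.symm |>.symm
    · intro h
      have : x = 0 := Subtype.ext h.symm
      rw [this, map_zero]
  · have : (ComplexShape.up ℕ).prev (n+1) = n := by simp
    rw [this]
    exact P.extMk_eq_zero_iff x.1 (n+1+1) rfl ((mem_Zc P Y _ x.1).1 x.2) n rfl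

noncomputable def equivOfSurj {Z A B : Type*} [AddCommGroup Z] [Module R Z] [AddCommGroup A] [Module R A]
    [AddCommGroup B] [Module R B] (a : Z →ₗ[R] A) (b : Z →ₗ[R] B) (ha : Function.Surjective a)
    (hb : Function.Surjective b) (h : LinearMap.ker a = LinearMap.ker b) : A ≃ₗ[R] B :=
  (a.quotKerEquivOfSurjective ha).symm ≪≫ₗ Submodule.quotEquivOfEq _ _ h ≪≫ₗ
    b.quotKerEquivOfSurjective hb

lemma equivOfSurj_apply {Z A B : Type*} [AddCommGroup Z] [Module R Z] [AddCommGroup A] [Module R A]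
    [AddCommGroup B] [Module R B] (a : Z →ₗ[R] A) (b : Z →ₗ[R] B) (ha : Function.Surjective a)
    (hb : Function.Surjective b) (h : LinearMap.ker a = LinearMap.ker b) (z : Z) :
    equivOfSurj a b ha hb h (a z) = b z := by
  have : (a.quotKerEquivOfSurjective ha).symm (a z) = Submodule.Quotient.mk z := by
    rw [LinearEquiv.symm_apply_eq]; rfl
  simp only [equivOfSurj, LinearEquiv.trans_apply, this]
  rfl

/-- the comparison of the two versions of Ext -/
noncomputable def extCmp (X Y : ModuleCat.{u} R) (n : ℕ) :
    (((Ext R (ModuleCat.{u} R) n).obj (Opposite.op X)).obj Y) ≃ₗ[R] Abelian.Ext X Y n :=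
  equivOfSurj (oldMk (projectiveResolution X) Y n) (newMk _ Y n) (oldMk_surj _ _ _)
    (newMk_surj _ _ _) (by ext x; simp only [LinearMap.mem_ker, oldMk_eq_zero_iff, newMk_eq_zero_iff])

lemma extCmp_nat {X X' : ModuleCat.{u} R} (g : X ⟶ X') (n : ℕ) (Y : ModuleCat.{u} R)
    (x : ((Ext R (ModuleCat.{u} R) n).obj (Opposite.op X')).obj Y) :
    extCmp X Y n ((((Ext R (ModuleCat.{u} R) n).map g.op).app Y) x) =
      (Abelian.Ext.mk₀ g).comp (extCmp X' Y n x) (zero_add n) := by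
  obtain ⟨z, rfl⟩ := oldMk_surj (projectiveResolution X') Y n x
  let φ : ProjectiveResolution.Hom (projectiveResolution X) (projectiveResolution X') g :=
    ⟨ProjectiveResolution.lift g _ _, by
      have := ProjectiveResolution.lift_commutes g (projectiveResolution X) (projectiveResolution X')
      exact congrArg (fun t => t.f 0) this⟩
  have hx : φ.hom.f n ≫ z.1 ∈ Zc (projectiveResolution X) Y n := by
    have := z.2
    rw [mem_Zc] at this ⊢
    rw [← φ.hom.comm_assoc, this, Limits.comp_zero]
  have h1 := oldMk_nat (projectiveResolution X) (projectiveResolution X') g φ.hom (by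
     simpa using φ.hom_f_zero_comp_π_f_zero) n Y z hx
  rw [h1]
  unfold extCmp
  rw [equivOfSurj_apply, equivOfSurj_apply]
  exact (ProjectiveResolution.mk₀_comp_extMk z.1 (n+1) rfl ((mem_Zc _ _ _ z.1).1 z.2) φ).symm

end Bridge

end Part1

section Part2
open CategoryTheory

section EXdefs

variable (R : Type u) [CommRing R]

/-- Unbundled Ext modules -/
def EX (N L : Type u) [AddCommGroup N] [Module R N] [AddCommGroup L] [Module R L] (i : ℕ) : Type u :=
  Abelian.Ext (ModuleCat.of R N) (ModuleCat.of R L) i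

noncomputable instance (N L : Type u) [AddCommGroup N] [Module R N] [AddCommGroup L] [Module R L]
    (i : ℕ) : AddCommGroup (EX R N L i) :=
  inferInstanceAs (AddCommGroup (Abelian.Ext (ModuleCat.of R N) (ModuleCat.of R L) i))

noncomputable instance (N L : Type u) [AddCommGroup N] [Module R N] [AddCommGroup L] [Module R L]
    (i : ℕ) : Module R (EX R N L i) :=
  inferInstanceAs (Module R (Abelian.Ext (ModuleCat.of R N) (ModuleCat.of R L) i))

end EXdefs

namespace EX

variable {R : Type u} [CommRing R]
variable {N N' N'' L L' L'' : Type u} [AddCommGroup N] [Module R N] [AddCommGroup N'] [Module R N']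
  [AddCommGroup N''] [Module R N'']
  [AddCommGroup L] [Module R L] [AddCommGroup L'] [Module R L'] [AddCommGroup L''] [Module R L'']

variable (N) in
noncomputable def post (f : L →ₗ[R] L') (i : ℕ) : EX R N L i →ₗ[R] EX R N L' i :=
  (Abelian.Ext.bilinearCompOfLinear R (ModuleCat.of R N) (ModuleCat.of R L) (ModuleCat.of R L')
    i 0 i (add_zero i)).flip (Abelian.Ext.mk₀ (ModuleCat.ofHom f))

variable (L) in
noncomputable def pre (g : N →ₗ[R] N') (i : ℕ) : EX R N' L i →ₗ[R] EX R N L i :=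
  (Abelian.Ext.bilinearCompOfLinear R (ModuleCat.of R N) (ModuleCat.of R N') (ModuleCat.of R L)
    0 i i (zero_add i)) (Abelian.Ext.mk₀ (ModuleCat.ofHom g))

lemma post_def (f : L →ₗ[R] L') (i : ℕ) (x : EX R N L i) : post N f i x =
  Abelian.Ext.comp (X := ModuleCat.of R N) (Y := ModuleCat.of R L) x
    (Abelian.Ext.mk₀ (ModuleCat.ofHom f)) (add_zero i) := rfl

lemma pre_def (g : N →ₗ[R] N') (i : ℕ) (x : EX R N' L i) : pre L g i x =
  Abelian.Ext.comp (Z := ModuleCat.of R L) (Abelian.Ext.mk₀ (ModuleCat.ofHom g)) x (zero_add i) := rfl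

lemma pre_pre (g : N →ₗ[R] N') (g' : N' →ₗ[R] N'') (i : ℕ) (x : EX R N'' L i) :
    pre L g i (pre L g' i x) = pre L (g' ∘ₗ g) i x := by
  simp only [pre_def, ModuleCat.ofHom_comp]
  exact Abelian.Ext.mk₀_comp_mk₀_assoc _ _ _

lemma post_post (f : L →ₗ[R] L') (f' : L' →ₗ[R] L'') (i : ℕ) (x : EX R N L i) :
    post N f' i (post N f i x) = post N (f' ∘ₗ f) i x := by
  simp only [post_def, ModuleCat.ofHom_comp]
  rw [← Abelian.Ext.mk₀_comp_mk₀]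
  exact Abelian.Ext.comp_assoc_of_third_deg_zero _ _ _ _

lemma pre_post (g : N →ₗ[R] N') (f : L →ₗ[R] L') (i : ℕ) (x : EX R N' L i) :
    pre L' g i (post N' f i x) = post N f i (pre L g i x) := by
  simp only [post_def, pre_def]
  exact (Abelian.Ext.comp_assoc_of_third_deg_zero _ _ _ _).symm

lemma pre_id (i : ℕ) : pre L (LinearMap.id : N →ₗ[R] N) i = LinearMap.id := by
  ext x
  rw [pre_def]
  exact Abelian.Ext.mk₀_id_comp _

lemma post_id (i : ℕ) : post N (LinearMap.id : L →ₗ[R] L) i = LinearMap.id := by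
  ext x
  rw [post_def]
  exact Abelian.Ext.comp_mk₀_id _

lemma post_smul_id (r : R) (i : ℕ) : post N (r • LinearMap.id : L →ₗ[R] L) i = r • LinearMap.id := by
  ext x
  rw [post_def]
  exact (Abelian.Ext.smul_eq_comp_mk₀ (R := R) _ _).symm

lemma pre_smul (r : R) (g : N →ₗ[R] N') (i : ℕ) : pre L (r • g) i = r • pre L g i := by
  ext x
  rw [pre_def, LinearMap.smul_apply, pre_def]
  have : ModuleCat.ofHom (r • g) = r • ModuleCat.ofHom g := rfl
  rw [this, Abelian.Ext.mk₀_smul]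
  exact Abelian.Ext.smul_comp _ _ _ _

lemma post_smul (r : R) (g : L →ₗ[R] L') (i : ℕ) : post N (r • g) i = r • post N g i := by
  ext x
  rw [post_def, LinearMap.smul_apply, post_def]
  have : ModuleCat.ofHom (r • g) = r • ModuleCat.ofHom g := rfl
  rw [this, Abelian.Ext.mk₀_smul]
  exact Abelian.Ext.comp_smul _ _ _ _

lemma pre_smul_id (r : R) (i : ℕ) : pre L (r • LinearMap.id : N →ₗ[R] N) i = r • LinearMap.id := by
  rw [pre_smul, pre_id]

noncomputable def preEquiv (e : N ≃ₗ[R] N') (i : ℕ) : EX R N' L i ≃ₗ[R] EX R N L i :=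
  LinearEquiv.ofLinearMap (pre L e.toLinearMap i) (pre L e.symm.toLinearMap i)
    (by ext x; simp [pre_pre, pre_id]) (by ext x; simp [pre_pre, pre_id])

noncomputable def postEquiv (e : L ≃ₗ[R] L') (i : ℕ) : EX R N L i ≃ₗ[R] EX R N L' i :=
  LinearEquiv.ofLinearMap (post N e.toLinearMap i) (post N e.symm.toLinearMap i)
    (by ext x; simp [post_post, post_id]) (by ext x; simp [post_post, post_id])

noncomputable def zeroEquiv : EX R N L 0 ≃ₗ[R] (N →ₗ[R] L) :=
  (Abelian.Ext.linearEquiv₀ (R := R) (X := ModuleCat.of R N) (Y := ModuleCat.of R L)).trans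
    (ModuleCat.homLinearEquiv)

lemma zeroEquiv_symm (f : N →ₗ[R] L) :
    (zeroEquiv (R := R)).symm f = Abelian.Ext.mk₀ (ModuleCat.ofHom f) := rfl

lemma zeroEquiv_pre (g : N →ₗ[R] N') (x : EX R N' L 0) : zeroEquiv (pre L g 0 x) = zeroEquiv x ∘ₗ g := by
  obtain ⟨f, rfl⟩ := (zeroEquiv (R := R)).symm.surjective x
  rw [LinearEquiv.apply_symm_apply, ← LinearEquiv.eq_symm_apply, zeroEquiv_symm, zeroEquiv_symm]
  exact Abelian.Ext.mk₀_comp_mk₀ _ _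

lemma zeroEquiv_post (g : L →ₗ[R] L') (x : EX R N L 0) : zeroEquiv (post N g 0 x) = g ∘ₗ zeroEquiv x := by
  obtain ⟨f, rfl⟩ := (zeroEquiv (R := R)).symm.surjective x
  rw [LinearEquiv.apply_symm_apply, ← LinearEquiv.eq_symm_apply, zeroEquiv_symm, zeroEquiv_symm]
  exact Abelian.Ext.mk₀_comp_mk₀ _ _

section LES
variable {A B C : Type u} [AddCommGroup A] [Module R A] [AddCommGroup B] [Module R B]
  [AddCommGroup C] [Module R C] {f : A →ₗ[R] B} {g : B →ₗ[R] C}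

lemma sesShort (hf : Function.Injective f) (hfg : Function.Exact f g) (hg : Function.Surjective g) :
    (ShortComplex.mk (ModuleCat.ofHom f) (ModuleCat.ofHom g) (by
      ext x; exact hfg.apply_apply_eq_zero x)).ShortExact :=
  ModuleCat.shortComplex_shortExact _ hfg hf hg

noncomputable def eclass (hf : Function.Injective f) (hfg : Function.Exact f g)
    (hg : Function.Surjective g) : EX R C A 1 := (sesShort hf hfg hg).extClass

variable (N) in
noncomputable def δ (hf : Function.Injective f) (hfg : Function.Exact f g) (hg : Function.Surjective g)
    (i : ℕ) : EX R N C i →ₗ[R] EX R N A (i+1) :=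
  (Abelian.Ext.bilinearCompOfLinear R (ModuleCat.of R N) (ModuleCat.of R C) (ModuleCat.of R A)
    i 1 (i+1) rfl).flip (eclass hf hfg hg)

variable (L) in
noncomputable def δ' (hf : Function.Injective f) (hfg : Function.Exact f g) (hg : Function.Surjective g)
    (i : ℕ) : EX R A L i →ₗ[R] EX R C L (i+1) :=
  (Abelian.Ext.bilinearCompOfLinear R (ModuleCat.of R C) (ModuleCat.of R A) (ModuleCat.of R L)
    1 i (i+1) (add_comm 1 i)) (eclass hf hfg hg)

variable (hf : Function.Injective f) (hfg : Function.Exact f g) (hg : Function.Surjective g)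

include hf hfg hg

lemma pre_δ (h : N →ₗ[R] N') (i : ℕ) (x : EX R N' C i) :
    pre A h (i+1) (δ N' hf hfg hg i x) = δ N hf hfg hg i (pre C h i x) := by
  exact (Abelian.Ext.comp_assoc (X := ModuleCat.of R N) (Y := ModuleCat.of R N')
    (Z := ModuleCat.of R C) (T := ModuleCat.of R A)
     (Abelian.Ext.mk₀ (ModuleCat.ofHom h)) x (eclass hf hfg hg)
     (zero_add i) rfl (by lia)).symm

lemma exact_mid (i : ℕ) : Function.Exact (post N f i) (post N g i) := by
  intro x
  constructor
  · intro h
    exact Abelian.Ext.covariant_sequence_exact₂ (X := ModuleCat.of R N) (sesShort hf hfg hg) x h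
  · rintro ⟨y, rfl⟩
    rw [post_post, hfg.linearMap_comp_eq_zero]
    rw [show (0 : A →ₗ[R] C) = (0:R) • 0 by simp, post_smul]; simp

lemma exact_right (i : ℕ) : Function.Exact (post N g i) (δ N hf hfg hg i) := by
  intro x
  constructor
  · intro h
    exact Abelian.Ext.covariant_sequence_exact₃ (X := ModuleCat.of R N) (sesShort hf hfg hg) x rfl h
  · rintro ⟨y, rfl⟩
    refine (Abelian.Ext.comp_assoc_of_second_deg_zero (X := ModuleCat.of R N) (Y := ModuleCat.of R B)
      y (Abelian.Ext.mk₀ (ModuleCat.ofHom g)) (sesShort hf hfg hg).extClass rfl).trans ?_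
    refine (congrArg (fun t => Abelian.Ext.comp (X := ModuleCat.of R N) (Y := ModuleCat.of R B) y t rfl)
      (sesShort hf hfg hg).comp_extClass).trans ?_
    exact Abelian.Ext.comp_zero (C := ModuleCat.{u} R) ..

lemma exact_left (i : ℕ) : Function.Exact (δ N hf hfg hg i) (post N f (i+1)) := by
  intro x
  constructor
  · intro h
    exact Abelian.Ext.covariant_sequence_exact₁ (X := ModuleCat.of R N) (sesShort hf hfg hg) x h rfl
  · rintro ⟨y, rfl⟩
    refine (Abelian.Ext.comp_assoc_of_third_deg_zero (X := ModuleCat.of R N) (Y := ModuleCat.of R C)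
      y (sesShort hf hfg hg).extClass (Abelian.Ext.mk₀ (ModuleCat.ofHom f)) rfl).trans ?_
    refine (congrArg (fun t => Abelian.Ext.comp (X := ModuleCat.of R N) (Y := ModuleCat.of R C) y t rfl)
      (sesShort hf hfg hg).extClass_comp).trans ?_
    exact Abelian.Ext.comp_zero (C := ModuleCat.{u} R) ..

omit hfg hg in
lemma post_zero_inj : Function.Injective (post N f 0) := by
  intro x y h
  have h' := congrArg zeroEquiv h
  rw [zeroEquiv_post, zeroEquiv_post] at h'
  apply zeroEquiv.injective
  ext n
  exact hf (LinearMap.congr_fun h' n)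

lemma exact_mid' (i : ℕ) : Function.Exact (pre L g i) (pre L f i) := by
  intro x
  constructor
  · intro h
    exact Abelian.Ext.contravariant_sequence_exact₂ (sesShort hf hfg hg) (ModuleCat.of R L) x h
  · rintro ⟨y, rfl⟩
    rw [pre_pre, hfg.linearMap_comp_eq_zero]
    rw [show (0 : A →ₗ[R] C) = (0:R) • 0 by simp, pre_smul]; simp

lemma exact_right' (i : ℕ) : Function.Exact (pre L f i) (δ' L hf hfg hg i) := by
  intro x
  constructor
  · intro h
    exact Abelian.Ext.contravariant_sequence_exact₁ (sesShort hf hfg hg) (ModuleCat.of R L) x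
      (add_comm 1 i) h
  · rintro ⟨y, rfl⟩
    refine (Abelian.Ext.comp_assoc_of_second_deg_zero (sesShort hf hfg hg).extClass
      (Abelian.Ext.mk₀ (ModuleCat.ofHom f)) y (add_comm 1 i)).symm.trans ?_
    refine (congrArg (fun t => Abelian.Ext.comp (Z := ModuleCat.of R L) t y (add_comm 1 i))
      (sesShort hf hfg hg).extClass_comp).trans ?_
    exact Abelian.Ext.zero_comp (C := ModuleCat.{u} R) ..

lemma exact_left' (i : ℕ) : Function.Exact (δ' L hf hfg hg i) (pre L g (i+1)) := by
  intro x
  constructor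
  · intro h
    exact Abelian.Ext.contravariant_sequence_exact₃ (sesShort hf hfg hg) (ModuleCat.of R L) x h
      (add_comm 1 i)
  · rintro ⟨y, rfl⟩
    refine (Abelian.Ext.comp_assoc (Abelian.Ext.mk₀ (ModuleCat.ofHom g)) (sesShort hf hfg hg).extClass
       y (zero_add 1) (add_comm 1 i) (by lia)).symm.trans ?_
    refine (congrArg (fun t => Abelian.Ext.comp (Z := ModuleCat.of R L) t y (add_comm 1 i))
      (sesShort hf hfg hg).comp_extClass).trans ?_
    exact Abelian.Ext.zero_comp (C := ModuleCat.{u} R) ..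

omit hf hfg in
lemma pre_zero_inj : Function.Injective (pre L g 0) := by
  intro x y h
  have h' := congrArg zeroEquiv h
  rw [zeroEquiv_pre, zeroEquiv_pre] at h'
  apply zeroEquiv.injective
  ext n
  obtain ⟨m, rfl⟩ := hg n
  exact (LinearMap.congr_fun h' m)

end LES

lemma subsingleton_injective (N E : Type u) [AddCommGroup N] [Module R N] [AddCommGroup E] [Module R E]
    [Module.Injective R E] (i : ℕ) : Subsingleton (EX R N E (i+1)) := by
  have := Module.injective_object_of_injective_module R E
  exact Abelian.Ext.subsingleton_of_injective (ModuleCat.of R N) (ModuleCat.of R E) i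

lemma subsingleton_projective (N L : Type u) [AddCommGroup N] [Module R N] [AddCommGroup L] [Module R L]
    [Module.Projective R N] (i : ℕ) : Subsingleton (EX R N L (i+1)) := by
  have : Projective (ModuleCat.of R N) := inferInstance
  exact ⟨fun a b => (Abelian.Ext.eq_zero_of_projective a).trans (Abelian.Ext.eq_zero_of_projective b).symm⟩

lemma finite_of_finite [IsNoetherianRing R] [Module.Finite R N] [Module.Finite R L] (i : ℕ) :
    Module.Finite R (EX R N L i) := by
  have : Module.Finite R (ModuleCat.of R N) := ‹Module.Finite R N›
  have : Module.Finite R (ModuleCat.of R L) := ‹Module.Finite R L›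
  exact ModuleCat.finite_ext R (ModuleCat.of R N) (ModuleCat.of R L) i

end EX

end Part2

section Part3
open CategoryTheory

section DirLim

/-- `H` is a direct limit of the `ℕ`-system `G`. -/
structure DL {R : Type u} [CommRing R] (G : ℕ → Type u) [∀ n, AddCommGroup (G n)] [∀ n, Module R (G n)]
    (t : ∀ n m, n ≤ m → G n →ₗ[R] G m) (H : Type u) [AddCommGroup H] [Module R H] where
  ι : ∀ n, G n →ₗ[R] H
  compat : ∀ n m (h : n ≤ m) x, ι m (t n m h x) = ι n x
  surj : ∀ y, ∃ n x, ι n x = y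
  ker : ∀ n x, ι n x = 0 → ∃ m, ∃ h : n ≤ m, t n m h x = 0

namespace DL
variable {R : Type u} [CommRing R] {G : ℕ → Type u} [∀ n, AddCommGroup (G n)] [∀ n, Module R (G n)]
    {t : ∀ n m, n ≤ m → G n →ₗ[R] G m} {H : Type u} [AddCommGroup H] [Module R H]
    {G' : ℕ → Type u} [∀ n, AddCommGroup (G' n)] [∀ n, Module R (G' n)]
    {t' : ∀ n m, n ≤ m → G' n →ₗ[R] G' m} {H' : Type u} [AddCommGroup H'] [Module R H']

lemma wd (D : DL G t H) (D' : DL G' t' H') (η : ∀ n, G n →ₗ[R] G' n)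
    (hη : ∀ n m h x, η m (t n m h x) = t' n m h (η n x)) (n m : ℕ) (x : G n) (y : G m)
    (h : D.ι n x = D.ι m y) : D'.ι n (η n x) = D'.ι m (η m y) := by
  have h1 : D.ι (max n m) (t _ _ (le_max_left n m) x - t _ _ (le_max_right n m) y) = 0 := by
    rw [map_sub, D.compat, D.compat, h, sub_self]
  obtain ⟨k, hk, h2⟩ := D.ker _ _ h1
  have h3 := congrArg (fun z => D'.ι k (η k z)) h2
  simp only [map_zero, hη, map_sub, D'.compat] at h3
  exact sub_eq_zero.1 h3

lemma exists_map (D : DL G t H) (D' : DL G' t' H') (η : ∀ n, G n →ₗ[R] G' n)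
    (hη : ∀ n m h x, η m (t n m h x) = t' n m h (η n x)) :
    ∃ φ : H →ₗ[R] H', ∀ n x, φ (D.ι n x) = D'.ι n (η n x) := by
  choose a b hab using D.surj
  refine ⟨⟨⟨fun y => D'.ι (a y) (η _ (b y)), ?_⟩, ?_⟩, ?_⟩
  · intro x y
    have : D.ι _ (b (x+y)) = D.ι _ (t _ _ (le_max_left (a x) (a y)) (b x) +
        t _ _ (le_max_right (a x) (a y)) (b y)) := by
      rw [map_add, D.compat, D.compat, hab, hab, hab]
    rw [wd D D' η hη _ _ _ _ this]
    simp only [map_add, hη, D'.compat]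
  · intro r x
    have : D.ι _ (b (r • x)) = D.ι _ (r • b x) := by
      rw [map_smul, hab, hab]
    simp only [RingHom.id_apply]
    rw [wd D D' η hη _ _ _ _ this]
    simp only [map_smul]
  · intro n x
    exact wd D D' η hη _ _ _ _ (hab _)

lemma exists_equiv (D : DL G t H) (D' : DL G' t' H') (η : ∀ n, G n →ₗ[R] G' n)
    (hη : ∀ n m h x, η m (t n m h x) = t' n m h (η n x))
    (hinj : ∀ n x, η n x = 0 → ∃ m, ∃ h : n ≤ m, t n m h x = 0)
    (hsurj : ∀ n y, ∃ m, ∃ h : n ≤ m, ∃ x, η m x = t' n m h y) :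
    Nonempty (H ≃ₗ[R] H') := by
  obtain ⟨φ, hφ⟩ := exists_map D D' η hη
  refine ⟨LinearEquiv.ofBijective φ ⟨?_, ?_⟩⟩
  · rw [injective_iff_map_eq_zero]
    intro y hy
    obtain ⟨n, x, rfl⟩ := D.surj y
    rw [hφ] at hy
    obtain ⟨m, h, hm⟩ := D'.ker _ _ hy
    rw [← hη] at hm
    obtain ⟨k, hk, h2⟩ := hinj _ _ hm
    rw [← D.compat n m h, ← D.compat m k hk, h2, map_zero]
  · intro y
    obtain ⟨n, x, rfl⟩ := D'.surj y
    obtain ⟨m, h, z, hz⟩ := hsurj n x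
    exact ⟨D.ι m z, by rw [hφ, hz, D'.compat]⟩

end DL
end DirLim

section LC
variable {R : Type u} [CommRing R] (I : Ideal R)

/-- transition `R/I^m → R/I^n` -/
noncomputable def tq (n m : ℕ) (h : n ≤ m) : (R ⧸ I^m) →ₗ[R] (R ⧸ I^n) :=
  Submodule.mapQ _ _ LinearMap.id (Ideal.pow_le_pow_right h)

/-- the local cohomology module -/
noncomputable abbrev Hc (i : ℕ) (M : Type u) [AddCommGroup M] [Module R M] : Type u :=
  (localCohomology I i).obj (ModuleCat.of R M)

open Limits in
lemma lcDL (i : ℕ) (M : Type u) [AddCommGroup M] [Module R M] :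
    Nonempty (DL (fun n => EX R (R ⧸ I^n) M i) (fun n m h => EX.pre M (tq I n m h) i) (Hc I i M)) := by
  let F := localCohomology.diagram (localCohomology.idealPowersDiagram I) i
  let Y := ModuleCat.of R M
  have := preservesFilteredColimitsOfSize_shrink.{0,u,0,u} (forget (ModuleCat.{u} R))
  have hpF : ∀ F : ℕᵒᵖᵒᵖ ⥤ ModuleCat.{u} R, PreservesColimit F (forget (ModuleCat.{u} R)) :=
    fun F => inferInstance
  let ev := (evaluation (ModuleCat.{u} R) (ModuleCat.{u} R)).obj Y
  have : HasColimit F := inferInstance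
  let c := ev.mapCocone (colimit.cocone F)
  have hc : IsColimit c := isColimitOfPreserves ev (colimit.isColimit F)
  have hpt : c.pt = (localCohomology I i).obj Y := rfl
  let e : ∀ n : ℕ, ((F ⋙ ev).obj (Opposite.op (Opposite.op n))) ≃ₗ[R] EX R (R ⧸ I^n) M i :=
    fun n => extCmp (ModuleCat.of R (R ⧸ I^n)) Y i
  have he : ∀ n m (h : n ≤ m) x, EX.pre M (tq I n m h) i (e n x) =
      e m ((F ⋙ ev).map (homOfLE h).op.op x) := by
    intro n m h x
    exact (extCmp_nat (ModuleCat.ofHom (tq I n m h)) i Y x).symm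
  refine ⟨⟨fun n => (c.ι.app (Opposite.op (Opposite.op n))).hom ∘ₗ (e n).symm.toLinearMap, ?_, ?_, ?_⟩⟩
  · intro n m h x
    obtain ⟨y, rfl⟩ := (e n).surjective x
    rw [he]
    exact Eq.trans (congrArg (c.ι.app (Opposite.op (Opposite.op m))).hom ((e m).symm_apply_apply _)) <| Eq.trans (congrArg (fun f => f.hom y) (c.w (homOfLE h).op.op))
      (congrArg (c.ι.app (Opposite.op (Opposite.op n))).hom ((e n).symm_apply_apply _)).symm
  · intro y
    obtain ⟨j, x, hx⟩ := Concrete.isColimit_exists_rep (F ⋙ ev) hc y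
    refine ⟨j.unop.unop, e _ x, ?_⟩
    exact Eq.trans (congrArg (c.ι.app _).hom ((e _).symm_apply_apply _)) hx
  · intro n x hx
    obtain ⟨y, rfl⟩ := (e n).surjective x
    replace hx := Eq.trans (congrArg (c.ι.app (Opposite.op (Opposite.op n))).hom ((e n).symm_apply_apply y)).symm hx
    have h2 := (IsColimit.eq_iff' hc y 0).1 (hx.trans (map_zero _).symm)
    obtain ⟨j, f, hf⟩ := h2
    refine ⟨j.unop.unop, leOfHom f.unop.unop, ?_⟩
    rw [he]
    rw [map_zero] at hf
    exact (congrArg (e _) hf).trans (map_zero _)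

end LC

end Part3

section Part4
open CategoryTheory

section Gam
variable {R : Type u} [CommRing R] (I : Ideal R)

/-- the `I`-torsion submodule -/
def gam (M : Type u) [AddCommGroup M] [Module R M] : Submodule R M where
  carrier := {x | ∃ n : ℕ, ∀ r ∈ I^n, r • x = 0}
  add_mem' := by
    rintro a b ⟨n, hn⟩ ⟨m, hm⟩
    refine ⟨max n m, fun r hr => ?_⟩
    rw [smul_add, hn r (Ideal.pow_le_pow_right (le_max_left _ _) hr),
      hm r (Ideal.pow_le_pow_right (le_max_right _ _) hr), add_zero]
  zero_mem' := ⟨0, fun r _ => smul_zero r⟩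
  smul_mem' := by
    rintro c x ⟨n, hn⟩
    exact ⟨n, fun r hr => by rw [smul_comm, hn r hr, smul_zero]⟩

/-- `M` is `I`-torsion -/
def IsTors (M : Type u) [AddCommGroup M] [Module R M] : Prop := ∀ x : M, ∃ n : ℕ, ∀ r ∈ I^n, r • x = 0

/-- `M` is `I`-torsion free -/
def TorsFree (M : Type u) [AddCommGroup M] [Module R M] : Prop := ∀ x : M, (∀ r ∈ I, r • x = 0) → x = 0

variable {M : Type u} [AddCommGroup M] [Module R M] {M' : Type u} [AddCommGroup M'] [Module R M']
variable {I}

lemma mem_gam {x : M} : x ∈ gam I M ↔ ∃ n : ℕ, ∀ r ∈ I^n, r • x = 0 := Iff.rfl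

lemma isTors_gam : IsTors I (gam I M) := by
  rintro ⟨x, n, hn⟩
  exact ⟨n, fun r hr => Subtype.ext (hn r hr)⟩

lemma IsTors.of_inj (h : IsTors I M) (f : M' →ₗ[R] M) (hf : Function.Injective f) : IsTors I M' := by
  intro x
  obtain ⟨n, hn⟩ := h (f x)
  exact ⟨n, fun r hr => hf (by rw [map_smul, hn r hr, map_zero])⟩

lemma IsTors.of_surj (h : IsTors I M) (f : M →ₗ[R] M') (hf : Function.Surjective f) : IsTors I M' := by
  intro y
  obtain ⟨x, rfl⟩ := hf y
  obtain ⟨n, hn⟩ := h x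
  exact ⟨n, fun r hr => by rw [← map_smul, hn r hr, map_zero]⟩

lemma TorsFree.of_inj (h : TorsFree I M) (f : M' →ₗ[R] M) (hf : Function.Injective f) : TorsFree I M' := by
  intro x hx
  apply hf
  rw [map_zero]
  exact h _ fun r hr => by rw [← map_smul, hx r hr, map_zero]

lemma TorsFree.pow (h : TorsFree I M) (n : ℕ) : ∀ x : M, (∀ r ∈ I^n, r • x = 0) → x = 0 := by
  induction n with
  | zero => intro x hx; simpa using hx 1 (by simp)
  | succ n ih =>
    intro x hx
    apply h
    intro r hr
    apply ih
    intro s hs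
    rw [← mul_smul]
    exact hx _ (by rw [pow_succ]; exact Ideal.mul_mem_mul hs hr)

lemma TorsFree.gam_eq (h : TorsFree I M) : gam I M = ⊥ := by
  rw [eq_bot_iff]
  rintro x ⟨n, hn⟩
  exact h.pow n x hn

/-- generators criterion -/
lemma pow_smul_of_fg (hI : I.FG) (n : ℕ) (x : M) (h : ∀ r ∈ I, ∃ k, ∀ s ∈ I^k, s • r • x = 0) :
    ∃ k, ∀ r ∈ I^k, r • x = 0 := by
  have h1 : ∀ N : Ideal R, N.FG → N ≤ I → ∃ k, ∀ s ∈ I^k, ∀ r ∈ N, s • r • x = 0 := by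
    intro N hN
    refine Submodule.fg_induction (motive := fun (N : Ideal R) _ => N ≤ I → ∃ k, ∀ s ∈ I^k, ∀ r ∈ N, s • r • x = 0) ?_ ?_ N hN
    · intro r hr
      obtain ⟨k, hk⟩ := h r (hr (Submodule.mem_span_singleton_self r))
      refine ⟨k, fun s hs r' hr' => ?_⟩
      obtain ⟨a, rfl⟩ := Submodule.mem_span_singleton.1 hr'
      rw [smul_eq_mul, mul_smul, smul_comm, hk s hs, smul_zero]
    · intro N1 N2 _ _ h1 h2 h12
      obtain ⟨k1, hk1⟩ := h1 (le_trans le_sup_left h12)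
      obtain ⟨k2, hk2⟩ := h2 (le_trans le_sup_right h12)
      refine ⟨max k1 k2, fun s hs r hr => ?_⟩
      obtain ⟨a, ha, b, hb, rfl⟩ := Submodule.mem_sup.1 hr
      rw [add_smul, smul_add, hk1 s (Ideal.pow_le_pow_right (le_max_left _ _) hs) a ha,
        hk2 s (Ideal.pow_le_pow_right (le_max_right _ _) hs) b hb, add_zero]
  obtain ⟨k, hk⟩ := h1 I hI le_rfl
  refine ⟨k+1, fun r hr => ?_⟩
  rw [pow_succ] at hr
  refine Submodule.mul_induction_on hr (fun s hs t ht => ?_) (fun a b ha hb => ?_)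
  · rw [mul_smul]; exact hk s hs t ht
  · rw [add_smul, ha, hb, add_zero]

lemma fg_tors_bound (N : Submodule R M) (hN : N.FG) (h : ∀ x ∈ N, ∃ n : ℕ, ∀ r ∈ I^n, r • x = 0) :
    ∃ k, ∀ r ∈ I^k, ∀ x ∈ N, r • x = 0 := by
  revert h
  refine Submodule.fg_induction (motive := fun (N : Submodule R M) _ => (∀ x ∈ N, ∃ n : ℕ, ∀ r ∈ I^n, r • x = 0) →
    ∃ k, ∀ r ∈ I^k, ∀ x ∈ N, r • x = 0) ?_ ?_ N hN
  · intro x h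
    obtain ⟨k, hk⟩ := h x (Submodule.mem_span_singleton_self x)
    refine ⟨k, fun s hs y hy => ?_⟩
    obtain ⟨a, rfl⟩ := Submodule.mem_span_singleton.1 hy
    rw [smul_comm, hk s hs, smul_zero]
  · intro N1 N2 _ _ h1 h2 h12
    obtain ⟨k1, hk1⟩ := h1 (fun x hx => h12 x (Submodule.mem_sup_left hx))
    obtain ⟨k2, hk2⟩ := h2 (fun x hx => h12 x (Submodule.mem_sup_right hx))
    refine ⟨max k1 k2, fun s hs r hr => ?_⟩
    obtain ⟨a, ha, b, hb, rfl⟩ := Submodule.mem_sup.1 hr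
    rw [smul_add, hk1 s (Ideal.pow_le_pow_right (le_max_left _ _) hs) a ha,
      hk2 s (Ideal.pow_le_pow_right (le_max_right _ _) hs) b hb, add_zero]

lemma IsTors.bound [Module.Finite R M] (h : IsTors I M) : ∃ k, ∀ r ∈ I^k, ∀ x : M, r • x = 0 := by
  obtain ⟨k, hk⟩ := fg_tors_bound (I := I) (⊤ : Submodule R M) (Module.Finite.fg_top) (fun x _ => h x)
  exact ⟨k, fun r hr x => hk r hr x trivial⟩

lemma torsFree_quot [IsNoetherianRing R] : TorsFree I (M ⧸ gam I M) := by
  intro y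
  obtain ⟨x, rfl⟩ := Submodule.mkQ_surjective _ y
  intro h
  rw [Submodule.mkQ_apply, Submodule.Quotient.mk_eq_zero]
  apply pow_smul_of_fg (IsNoetherian.noetherian I) 0
  intro r hr
  have := h r hr
  rw [← map_smul, Submodule.mkQ_apply, Submodule.Quotient.mk_eq_zero] at this
  exact this

lemma injective_of_retract (E : Type u) [AddCommGroup E] [Module R E] [Module.Injective R E]
    (i : M →ₗ[R] E) (p : E →ₗ[R] M) (h : ∀ x, p (i x) = x) : Module.Injective R M := by
  constructor
  intro X Y _ _ _ _ f hf g
  obtain ⟨k, hk⟩ := Module.Injective.out f hf (i ∘ₗ g)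
  exact ⟨p ∘ₗ k, fun x => by rw [LinearMap.comp_apply, hk, LinearMap.comp_apply, h]⟩

instance injective_gam [IsNoetherianRing R] (E : Type u) [AddCommGroup E] [Module R E] [Module.Injective R E] :
    Module.Injective R (gam I E) := by
  apply Module.Baer.injective
  intro J g
  have hfin : (LinearMap.range g).FG := by
    rw [← Submodule.map_top]; exact (IsNoetherian.noetherian (⊤ : Submodule R J)).map g
  obtain ⟨k, hk⟩ := fg_tors_bound (I := I) (LinearMap.range g) hfin (fun x _ => isTors_gam x)
  obtain ⟨c, hc⟩ := Ideal.exists_pow_inf_eq_pow_smul I (M := R) J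
  have hker : ∀ j : J, (j : R) ∈ I^(c+k) → g j = 0 := by
    intro j hj
    have h1 : (j : R) ∈ I^(c+k) • (⊤ : Submodule R R) ⊓ J := ⟨by simpa using hj, j.2⟩
    rw [hc (c+k) (by omega), Nat.add_sub_cancel_left] at h1
    have h2 : ∀ x ∈ I^k • (I^c • (⊤ : Submodule R R) ⊓ J), ∃ hx : x ∈ J, g ⟨x, hx⟩ = 0 := by
      intro x hx
      refine Submodule.smul_induction_on hx ?_ ?_
      · intro r hr n hn
        refine ⟨J.smul_mem _ hn.2, ?_⟩
        exact (map_smul g r ⟨n, hn.2⟩).trans (hk r hr _ ⟨_, rfl⟩)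
      · rintro x y ⟨hx, hx'⟩ ⟨hy, hy'⟩
        refine ⟨J.add_mem hx hy, ?_⟩
        have := map_add g ⟨x, hx⟩ ⟨y, hy⟩
        rw [hx', hy', add_zero] at this
        exact this
    exact (h2 _ h1).2
  let q : J →ₗ[R] (R ⧸ I^(c+k)) := (I^(c+k)).mkQ ∘ₗ J.subtype
  have hq : LinearMap.ker q ≤ LinearMap.ker g := by
    intro j hj
    apply hker
    exact (Submodule.Quotient.mk_eq_zero _).1 hj
  obtain ⟨h, hh⟩ := Module.Injective.out ((LinearMap.ker q).liftQ q le_rfl)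
    (LinearMap.ker_eq_bot.1 (Submodule.ker_liftQ_eq_bot _ _ _ le_rfl))
    ((gam I E).subtype ∘ₗ (LinearMap.ker q).liftQ g hq)
  refine ⟨(h ∘ₗ (I^(c+k)).mkQ).codRestrict _ ?_, ?_⟩
  · intro x
    refine ⟨c+k, fun r hr => ?_⟩
    rw [LinearMap.comp_apply, ← map_smul, ← map_smul,
      show (I^(c+k)).mkQ (r • x) = 0 from (Submodule.Quotient.mk_eq_zero _).2 (Ideal.mul_mem_right _ _ hr), map_zero]
  · intro x hx
    apply Subtype.ext
    exact hh (Submodule.Quotient.mk ⟨x, hx⟩)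

/-- embed in an injective -/
lemma exists_injective_embedding (M : Type u) [AddCommGroup M] [Module R M] :
    ∃ (E : ModuleCat.{u} R) (f : M →ₗ[R] E), Module.Injective R E ∧ Function.Injective f := by
  let X := ModuleCat.of R M
  refine ⟨Injective.under (C := ModuleCat.{u} R) X, (Injective.ι X).hom, ?_, ?_⟩
  · exact @Module.injective_module_of_injective_object R _ _ _ _ (Injective.injective_under X)
  · exact (ModuleCat.mono_iff_injective _).1 inferInstance

/-- embed torsion-free in a torsion-free injective -/
lemma exists_injective_embedding_torsFree [IsNoetherianRing R] (M : Type u) [AddCommGroup M] [Module R M]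
    (hM : TorsFree I M) :
    ∃ (E : ModuleCat.{u} R) (f : M →ₗ[R] E), Module.Injective R E ∧ Function.Injective f ∧ TorsFree I E := by
  obtain ⟨E, f, hE, hf⟩ := exists_injective_embedding (R := R) M
  obtain ⟨r, hr⟩ := (injective_gam (I := I) E).out (gam I E).subtype Subtype.val_injective LinearMap.id
  let p : E →ₗ[R] LinearMap.ker r := (LinearMap.id - (gam I E).subtype ∘ₗ r).codRestrict _ (by
    intro x
    have := hr (r x)
    simp at this
    simp [this])
  have hp : ∀ x, (p x : E) = x - r x := fun x => rfl
  refine ⟨ModuleCat.of R (LinearMap.ker r), p ∘ₗ f, ?_, ?_, ?_⟩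
  · refine injective_of_retract E (LinearMap.ker r).subtype p ?_
    intro x
    apply Subtype.ext
    rw [hp]
    simp
  · rw [injective_iff_map_eq_zero]
    intro x hx
    have h1 : f x = r (f x) := by
      have := congrArg Subtype.val hx
      rw [LinearMap.comp_apply, hp] at this
      exact sub_eq_zero.1 this
    obtain ⟨n, hn⟩ := (r (f x)).2
    refine hM.pow n x fun s hs => hf ?_
    rw [map_smul, h1, hn s hs, map_zero]
  · rintro ⟨x, hx⟩ h
    have hx2 : x ∈ gam I E := ⟨1, fun s hs => congrArg Subtype.val (h s (by simpa using hs))⟩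
    have := hr ⟨x, hx2⟩
    apply Subtype.ext
    have h3 : r x = 0 := hx
    simp [h3] at this
    exact (congrArg Subtype.val this).symm

end Gam

end Part4

section Part5
open CategoryTheory

section LC2
variable {R : Type u} [CommRing R] {I : Ideal R}
variable {M : Type u} [AddCommGroup M] [Module R M] {L : Type u} [AddCommGroup L] [Module R L]

lemma tq_mk (n m : ℕ) (h : n ≤ m) (r : R) : tq I n m h (Submodule.Quotient.mk r) = Submodule.Quotient.mk r := rfl

/-- hom from cyclic module -/
noncomputable def cycHom (J : Ideal R) (x : M) (hx : ∀ r ∈ J, r • x = 0) : (R ⧸ J) →ₗ[R] M :=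
  Submodule.liftQ J (LinearMap.toSpanSingleton R M x) (fun r hr => hx r hr)

lemma cycHom_mk (J : Ideal R) (x : M) (hx : ∀ r ∈ J, r • x = 0) (r : R) :
    cycHom J x hx (Submodule.Quotient.mk r) = r • x := rfl

lemma cyc_ext {J : Ideal R} {f g : (R ⧸ J) →ₗ[R] M} (h : f (Submodule.Quotient.mk 1) = g (Submodule.Quotient.mk 1)) :
    f = g := by
  apply Submodule.linearMap_qext
  ext
  exact h

lemma cyc_kill {J : Ideal R} (f : (R ⧸ J) →ₗ[R] M) (r : R) (hr : r ∈ J) :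
    r • f (Submodule.Quotient.mk 1) = 0 := by
  rw [← map_smul]
  have : r • (Submodule.Quotient.mk 1 : R ⧸ J) = 0 := by
    rw [← Submodule.Quotient.mk_smul, Submodule.Quotient.mk_eq_zero]; simpa using hr
  rw [this, map_zero]

lemma lcZero : Nonempty (Hc I 0 M ≃ₗ[R] gam I M) := by
  obtain ⟨D⟩ := lcDL I 0 M
  let ι : ∀ n, EX R (R ⧸ I^n) M 0 →ₗ[R] gam I M := fun n =>
    LinearMap.codRestrict (gam I M) ((LinearMap.applyₗ (Submodule.Quotient.mk 1 : R ⧸ I^n)) ∘ₗ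
      (EX.zeroEquiv (R := R) (N := R ⧸ I^n) (L := M)).toLinearMap)
    (fun x => ⟨n, fun r hr => cyc_kill _ r hr⟩)
  have hι : ∀ n x, (ι n x : M) = EX.zeroEquiv x (Submodule.Quotient.mk 1) := fun n x => rfl
  let D' : DL (fun n => EX R (R ⧸ I^n) M 0) (fun n m h => EX.pre M (tq I n m h) 0) (gam I M) :=
    { ι := ι
      compat := by
        intro n m h x
        apply Subtype.ext
        rw [hι, hι, EX.zeroEquiv_pre]
        rfl
      surj := by
        rintro ⟨x, n, hn⟩
        refine ⟨n, EX.zeroEquiv.symm (cycHom _ x hn), ?_⟩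
        apply Subtype.ext
        rw [hι, LinearEquiv.apply_symm_apply, cycHom_mk, one_smul]
      ker := by
        intro n x hx
        refine ⟨n, le_rfl, ?_⟩
        have h := congrArg Subtype.val hx
        rw [hι] at h
        have : x = 0 := by
          apply EX.zeroEquiv.injective
          rw [map_zero]
          exact cyc_ext h
        rw [this, map_zero] }
  exact DL.exists_equiv D D' (fun n => LinearMap.id) (fun _ _ _ _ => rfl) (fun n x hx => ⟨n, le_rfl, by
    rw [show x = 0 from hx, map_zero]⟩)
    (fun n y => ⟨n, le_rfl, _, rfl⟩)

lemma EX.smul_eq_zero_left {N : Type u} [AddCommGroup N] [Module R N] (r : R) (h : ∀ x : N, r • x = 0) (i : ℕ)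
    (x : EX R N L i) : r • x = 0 := by
  have h1 := LinearMap.congr_fun (EX.pre_smul_id (L := L) (N := N) r i) x
  have h2 : (r • LinearMap.id : N →ₗ[R] N) = (0 : R) • LinearMap.id := by
    ext x; simp [h]
  rw [h2, EX.pre_smul_id, zero_smul] at h1
  simpa using h1.symm

lemma EX.smul_eq_zero_right {N : Type u} [AddCommGroup N] [Module R N] (r : R) (h : ∀ x : L, r • x = 0) (i : ℕ)
    (x : EX R N L i) : r • x = 0 := by
  have h1 := LinearMap.congr_fun (EX.post_smul_id (L := L) (N := N) r i) x
  have h2 : (r • LinearMap.id : L →ₗ[R] L) = (0 : R) • LinearMap.id := by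
    ext x; simp [h]
  rw [h2, EX.post_smul_id, zero_smul] at h1
  simpa using h1.symm

lemma quot_kill {J : Ideal R} (r : R) (hr : r ∈ J) (x : R ⧸ J) : r • x = 0 := by
  obtain ⟨s, rfl⟩ := Submodule.Quotient.mk_surjective _ x
  rw [← Submodule.Quotient.mk_smul, Submodule.Quotient.mk_eq_zero]
  exact Ideal.mul_mem_right _ _ hr

lemma isTors_Hc (i : ℕ) : IsTors I (Hc I i M) := by
  obtain ⟨D⟩ := lcDL I i M
  intro y
  obtain ⟨n, x, rfl⟩ := D.surj y
  refine ⟨n, fun r hr => ?_⟩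
  rw [← map_smul, EX.smul_eq_zero_left r (quot_kill r hr), map_zero]

lemma IsTors.support (h : IsTors I M) : Module.support R M ⊆ PrimeSpectrum.zeroLocus (I : Set R) := by
  intro p hp
  rw [Module.mem_support_iff'] at hp
  obtain ⟨m, hm⟩ := hp
  obtain ⟨n, hn⟩ := h m
  intro r hr
  by_contra hrp
  have : r^n ∉ p.asIdeal := fun h => hrp (p.2.mem_of_pow_mem _ h)
  exact hm _ this (hn _ (Ideal.pow_mem_pow hr n))

/-- all Ext finite -/
def ExtFin (N L : Type u) [AddCommGroup N] [Module R N] [AddCommGroup L] [Module R L] : Prop :=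
  ∀ i, Module.Finite R (EX R N L i)

lemma isCofinite_Hc_iff (i : ℕ) : IsCofinite I ((localCohomology I i).obj (ModuleCat.of R M)) ↔
    ExtFin (R := R) (R ⧸ I) (Hc I i M) := by
  have key : ∀ j, Module.Finite R (((Ext R (ModuleCat.{u} R) j).obj (Opposite.op (ModuleCat.of R (R ⧸ I)))).obj
      ((localCohomology I i).obj (ModuleCat.of R M))) ↔ Module.Finite R (EX R (R ⧸ I) (Hc I i M) j) :=
    fun j => Module.Finite.equiv_iff (extCmp (ModuleCat.of R (R ⧸ I)) ((localCohomology I i).obj (ModuleCat.of R M)) j)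
  constructor
  · intro h j
    exact (key j).1 (h.2 j)
  · intro h
    exact ⟨(isTors_Hc i).support, fun j => (key j).2 (h j)⟩

lemma ExtFin.congr {N L L' : Type u} [AddCommGroup N] [Module R N] [AddCommGroup L] [Module R L]
    [AddCommGroup L'] [Module R L'] (e : L ≃ₗ[R] L') (h : ExtFin (R := R) N L) : ExtFin (R := R) N L' :=
  fun i => have := h i; Module.Finite.equiv (EX.postEquiv e i)

section
variable {A B C : Type u} [AddCommGroup A] [Module R A] [AddCommGroup B] [Module R B]
  [AddCommGroup C] [Module R C] {f : A →ₗ[R] B} {g : B →ₗ[R] C}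

lemma EX.δ_inj {N : Type u} [AddCommGroup N] [Module R N]
    (hf : Function.Injective f) (hfg : Function.Exact f g) (hg : Function.Surjective g) (i : ℕ)
    (h : Subsingleton (EX R N B i)) : Function.Injective (EX.δ N hf hfg hg i) := by
  rw [injective_iff_map_eq_zero]
  intro x hx
  obtain ⟨y, rfl⟩ := (EX.exact_right hf hfg hg i x).1 hx
  rw [Subsingleton.elim y 0, map_zero]

lemma EX.δ_surj {N : Type u} [AddCommGroup N] [Module R N]
    (hf : Function.Injective f) (hfg : Function.Exact f g) (hg : Function.Surjective g) (i : ℕ)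
    (h : Subsingleton (EX R N B (i+1))) : Function.Surjective (EX.δ N hf hfg hg i) := by
  intro y
  exact (EX.exact_left hf hfg hg i y).1 (Subsingleton.elim _ _)

lemma EX.δ'_inj {N : Type u} [AddCommGroup N] [Module R N]
    (hf : Function.Injective f) (hfg : Function.Exact f g) (hg : Function.Surjective g) (i : ℕ)
    (h : Subsingleton (EX R B N i)) : Function.Injective (EX.δ' N hf hfg hg i) := by
  rw [injective_iff_map_eq_zero]
  intro x hx
  obtain ⟨y, rfl⟩ := (EX.exact_right' hf hfg hg i x).1 hx
  rw [Subsingleton.elim y 0, map_zero]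

lemma EX.δ'_surj {N : Type u} [AddCommGroup N] [Module R N]
    (hf : Function.Injective f) (hfg : Function.Exact f g) (hg : Function.Surjective g) (i : ℕ)
    (h : Subsingleton (EX R B N (i+1))) : Function.Surjective (EX.δ' N hf hfg hg i) := by
  intro y
  exact (EX.exact_left' hf hfg hg i y).1 (Subsingleton.elim _ _)

/-- dimension shifting -/
lemma lcShift (hf : Function.Injective f) (hfg : Function.Exact f g) (hg : Function.Surjective g) (i : ℕ)
    (h0 : ∀ n, Subsingleton (EX R (R ⧸ I^n) B i)) (h1 : ∀ n, Subsingleton (EX R (R ⧸ I^n) B (i+1))) :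
    Nonempty (Hc I i C ≃ₗ[R] Hc I (i+1) A) := by
  obtain ⟨D⟩ := lcDL I i C
  obtain ⟨D'⟩ := lcDL I (i+1) A
  refine DL.exists_equiv D D' (fun n => EX.δ (R ⧸ I^n) hf hfg hg i)
    (fun n m h x => (EX.pre_δ hf hfg hg _ i x).symm) ?_ ?_
  · intro n x hx
    refine ⟨n, le_rfl, ?_⟩
    rw [EX.δ_inj hf hfg hg i (h0 n) (hx.trans (map_zero _).symm), map_zero]
  · intro n y
    exact ⟨n, le_rfl, EX.δ_surj hf hfg hg i (h1 n) _⟩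

end

lemma EX.subsingleton_zero_of_torsFree (hM : TorsFree I M) (n : ℕ) : Subsingleton (EX R (R ⧸ I^n) M 0) := by
  rw [subsingleton_iff_forall_eq 0]
  intro x
  apply EX.zeroEquiv.injective
  rw [map_zero]
  apply cyc_ext
  exact hM.pow n _ (fun r hr => cyc_kill _ r hr)

lemma exact_mkQ (N : Submodule R M) : Function.Exact N.subtype N.mkQ := by
  rw [LinearMap.exact_iff]; simp

variable [IsNoetherianRing R]

lemma EX.tors_dies (i : ℕ) : ∀ (T : Type u) [AddCommGroup T] [Module R T] (_ : IsTors I T) (n : ℕ)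
    (x : EX R (R ⧸ I^n) T (i+1)), ∃ m, ∃ h : n ≤ m, EX.pre T (tq I n m h) (i+1) x = 0 := by
  induction i with
  | zero =>
    intro T _ _ hT n x
    obtain ⟨E, f, hE, hf⟩ := exists_injective_embedding (R := R) T
    let f' : T →ₗ[R] gam I E := f.codRestrict _ (fun x => by
      obtain ⟨n, hn⟩ := hT x
      exact ⟨n, fun r hr => by rw [← map_smul, hn r hr, map_zero]⟩)
    have hf' : Function.Injective f' := fun a b h => hf (congrArg Subtype.val h)
    have hex : Function.Exact f' (LinearMap.range f').mkQ := by rw [LinearMap.exact_iff]; simp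
    have hsurj := Submodule.mkQ_surjective (LinearMap.range f')
    obtain ⟨y, rfl⟩ := EX.δ_surj hf' hex hsurj 0 (EX.subsingleton_injective _ _ 0) x
    obtain ⟨g, hg⟩ := hsurj (EX.zeroEquiv y (Submodule.Quotient.mk 1))
    obtain ⟨m, hm⟩ := isTors_gam g
    refine ⟨max n m, le_max_left _ _, ?_⟩
    have hm' : ∀ r ∈ I^(max n m), r • g = 0 := fun r hr => hm r (Ideal.pow_le_pow_right (le_max_right _ _) hr)
    rw [EX.pre_δ]
    have : EX.pre _ (tq I n (max n m) (le_max_left _ _)) 0 y =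
      EX.post _ (LinearMap.range f').mkQ 0 (EX.zeroEquiv.symm (cycHom _ g hm')) := by
      apply EX.zeroEquiv.injective
      rw [EX.zeroEquiv_pre, EX.zeroEquiv_post, LinearEquiv.apply_symm_apply]
      apply cyc_ext
      rw [LinearMap.comp_apply, LinearMap.comp_apply, cycHom_mk, tq_mk, one_smul, hg]
    rw [this]
    exact (EX.exact_right hf' hex hsurj 0).apply_apply_eq_zero _
  | succ i ih =>
    intro T _ _ hT n x
    obtain ⟨E, f, hE, hf⟩ := exists_injective_embedding (R := R) T
    let f' : T →ₗ[R] gam I E := f.codRestrict _ (fun x => by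
      obtain ⟨n, hn⟩ := hT x
      exact ⟨n, fun r hr => by rw [← map_smul, hn r hr, map_zero]⟩)
    have hf' : Function.Injective f' := fun a b h => hf (congrArg Subtype.val h)
    have hex : Function.Exact f' (LinearMap.range f').mkQ := by rw [LinearMap.exact_iff]; simp
    have hsurj := Submodule.mkQ_surjective (LinearMap.range f')
    obtain ⟨y, rfl⟩ := EX.δ_surj hf' hex hsurj (i+1) (EX.subsingleton_injective _ _ _) x
    obtain ⟨m, h, hm⟩ := ih (gam I E ⧸ LinearMap.range f') (isTors_gam.of_surj _ hsurj) n y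
    refine ⟨m, h, ?_⟩
    rw [EX.pre_δ, hm, map_zero]

lemma lcModGam (i : ℕ) : Nonempty (Hc I (i+1) M ≃ₗ[R] Hc I (i+1) (M ⧸ gam I M)) := by
  obtain ⟨D⟩ := lcDL I (i+1) M
  obtain ⟨D'⟩ := lcDL I (i+1) (M ⧸ gam I M)
  have hf : Function.Injective (gam I M).subtype := Subtype.val_injective
  have hex := exact_mkQ (gam I M)
  have hg := Submodule.mkQ_surjective (gam I M)
  refine DL.exists_equiv D D' (fun n => EX.post _ (gam I M).mkQ (i+1))
    (fun n m h x => (EX.pre_post _ _ _ _).symm) ?_ ?_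
  · intro n x hx
    obtain ⟨y, rfl⟩ := (EX.exact_mid hf hex hg (i+1) x).1 hx
    obtain ⟨m, h, hm⟩ := EX.tors_dies i _ isTors_gam n y
    refine ⟨m, h, ?_⟩
    rw [EX.pre_post, hm, map_zero]
  · intro n y
    obtain ⟨m, h, hm⟩ := EX.tors_dies (i+1) _ isTors_gam n (EX.δ _ hf hex hg (i+1) y)
    refine ⟨m, h, ?_⟩
    rw [EX.pre_δ] at hm
    exact (EX.exact_right hf hex hg (i+1) _).1 hm

lemma lcTorsFree_zero (hM : TorsFree I M) : Subsingleton (Hc I 0 M) := by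
  obtain ⟨e⟩ := lcZero (I := I) (M := M)
  rw [hM.gam_eq] at e
  exact e.toEquiv.subsingleton

end LC2

end Part5

section Part6
open CategoryTheory

section Serre
variable {R : Type u} [CommRing R] [IsNoetherianRing R] {I : Ideal R}
variable {L : Type u} [AddCommGroup L] [Module R L]

lemma exact_ker {A B : Type u} [AddCommGroup A] [Module R A] [AddCommGroup B] [Module R B] (f : A →ₗ[R] B) :
    Function.Exact (LinearMap.ker f).subtype f := by
  rw [LinearMap.exact_iff]; simp

lemma fin_mid {A B C : Type u} [AddCommGroup A] [Module R A] [AddCommGroup B] [Module R B]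
    [AddCommGroup C] [Module R C] (f : A →ₗ[R] B) (g : B →ₗ[R] C) (h : Function.Exact f g)
    (hA : Module.Finite R A) (hC : Module.Finite R C) : Module.Finite R B := by
  have := isNoetherian_of_isNoetherianRing_of_finite R A
  have := isNoetherian_of_isNoetherianRing_of_finite R C
  have := isNoetherian_of_range_eq_ker f g ((LinearMap.exact_iff.1 h).symm)
  infer_instance

omit [IsNoetherianRing R] in
lemma sub_mid {A B C : Type u} [AddCommGroup A] [Module R A] [AddCommGroup B] [Module R B]
    [AddCommGroup C] [Module R C] (f : A →ₗ[R] B) (g : B →ₗ[R] C) (h : Function.Exact f g)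
    (hA : Subsingleton A) (hC : Subsingleton C) : Subsingleton B := by
  rw [subsingleton_iff_forall_eq 0]
  intro b
  obtain ⟨a, rfl⟩ := (h b).1 (Subsingleton.elim _ _)
  rw [Subsingleton.elim a 0, map_zero]

omit [IsNoetherianRing R] in
lemma exact_zero_left {B C : Type u} [AddCommGroup B] [Module R B]
    [AddCommGroup C] [Module R C] (g : B →ₗ[R] C) (h : Function.Injective g) :
    Function.Exact (0 : PUnit.{u+1} →ₗ[R] B) g := by
  intro b
  constructor
  · intro hb
    exact ⟨0, (h (hb.trans (map_zero g).symm)).symm⟩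
  · rintro ⟨_, rfl⟩; simp

lemma EX.serre (Q : ∀ (X : Type u) [AddCommGroup X] [Module R X], Prop)
    (hmid : ∀ (A B C : Type u) [AddCommGroup A] [Module R A] [AddCommGroup B] [Module R B]
    [AddCommGroup C] [Module R C] (f : A →ₗ[R] B) (g : B →ₗ[R] C), Function.Exact f g → Q A → Q C → Q B)
    (hsub : ∀ (A : Type u) [AddCommGroup A] [Module R A], Subsingleton A → Q A) (n : ℕ)
    (h : ∀ j ≤ n, Q (EX R (R ⧸ I) L j)) (j : ℕ) :
    j ≤ n → ∀ (N : Type u) [AddCommGroup N] [Module R N], Module.Finite R N → ∀ k,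
      (∀ r ∈ I^k, ∀ x : N, r • x = 0) → Q (EX R N L j) := by
  have hinj : ∀ (B C : Type u) [AddCommGroup B] [Module R B]
    [AddCommGroup C] [Module R C] (g : B →ₗ[R] C), Function.Injective g → Q C → Q B := fun B C _ _ _ _ g hg hC =>
    hmid PUnit.{u+1} B C 0 g (exact_zero_left g hg) (hsub _ inferInstance) hC
  induction j with
  | zero =>
    intro hj N _ _ hN
    induction hN using IsNoetherianRing.induction_on_isQuotientEquivQuotientPrime R with
    | subsingleton N =>
      intro k hk
      apply hsub
      have : Subsingleton (N →ₗ[R] L) := ⟨fun a b => by ext x; rw [Subsingleton.elim x 0, map_zero, map_zero]⟩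
      exact EX.zeroEquiv.toEquiv.subsingleton
    | quotient N p e =>
      intro k hk
      have hIp : I ≤ p.1 := by
        have : I^k ≤ p.1 := by
          intro r hr
          have := hk r hr (e.symm (Submodule.Quotient.mk 1))
          rw [← map_smul, LinearEquiv.map_eq_zero_iff, ← Submodule.Quotient.mk_smul, Submodule.Quotient.mk_eq_zero] at this
          simpa using this
        exact p.2.le_of_pow_le this
      refine hinj _ _ (EX.preEquiv e.symm 0).toLinearMap (LinearEquiv.injective _) ?_
      exact hinj _ _ (EX.pre L (Submodule.factor hIp) 0) (EX.pre_zero_inj (Submodule.factor_surjective hIp)) (h 0 hj)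
    | exact N1 N2 N3 f g hf hg hfg h1 h3 =>
      intro k hk
      refine hmid _ _ _ _ _ (EX.exact_mid' hf hfg hg 0) (h3 k ?_) (h1 k ?_)
      · intro r hr x
        obtain ⟨y, rfl⟩ := hg x
        rw [← map_smul, hk r hr, map_zero]
      · intro r hr x
        apply hf
        rw [map_smul, hk r hr, map_zero]
  | succ j ih =>
    intro hj N _ _ hN
    induction hN using IsNoetherianRing.induction_on_isQuotientEquivQuotientPrime R with
    | subsingleton N =>
      intro k hk
      apply hsub
      exact EX.subsingleton_projective N L j
    | quotient N p e =>
      intro k hk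
      have hIp : I ≤ p.1 := by
        have : I^k ≤ p.1 := by
          intro r hr
          have := hk r hr (e.symm (Submodule.Quotient.mk 1))
          rw [← map_smul, LinearEquiv.map_eq_zero_iff, ← Submodule.Quotient.mk_smul, Submodule.Quotient.mk_eq_zero] at this
          simpa using this
        exact p.2.le_of_pow_le this
      refine hinj _ _ (EX.preEquiv e.symm _).toLinearMap (LinearEquiv.injective _) ?_
      have hs := (Submodule.factor_surjective hIp)
      refine hmid _ _ _ _ _ (EX.exact_left' Subtype.val_injective (exact_ker _) hs j) ?_ (h (j+1) hj)
      refine ih (by omega) _ inferInstance 1 ?_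
      rintro r hr ⟨x, hx⟩
      apply Subtype.ext
      exact quot_kill r (by simpa using hr) x
    | exact N1 N2 N3 f g hf hg hfg h1 h3 =>
      intro k hk
      refine hmid _ _ _ _ _ (EX.exact_mid' hf hfg hg (j+1)) (h3 k ?_) (h1 k ?_)
      · intro r hr x
        obtain ⟨y, rfl⟩ := hg x
        rw [← map_smul, hk r hr, map_zero]
      · intro r hr x
        apply hf
        rw [map_smul, hk r hr, map_zero]

lemma EX.finite_serre (n : ℕ) (h : ∀ j ≤ n, Module.Finite R (EX R (R ⧸ I) L j)) (j : ℕ) (hj : j ≤ n)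
    (N : Type u) [AddCommGroup N] [Module R N] [hN : Module.Finite R N] (k : ℕ)
    (hk : ∀ r ∈ I^k, ∀ x : N, r • x = 0) : Module.Finite R (EX R N L j) :=
  EX.serre (fun X => Module.Finite R X) (fun A B C _ _ _ _ _ _ f g h => fin_mid f g h)
    (fun A _ _ h => inferInstance) n h j hj N hN k hk

lemma EX.subsingleton_serre (n : ℕ) (h : ∀ j ≤ n, Subsingleton (EX R (R ⧸ I) L j)) (j : ℕ) (hj : j ≤ n)
    (N : Type u) [AddCommGroup N] [Module R N] [hN : Module.Finite R N] (k : ℕ)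
    (hk : ∀ r ∈ I^k, ∀ x : N, r • x = 0) : Subsingleton (EX R N L j) :=
  EX.serre (fun X => Subsingleton X) (fun A B C _ _ _ _ _ _ f g h => sub_mid f g h)
    (fun A _ _ h => inferInstance) n h j hj N hN k hk

section
variable {A B C : Type u} [AddCommGroup A] [Module R A] [AddCommGroup B] [Module R B]
  [AddCommGroup C] [Module R C] {f : A →ₗ[R] B} {g : B →ₗ[R] C} {N : Type u} [AddCommGroup N] [Module R N]

lemma ExtFin.mid (hf : Function.Injective f) (hfg : Function.Exact f g) (hg : Function.Surjective g)
    (hA : ExtFin (R := R) N A) (hC : ExtFin (R := R) N C) : ExtFin (R := R) N B := fun i =>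
  fin_mid _ _ (EX.exact_mid hf hfg hg i) (hA i) (hC i)

lemma ExtFin.right (hf : Function.Injective f) (hfg : Function.Exact f g) (hg : Function.Surjective g)
    (hA : ExtFin (R := R) N A) (hB : ExtFin (R := R) N B) : ExtFin (R := R) N C := fun i =>
  fin_mid _ _ (EX.exact_right hf hfg hg i) (hB i) (hA (i+1))

lemma EX.fin_zero_left (hf : Function.Injective f) (hB : Module.Finite R (EX R N B 0)) :
    Module.Finite R (EX R N A 0) :=
  fin_mid _ _ (exact_zero_left _ (EX.post_zero_inj hf)) inferInstance hB

lemma ExtFin.left (hf : Function.Injective f) (hfg : Function.Exact f g) (hg : Function.Surjective g)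
    (hB : ExtFin (R := R) N B) (hC : ExtFin (R := R) N C) : ExtFin (R := R) N A
  | 0 => EX.fin_zero_left hf (hB 0)
  | i+1 => fin_mid _ _ (EX.exact_left hf hfg hg i) (hC i) (hB (i+1))

lemma EX.fin_one_left (hf : Function.Injective f) (hfg : Function.Exact f g) (hg : Function.Surjective g) (i : ℕ)
    (hC : Module.Finite R (EX R N C i)) (hB : Module.Finite R (EX R N B (i+1))) :
    Module.Finite R (EX R N A (i+1)) := fin_mid _ _ (EX.exact_left hf hfg hg i) hC hB

lemma EX.fin_right (hf : Function.Injective f) (hfg : Function.Exact f g) (hg : Function.Surjective g) (i : ℕ)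
    (hB : Module.Finite R (EX R N B i)) (hA : Module.Finite R (EX R N A (i+1))) :
    Module.Finite R (EX R N C i) := fin_mid _ _ (EX.exact_right hf hfg hg i) hB hA

omit [IsNoetherianRing R] in
lemma EX.sub_right (hf : Function.Injective f) (hfg : Function.Exact f g) (hg : Function.Surjective g) (i : ℕ)
    (hB : Subsingleton (EX R N B i)) (hA : Subsingleton (EX R N A (i+1))) :
    Subsingleton (EX R N C i) := sub_mid _ _ (EX.exact_right hf hfg hg i) hB hA

lemma ExtFin.of_finite [Module.Finite R N] [Module.Finite R A] : ExtFin (R := R) N A :=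
  fun i => EX.finite_of_finite i

omit [IsNoetherianRing R] in
lemma ExtFin.of_subsingleton (h : ∀ i, Subsingleton (EX R N A i)) : ExtFin (R := R) N A :=
  fun i => have := h i; inferInstance

/-- if `r` kills `N` and is bijective on `L` then Ext vanish -/
lemma EX.subsingleton_of_unit (r : R) (k : ℕ) (hN : ∀ x : N, r^k • x = 0)
    (hA : Function.Bijective (LinearMap.lsmul R A r)) (i : ℕ) : Subsingleton (EX R N A i) := by
  rw [subsingleton_iff_forall_eq 0]
  intro x
  let e := EX.postEquiv (R := R) (N := N) (LinearEquiv.ofBijective _ hA) i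
  have he : ∀ x, e x = r • x := by
    intro x
    exact LinearMap.congr_fun (EX.post_smul_id (R := R) (N := N) (L := A) r i) x
  have h2 : ∀ n : ℕ, ∀ x : EX R N A i, r^n • x = 0 → x = 0 := by
    intro n
    induction n with
    | zero => intro x hx; simpa using hx
    | succ n ih =>
      intro x hx
      apply ih
      apply e.injective
      rw [he, map_zero, smul_smul, ← pow_succ']
      exact hx
  exact h2 k x (EX.smul_eq_zero_left _ hN i x)
end

end Serre

end Part6

section Part7
open CategoryTheory

section PartA
variable {R : Type u} [CommRing R] [IsNoetherianRing R] {I : Ideal R}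

lemma lcTors_succ {T : Type u} [AddCommGroup T] [Module R T] (hT : IsTors I T) (i : ℕ) :
    Subsingleton (Hc I (i+1) T) := by
  obtain ⟨D⟩ := lcDL I (i+1) T
  rw [subsingleton_iff_forall_eq 0]
  intro y
  obtain ⟨n, x, rfl⟩ := D.surj y
  obtain ⟨m, h, hm⟩ := EX.tors_dies i T hT n x
  rw [← D.compat n m h, hm, map_zero]

lemma lcTors_zero {T : Type u} [AddCommGroup T] [Module R T] (hT : IsTors I T) :
    Nonempty (Hc I 0 T ≃ₗ[R] T) := by
  obtain ⟨e⟩ := lcZero (I := I) (M := T)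
  have : gam I T = ⊤ := by rw [eq_top_iff]; intro x _; exact hT x
  exact ⟨e.trans ((LinearEquiv.ofEq _ _ this).trans Submodule.topEquiv)⟩

lemma extFin_lcZero {M : Type u} [AddCommGroup M] [Module R M] [Module.Finite R M] :
    ExtFin (R := R) (R ⧸ I) (Hc I 0 M) := by
  obtain ⟨e⟩ := lcZero (I := I) (M := M)
  exact ExtFin.congr e.symm ExtFin.of_finite

lemma ExtFin.of_sub {N A : Type u} [AddCommGroup N] [Module R N] [AddCommGroup A] [Module R A] [Subsingleton A] :
    ExtFin (R := R) N A := by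
  apply ExtFin.of_subsingleton
  intro i
  rw [subsingleton_iff_forall_eq 0]
  intro x
  have := EX.smul_eq_zero_right (R := R) (N := N) (L := A) 1 (fun x => Subsingleton.elim _ _) i x
  rwa [one_smul] at this

lemma partA (x : R) (hx : I.radical = Ideal.span {x}) (M : Type u) [AddCommGroup M] [Module R M]
    [Module.Finite R M] (i : ℕ) : ExtFin (R := R) (R ⧸ I) (Hc I i M) := by
  rcases i with _ | i
  · exact extFin_lcZero
  obtain ⟨e⟩ := lcModGam (I := I) (M := M) i
  refine ExtFin.congr e.symm ?_
  let M' := M ⧸ gam I M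
  have htf : TorsFree I M' := torsFree_quot
  let N := LocalizedModule (Submonoid.powers x) M'
  let f : M' →ₗ[R] N := LocalizedModule.mkLinearMap (Submonoid.powers x) M'
  have hIx : ∀ n, I^n ≤ Ideal.span {x^n} := by
    intro n
    rw [← Ideal.span_singleton_pow]
    exact Ideal.pow_right_mono (hx ▸ Ideal.le_radical) n
  have hkill : ∀ (A : Type u) [AddCommGroup A] [Module R A] (a : A) (n : ℕ), x^n • a = 0 → ∀ r ∈ I^n, r • a = 0 := by
    intro A _ _ a n h r hr
    obtain ⟨s, rfl⟩ := Ideal.mem_span_singleton'.1 (hIx n hr)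
    rw [mul_smul, h, smul_zero]
  have hf : Function.Injective f := by
    rw [injective_iff_map_eq_zero]
    intro m hm
    obtain ⟨⟨_, n, rfl⟩, hc⟩ := (IsLocalizedModule.eq_zero_iff (Submonoid.powers x) f).1 hm
    exact htf.pow n m (hkill _ m n hc)
  obtain ⟨a, ha⟩ : x ∈ I.radical := by rw [hx]; exact Ideal.mem_span_singleton_self x
  have hbij : Function.Bijective (LinearMap.lsmul R N x) := by
    have := IsLocalizedModule.map_units f ⟨x, Submonoid.mem_powers x⟩
    rw [Module.End.isUnit_iff] at this
    exact this
  have hvan : ∀ n i, Subsingleton (EX R (R ⧸ I^n) N i) := by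
    intro n i
    refine EX.subsingleton_of_unit x (a*n) ?_ hbij i
    intro y
    refine quot_kill _ ?_ y
    rw [pow_mul]
    exact Ideal.pow_mem_pow ha n
  let C := N ⧸ LinearMap.range f
  let g : N →ₗ[R] C := (LinearMap.range f).mkQ
  have hfg : Function.Exact f g := by rw [LinearMap.exact_iff]; exact Submodule.ker_mkQ _
  have hg : Function.Surjective g := Submodule.mkQ_surjective _
  have hC : IsTors I C := by
    intro c
    obtain ⟨y, rfl⟩ := hg c
    obtain ⟨⟨m, ⟨_, n, rfl⟩⟩, hc⟩ := IsLocalizedModule.surj (Submonoid.powers x) f y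
    refine ⟨n, hkill _ _ n ?_⟩
    rw [← map_smul, ← LinearMap.mem_ker, Submodule.ker_mkQ]
    exact ⟨m, hc.symm⟩
  obtain ⟨e'⟩ := lcShift (I := I) hf hfg hg i (fun n => hvan n i) (fun n => hvan n (i+1))
  refine ExtFin.congr e' ?_
  rcases i with _ | i
  · obtain ⟨e''⟩ := lcTors_zero hC
    refine ExtFin.congr e''.symm ?_
    refine ExtFin.right hf hfg hg ExtFin.of_finite (ExtFin.of_subsingleton ?_)
    intro j
    have := hvan 1 j
    rwa [pow_one] at this
  · have := lcTors_succ hC i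
    exact ExtFin.of_sub

end PartA

end Part7

section Part8
open CategoryTheory

section AnnS
variable {R : Type u} [CommRing R]

/-- elements killed by `J` -/
def annS (J : Ideal R) (M : Type u) [AddCommGroup M] [Module R M] : Submodule R M where
  carrier := {x | ∀ r ∈ J, r • x = 0}
  add_mem' := by
    intro a b ha hb r hr
    rw [smul_add, ha r hr, hb r hr, add_zero]
  zero_mem' := fun r _ => smul_zero r
  smul_mem' := by
    intro c x hx r hr
    rw [smul_comm, hx r hr, smul_zero]

variable {J : Ideal R} {M : Type u} [AddCommGroup M] [Module R M]

lemma mem_annS {x : M} : x ∈ annS J M ↔ ∀ r ∈ J, r • x = 0 := Iff.rfl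

noncomputable def annSEquiv : EX R (R ⧸ J) M 0 ≃ₗ[R] annS J M :=
  EX.zeroEquiv.trans (LinearEquiv.ofBijective
    (LinearMap.codRestrict (annS J M) (LinearMap.applyₗ (Submodule.Quotient.mk 1 : R ⧸ J))
      (fun f r hr => cyc_kill f r hr)) (by
    constructor
    · intro f g h
      exact cyc_ext (congrArg Subtype.val h)
    · rintro ⟨x, hx⟩
      refine ⟨cycHom J x hx, Subtype.ext ?_⟩
      exact one_smul _ _))

lemma finite_annS_iff : Module.Finite R (annS J M) ↔ Module.Finite R (EX R (R ⧸ J) M 0) :=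
  (Module.Finite.equiv_iff annSEquiv).symm

end AnnS

section LemC
variable {R : Type u} [CommRing R] [IsNoetherianRing R] {I : Ideal R}
variable {L : Type u} [AddCommGroup L] [Module R L]

lemma lemC (y : R) (hy : y ∈ I) (h1 : ExtFin (R := R) (R ⧸ I) (LinearMap.ker (LinearMap.lsmul R L y)))
    (h2 : ExtFin (R := R) (R ⧸ I) (L ⧸ (LinearMap.range (LinearMap.lsmul R L y)))) :
    ExtFin (R := R) (R ⧸ I) L := by
  intro i
  let μ := LinearMap.lsmul R L y
  let α : L →ₗ[R] LinearMap.range μ := μ.rangeRestrict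
  have hα : Function.Exact (LinearMap.ker μ).subtype α := by
    rw [LinearMap.exact_iff]; simp [α]
  have hαs : Function.Surjective α := μ.surjective_rangeRestrict
  let β := (LinearMap.range μ).subtype
  have hβ := exact_mkQ (LinearMap.range μ)
  have hβi : Function.Injective β := Subtype.val_injective
  have hβs := Submodule.mkQ_surjective (LinearMap.range μ)
  have hcomp : ∀ x : EX R (R ⧸ I) L i, EX.post (R ⧸ I) β i (EX.post (R ⧸ I) α i x) = 0 := by
    intro x
    rw [EX.post_post]
    have : β ∘ₗ α = y • LinearMap.id := by ext x; rfl
    rw [this, EX.post_smul_id]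
    exact EX.smul_eq_zero_left y (quot_kill y hy) i x
  have hK : Module.Finite R (LinearMap.ker (EX.post (R ⧸ I) β i)) := by
    rcases i with _ | i
    · have := LinearMap.ker_eq_bot.2 (EX.post_zero_inj (N := R ⧸ I) hβi)
      rw [this]; infer_instance
    · have := h2 i
      have h3 := LinearMap.exact_iff.1 (EX.exact_left (N := R ⧸ I) hβi hβ hβs i)
      rw [h3]
      infer_instance
  let φ : EX R (R ⧸ I) L i →ₗ[R] LinearMap.ker (EX.post (R ⧸ I) β i) :=
    (EX.post (R ⧸ I) α i).codRestrict _ hcomp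
  refine fin_mid (EX.post (R ⧸ I) (LinearMap.ker μ).subtype i) φ ?_ (h1 i) hK
  have := EX.exact_mid (N := R ⧸ I) Subtype.val_injective hα hαs i
  intro x
  rw [← this x]
  exact ⟨fun h => congrArg Subtype.val h, fun h => Subtype.ext h⟩

end LemC

section LemArt
variable {R : Type u} [CommRing R]

lemma lemArt1 (x : R) (L : Type u) [AddCommGroup L] [Module R L] (hL : ∀ l : L, ∃ n : ℕ, x^n • l = 0)
    (h : IsArtinian R (annS (Ideal.span {x}) L)) : IsArtinian R L := by
  rw [← monotone_stabilizes_iff_artinian] at h ⊢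
  intro N
  let K := annS (Ideal.span {x}) L
  have hK : ∀ l : L, l ∈ K ↔ x • l = 0 := by
    intro l
    constructor
    · intro h
      exact h x (Ideal.mem_span_singleton_self x)
    · intro h r hr
      obtain ⟨s, rfl⟩ := Ideal.mem_span_singleton'.1 hr
      rw [mul_smul, h, smul_zero]
  let V : ℕ → ℕ → Submodule R K := fun n k =>
    ((OrderDual.ofDual (N k)).map (LinearMap.lsmul R L (x^n))).comap K.subtype
  have hV : ∀ n k (l : K), l ∈ V n k ↔ ∃ u ∈ OrderDual.ofDual (N k), x^n • u = l := by
    intro n k l; rfl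
  have hN : ∀ {k k'}, k ≤ k' → OrderDual.ofDual (N k') ≤ OrderDual.ofDual (N k) := fun hk => N.monotone hk
  have hVk : ∀ n {k k'}, k ≤ k' → V n k' ≤ V n k := by
    intro n k k' hk l hl
    rw [hV] at hl ⊢
    obtain ⟨u, hu, e⟩ := hl
    exact ⟨u, hN hk hu, e⟩
  have hVn : ∀ {n n'} k, n ≤ n' → V n' k ≤ V n k := by
    intro n n' k hn l hl
    rw [hV] at hl ⊢
    obtain ⟨u, hu, e⟩ := hl
    refine ⟨x^(n'-n) • u, Submodule.smul_mem _ _ hu, ?_⟩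
    rw [smul_smul, ← pow_add, Nat.add_sub_cancel' hn, e]
  -- diagonal
  obtain ⟨d, hd⟩ := h ⟨fun k => OrderDual.toDual (V k k), fun a b hab =>
    (hVk b hab).trans (hVn a hab)⟩
  replace hd : ∀ m ≥ d, V d d = V m m := fun m hm => congrArg OrderDual.ofDual (hd m hm)
  have hst : ∀ n, ∃ s, ∀ k ≥ s, V n s = V n k := by
    intro n
    obtain ⟨s, hs⟩ := h ⟨fun k => OrderDual.toDual (V n k), fun a b hab => hVk n hab⟩
    exact ⟨s, fun k hk => congrArg OrderDual.ofDual (hs k hk)⟩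
  choose s hs using hst
  let K0 := max d ((Finset.range d).sup s)
  have key : ∀ n k, K0 ≤ k → V n K0 = V n k := by
    intro n k hk
    by_cases hn : n < d
    · have : s n ≤ K0 := le_trans (Finset.le_sup (f := s) (Finset.mem_range.2 hn)) (le_max_right _ _)
      rw [← hs n K0 this, ← hs n k (this.trans hk)]
    · push Not at hn
      have e : ∀ k, d ≤ k → V n k = V d d := by
        intro k hk
        apply le_antisymm
        · exact (hVk n hk).trans (hVn d hn)
        · rw [hd (max n k) (hk.trans (le_max_right _ _))]
          exact (hVn _ (le_max_left _ _)).trans (hVk _ (le_max_right _ _))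
      rw [e K0 (le_max_left _ _), e k ((le_max_left _ _).trans hk)]
  refine ⟨K0, fun k hk => ?_⟩
  have main : ∀ n : ℕ, ∀ u ∈ OrderDual.ofDual (N K0), x^n • u = 0 → u ∈ OrderDual.ofDual (N k) := by
    intro n
    induction n with
    | zero => intro u hu h0; rw [pow_zero, one_smul] at h0; rw [h0]; exact Submodule.zero_mem _
    | succ n ih =>
      intro u hu h0
      have h1 : x^n • u ∈ K := by rw [hK, smul_smul, ← pow_succ']; exact h0
      have h2 : (⟨x^n • u, h1⟩ : K) ∈ V n K0 := (hV _ _ _).2 ⟨u, hu, rfl⟩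
      rw [key n k hk, hV] at h2
      obtain ⟨u', hu', e⟩ := h2
      have h3 := ih (u - u') (Submodule.sub_mem _ hu (hN hk hu')) (by rw [smul_sub, e, sub_self])
      have := Submodule.add_mem _ h3 hu'
      rwa [sub_add_cancel] at this
  apply le_antisymm
  · exact hN hk
  · intro u hu
    obtain ⟨n, hn⟩ := hL u
    exact main n u hu hn

lemma lemArt (J : Ideal R) (hJ : J.FG) : ∀ (L : Type u) [AddCommGroup L] [Module R L]
    (_ : ∀ l : L, ∀ x ∈ J, ∃ n : ℕ, x^n • l = 0) (_ : IsArtinian R (annS J L)), IsArtinian R L := by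
  refine Submodule.fg_induction (motive := fun (J : Ideal R) _ => ∀ (L : Type u) [AddCommGroup L] [Module R L]
    (_ : ∀ l : L, ∀ x ∈ J, ∃ n : ℕ, x^n • l = 0) (_ : IsArtinian R (annS J L)), IsArtinian R L) ?_ ?_ J hJ
  · intro x L _ _ hL h
    exact lemArt1 x L (fun l => hL l x (Ideal.mem_span_singleton_self x)) h
  · intro J1 J2 _ _ h1 h2 L _ _ hL h
    refine h1 L (fun l x hx => hL l x (Submodule.mem_sup_left hx)) ?_
    refine h2 _ ?_ ?_
    · rintro ⟨l, hl⟩ x hx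
      obtain ⟨n, hn⟩ := hL l x (Submodule.mem_sup_right hx)
      exact ⟨n, Subtype.ext hn⟩
    · let φ : annS J2 (annS J1 L) →ₗ[R] annS (J1 ⊔ J2) L :=
        LinearMap.codRestrict _ ((annS J1 L).subtype ∘ₗ (annS J2 (annS J1 L)).subtype) (by
          rintro ⟨⟨l, hl⟩, hl2⟩ r hr
          obtain ⟨a, ha, b, hb, rfl⟩ := Submodule.mem_sup.1 hr
          simp only [LinearMap.comp_apply, Submodule.subtype_apply, add_smul]
          rw [hl a ha, zero_add]
          exact congrArg Subtype.val (hl2 b hb))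
      refine isArtinian_of_injective φ ?_
      intro a b h
      apply Subtype.ext
      apply Subtype.ext
      have := congrArg (fun z : annS (J1 ⊔ J2) L => (z : L)) h
      exact this

end LemArt

section LemSec
variable {R : Type u} [CommRing R] [IsNoetherianRing R]

lemma lemSec_aux (J : Ideal R) (L : Type u) [AddCommGroup L] [Module R L] [IsArtinian R L]
    (h : ∀ k, Module.Finite R (annS (J^k) L)) (N : Submodule R L) :
    ∃ s : Finset (Ideal R), (∀ p ∈ s, p.IsPrime ∧ ¬ J ≤ p) ∧ ∀ y ∈ J, (∀ p ∈ s, y ∉ p) →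
      ∃ W : Submodule R L, W.FG ∧ N ≤ W ⊔ N.map (LinearMap.lsmul R L y) := by
  classical
  induction N using IsArtinian.induction with
  | hgt N ih =>
  by_cases hred : ∃ N1 N2, N1 < N ∧ N2 < N ∧ N ≤ N1 ⊔ N2
  · obtain ⟨N1, N2, h1, h2, h12⟩ := hred
    obtain ⟨s1, hs1, hs1'⟩ := ih N1 h1
    obtain ⟨s2, hs2, hs2'⟩ := ih N2 h2
    refine ⟨s1 ∪ s2, ?_, ?_⟩
    · intro p hp
      rcases Finset.mem_union.1 hp with hp | hp
      · exact hs1 p hp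
      · exact hs2 p hp
    · intro y hy hyp
      obtain ⟨W1, hW1, h1'⟩ := hs1' y hy (fun p hp => hyp p (Finset.mem_union_left _ hp))
      obtain ⟨W2, hW2, h2'⟩ := hs2' y hy (fun p hp => hyp p (Finset.mem_union_right _ hp))
      refine ⟨W1 ⊔ W2, hW1.sup hW2, h12.trans ?_⟩
      apply sup_le
      · refine h1'.trans (sup_le_sup le_sup_left (Submodule.map_mono h1.le))
      · refine h2'.trans (sup_le_sup le_sup_right (Submodule.map_mono h2.le))
  · push Not at hred
    by_cases hN0 : N = ⊥
    · exact ⟨∅, by simp, fun y _ _ => ⟨⊥, Submodule.fg_bot, by rw [hN0]; exact bot_le⟩⟩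
    -- every r acts surjectively or nilpotently
    have hdich : ∀ r : R, (N ≤ N.map (LinearMap.lsmul R L r)) ∨ ∃ n : ℕ, ∀ l ∈ N, r^n • l = 0 := by
      intro r
      by_cases hlt : N ≤ N.map (LinearMap.lsmul R L r)
      · exact Or.inl hlt
      right
      have hle : N.map (LinearMap.lsmul R L r) ≤ N := by
        rintro _ ⟨l, hl, rfl⟩; exact N.smul_mem r hl
      obtain ⟨n, hn⟩ := (monotone_stabilizes_iff_artinian (R := R) (M := L)).2 inferInstance
        ⟨fun n => OrderDual.toDual (N.map (LinearMap.lsmul R L (r^n))), by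
          intro a b hab
          change N.map _ ≤ N.map _
          rintro _ ⟨l, hl, rfl⟩
          refine ⟨r^(b-a) • l, N.smul_mem _ hl, ?_⟩
          simp only [LinearMap.lsmul_apply, smul_smul]
          rw [← pow_add, Nat.add_sub_cancel' hab]⟩
      have hn' : N.map (LinearMap.lsmul R L (r^n)) = N.map (LinearMap.lsmul R L (r^(2*n+1))) :=
        congrArg OrderDual.ofDual (hn (2*n+1) (by omega))
      let N1 := N.map (LinearMap.lsmul R L r)
      let N2 := N ⊓ LinearMap.ker (LinearMap.lsmul R L (r^n))
      have h12 : N ≤ N1 ⊔ N2 := by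
        intro l hl
        have : LinearMap.lsmul R L (r^n) l ∈ N.map (LinearMap.lsmul R L (r^(2*n+1))) := by
          rw [← hn']; exact ⟨l, hl, rfl⟩
        obtain ⟨l', hl', e⟩ := this
        simp only [LinearMap.lsmul_apply] at e
        refine Submodule.mem_sup.2 ⟨r • r^n • l', ⟨r^n • l', N.smul_mem _ hl', rfl⟩, l - r • r^n • l', ?_, by abel⟩
        refine ⟨N.sub_mem hl (N.smul_mem _ (N.smul_mem _ hl')), ?_⟩
        simp only [SetLike.mem_coe, LinearMap.mem_ker, LinearMap.lsmul_apply, smul_sub]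
        rw [← e, smul_smul, smul_smul, ← sub_smul]
        have : r^(2*n+1) - r^n * r * r^n = 0 := by ring
        rw [this, zero_smul]
      have h1lt : N1 < N := lt_of_le_not_ge hle hlt
      have h2 : ¬ N2 < N := fun h2 => hred N1 N2 h1lt h2 h12
      have h2' : N2 = N := by
        by_contra hne
        exact h2 (lt_of_le_of_ne inf_le_left hne)
      refine ⟨n, fun l hl => ?_⟩
      rw [← h2'] at hl
      exact hl.2
    let p : Ideal R :=
      { carrier := {r | ∃ n : ℕ, ∀ l ∈ N, r^n • l = 0}
        add_mem' := by
          rintro a b ⟨n, hn⟩ ⟨m, hm⟩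
          have ha : a ∈ (Submodule.annihilator N).radical := ⟨n, (Submodule.mem_annihilator).2 hn⟩
          have hb : b ∈ (Submodule.annihilator N).radical := ⟨m, (Submodule.mem_annihilator).2 hm⟩
          obtain ⟨k, hk⟩ := Ideal.add_mem _ ha hb
          exact ⟨k, Submodule.mem_annihilator.1 hk⟩
        zero_mem' := ⟨1, fun l _ => by simp⟩
        smul_mem' := by
          rintro c a ⟨n, hn⟩
          refine ⟨n, fun l hl => ?_⟩
          rw [smul_eq_mul, mul_pow, mul_smul, hn l hl, smul_zero] }
    have hpmem : ∀ r, r ∈ p ↔ ∃ n : ℕ, ∀ l ∈ N, r^n • l = 0 := fun r => Iff.rfl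
    have hpsurj : ∀ r, r ∉ p → N ≤ N.map (LinearMap.lsmul R L r) := fun r hr => (hdich r).resolve_right hr
    have hp : p.IsPrime := by
      refine ⟨?_, ?_⟩
      · rw [Ideal.ne_top_iff_one]
        rintro ⟨n, hn⟩
        apply hN0
        rw [eq_bot_iff]
        intro l hl
        simpa using hn l hl
      · intro a b hab
        by_contra hcon
        push Not at hcon
        obtain ⟨n, hn⟩ := hab
        have ha := hpsurj a hcon.1
        have hb := hpsurj b hcon.2
        have hab : N ≤ N.map (LinearMap.lsmul R L (a*b)) := by
          intro l hl
          obtain ⟨l1, hl1, e1⟩ := ha hl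
          obtain ⟨l2, hl2, e2⟩ := hb hl1
          refine ⟨l2, hl2, ?_⟩
          simp only [LinearMap.lsmul_apply] at *
          rw [mul_smul, e2, e1]
        have : ∀ k : ℕ, N ≤ N.map (LinearMap.lsmul R L ((a*b)^k)) := by
          intro k
          induction k with
          | zero => intro l hl; exact ⟨l, hl, by simp⟩
          | succ k ihk =>
            intro l hl
            obtain ⟨l1, hl1, e1⟩ := ihk hl
            obtain ⟨l2, hl2, e2⟩ := hab hl1
            refine ⟨l2, hl2, ?_⟩
            simp only [LinearMap.lsmul_apply] at *
            rw [pow_succ, mul_smul, e2, e1]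
        apply hN0
        rw [eq_bot_iff]
        intro l hl
        obtain ⟨l1, hl1, e1⟩ := this n hl
        rw [LinearMap.lsmul_apply, hn l1 hl1] at e1
        exact e1.symm
    by_cases hJp : J ≤ p
    · refine ⟨∅, by simp, fun y hy _ => ⟨N, ?_, le_sup_left⟩⟩
      obtain ⟨k, hk⟩ : ∃ k, J^k ≤ Submodule.annihilator N := by
        apply Ideal.exists_pow_le_of_le_radical_of_fg _ (IsNoetherian.noetherian J)
        intro r hr
        obtain ⟨n, hn⟩ := hJp hr
        exact ⟨n, Submodule.mem_annihilator.2 hn⟩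
      have hNle : N ≤ annS (J^k) L := fun l hl r hr => Submodule.mem_annihilator.1 (hk hr) l hl
      have := h k
      have hn := isNoetherian_of_isNoetherianRing_of_finite R (annS (J^k) L)
      have := isNoetherian_of_injective (Submodule.inclusion hNle) (Submodule.inclusion_injective _)
      exact Module.Finite.iff_fg.1 (inferInstance : Module.Finite R N)
    · refine ⟨{p}, ?_, ?_⟩
      · intro q hq
        rw [Finset.mem_singleton] at hq
        subst hq
        exact ⟨hp, hJp⟩
      · intro y hy hyp
        exact ⟨⊥, Submodule.fg_bot, (hpsurj y (hyp p (Finset.mem_singleton_self p))).trans le_sup_right⟩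

lemma lemSec (J : Ideal R) (L : Type u) [AddCommGroup L] [Module R L] [IsArtinian R L]
    (h : ∀ k, Module.Finite R (annS (J^k) L)) :
    ∃ y ∈ J, Module.Finite R (L ⧸ LinearMap.range (LinearMap.lsmul R L y)) := by
  obtain ⟨s, hs, hs'⟩ := lemSec_aux J L h ⊤
  have : ∃ y ∈ J, ∀ p ∈ s, y ∉ p := by
    by_contra hcon
    push Not at hcon
    have hsub : (J : Set R) ⊆ ⋃ p ∈ (s : Set (Ideal R)), (p : Set R) := by
      intro y hy
      obtain ⟨p, hp, hyp⟩ := hcon y hy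
      exact Set.mem_biUnion hp hyp
    obtain ⟨p, hp, hle⟩ := (Ideal.subset_union_prime (f := id) ⊥ ⊥ (fun p hp _ _ => (hs p hp).1)).1 hsub
    exact (hs p hp).2 hle
  obtain ⟨y, hy, hyp⟩ := this
  refine ⟨y, hy, ?_⟩
  obtain ⟨W, hW, hle⟩ := hs' y hy hyp
  have : Module.Finite R W := Module.Finite.iff_fg.2 hW
  refine Module.Finite.of_surjective ((LinearMap.range (LinearMap.lsmul R L y)).mkQ ∘ₗ W.subtype) ?_
  intro q
  obtain ⟨l, rfl⟩ := Submodule.mkQ_surjective _ q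
  obtain ⟨w, hw, z, ⟨z', _, hz⟩, e⟩ := Submodule.mem_sup.1 (hle (Submodule.mem_top : l ∈ ⊤))
  refine ⟨⟨w, hw⟩, ?_⟩
  rw [← e, map_add]
  have : (LinearMap.range (LinearMap.lsmul R L y)).mkQ z = 0 := by
    rw [← LinearMap.mem_ker, Submodule.ker_mkQ]
    exact ⟨z', hz⟩
  rw [this, add_zero]
  rfl

end LemSec

end Part8

section Part9
open CategoryTheory

section ArtFG
variable {R : Type u} [CommRing R] [IsNoetherianRing R]

lemma artFG (J : Ideal R) (hJ : ∀ p : Ideal R, p.IsPrime → J ≤ p → p.IsMaximal) (N : Type u) [AddCommGroup N]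
    [Module R N] (hN : Module.Finite R N) (hk : ∃ k : ℕ, ∀ r ∈ J^k, ∀ x : N, r • x = 0) : IsArtinian R N := by
  induction hN using IsNoetherianRing.induction_on_isQuotientEquivQuotientPrime R with
  | subsingleton N => infer_instance
  | quotient N p e =>
    obtain ⟨k, hk⟩ := hk
    have hle : J ≤ p.asIdeal := by
      have : J^k ≤ p.asIdeal := by
        intro r hr
        have h1 := hk r hr (e.symm (Submodule.Quotient.mk 1))
        rw [← map_smul, LinearEquiv.map_eq_zero_iff, ← Submodule.Quotient.mk_smul, Submodule.Quotient.mk_eq_zero] at h1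
        simpa using h1
      by_cases hk0 : k = 0
      · subst hk0
        exfalso; apply p.isPrime.ne_top; rw [eq_top_iff]; simpa using this
      exact (Ideal.IsPrime.pow_le_iff hk0).1 this
    have hmax := hJ _ p.isPrime hle
    have : IsSimpleModule R (R ⧸ p.asIdeal) := by
      rw [isSimpleModule_iff_isCoatom]; exact hmax.out
    exact isArtinian_of_linearEquiv e.symm
  | exact N1 N2 N3 f g hf hg hfg h1 h3 =>
    obtain ⟨k, hk⟩ := hk
    have := h1 ⟨k, fun r hr x => hf (by rw [map_smul, hk r hr, map_zero])⟩
    have := h3 ⟨k, fun r hr x => by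
      obtain ⟨y, rfl⟩ := hg x
      rw [← map_smul, hk r hr, map_zero]⟩
    exact isArtinian_of_range_eq_ker f g (LinearMap.exact_iff.1 hfg).symm

lemma annS_pow_finite {I : Ideal R} {L : Type u} [AddCommGroup L] [Module R L] (h : Module.Finite R (annS I L)) (k : ℕ) :
    Module.Finite R (annS (I^k) L) := by
  rw [finite_annS_iff] at h ⊢
  exact EX.finite_serre (I := I) 0 (fun j hj => by obtain rfl : j = 0 := by omega
                                                   exact h) 0 le_rfl _ k (fun r hr x => quot_kill r hr x)

lemma annS_finite_of_inj {I : Ideal R} {L L' : Type u} [AddCommGroup L] [Module R L] [AddCommGroup L'] [Module R L']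
    (f : L' →ₗ[R] L) (hf : Function.Injective f) (h : Module.Finite R (annS I L)) :
    Module.Finite R (annS I L') := by
  rw [finite_annS_iff] at h ⊢
  exact EX.fin_zero_left hf h

lemma level1 {I K : Ideal R} (hIK : I ≤ K) (hK : ∀ p : Ideal R, p.IsPrime → K ≤ p → p.IsMaximal)
    (L : Type u) [AddCommGroup L] [Module R L] (hL : IsTors K L) (h : Module.Finite R (annS I L)) :
    ExtFin (R := R) (R ⧸ I) L := by
  have hArt : IsArtinian R L := by
    apply lemArt I (IsNoetherian.noetherian I)
    · intro l x hx
      obtain ⟨n, hn⟩ := hL l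
      exact ⟨n, hn _ (Ideal.pow_mem_pow (hIK hx) n)⟩
    · exact artFG K hK _ h (IsTors.bound (IsTors.of_inj hL _ (Submodule.injective_subtype _)))
  suffices H : ∀ N : Submodule R L, ExtFin (R := R) (R ⧸ I) N from
    ExtFin.congr (Submodule.topEquiv) (H ⊤)
  intro N
  induction N using IsArtinian.induction with
  | hgt N ih =>
  have hN := annS_finite_of_inj N.subtype (Submodule.injective_subtype _) h
  obtain ⟨y, hy, hfin⟩ := lemSec I N (annS_pow_finite hN)
  by_cases hA : LinearMap.ker (LinearMap.lsmul R N y) = ⊤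
  · have h0 : LinearMap.range (LinearMap.lsmul R N y) = ⊥ := by
      rw [LinearMap.range_eq_bot]; exact LinearMap.ker_eq_top.1 hA
    have : Module.Finite R N := Module.Finite.equiv (Submodule.quotEquivOfEqBot _ h0)
    exact ExtFin.of_finite
  · refine lemC y hy ?_ ExtFin.of_finite
    have hlt : (LinearMap.ker (LinearMap.lsmul R N y)).map N.subtype < N := by
      refine lt_of_le_of_ne (Submodule.map_subtype_le _ _) ?_
      intro heq
      apply hA
      rw [eq_top_iff]
      rintro ⟨n, hn⟩ -
      rw [← heq] at hn
      obtain ⟨z, hz, hzz⟩ := hn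
      have : z = ⟨n, by assumption⟩ := Subtype.ext hzz
      rw [← this]; exact hz
    exact ExtFin.congr (Submodule.equivSubtypeMap _ _).symm (ih _ hlt)

/-- B-type -/
lemma btype {I : Ideal R} {x : R} (hK : ∀ p : Ideal R, p.IsPrime → I ≤ p → x ∈ p → p.IsMaximal)
    (L : Type u) [AddCommGroup L] [Module R L] (hL : IsTors I L) (h : Module.Finite R (annS I L))
    (n : ℕ) (hn : ∀ l : L, ∀ r ∈ I^n, ∃ N : ℕ, x^N • r • l = 0) :
    ExtFin (R := R) (R ⧸ I) L := by
  have h1 := annS_pow_finite h n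
  refine ExtFin.mid (Submodule.injective_subtype (annS (I^n) L)) (exact_mkQ _) (Submodule.mkQ_surjective _)
    ExtFin.of_finite ?_
  refine level1 (K := I ⊔ Ideal.span {x}) le_sup_left (fun p hp hle => hK p hp (le_sup_left.trans hle)
    (hle (Submodule.mem_sup_right (Ideal.mem_span_singleton_self x)))) _ ?_ ?_
  · -- torsion
    intro q
    obtain ⟨l, rfl⟩ := Submodule.mkQ_surjective _ q
    obtain ⟨a, ha⟩ := hL l
    have h2 : ∃ N : ℕ, ∀ r ∈ I^n, x^N • r • l = 0 := by
      have := fg_tors_bound (I := Ideal.span {x}) (Submodule.map (LinearMap.toSpanSingleton R L l) (I^n))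
        (Submodule.FG.map _ (IsNoetherian.noetherian _)) (by
          rintro _ ⟨r, hr, rfl⟩
          obtain ⟨N, hN⟩ := hn l r hr
          refine ⟨N, fun s hs => ?_⟩
          rw [Ideal.span_singleton_pow, Ideal.mem_span_singleton] at hs
          obtain ⟨c, rfl⟩ := hs
          rw [mul_comm, mul_smul]
          simp only [LinearMap.toSpanSingleton_apply]
          rw [hN, smul_zero])
      obtain ⟨N, hN⟩ := this
      refine ⟨N, fun r hr => hN _ ?_ _ ⟨r, hr, rfl⟩⟩
      exact Ideal.pow_mem_pow (Ideal.mem_span_singleton_self x) N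
    obtain ⟨N, hN⟩ := h2
    refine ⟨a + N, fun r hr => ?_⟩
    have := Ideal.sup_pow_add_le_pow_sup_pow hr
    obtain ⟨s, hs, t, ht, rfl⟩ := Submodule.mem_sup.1 this
    rw [Ideal.span_singleton_pow, Ideal.mem_span_singleton] at ht
    obtain ⟨c, rfl⟩ := ht
    rw [add_smul, ← map_smul, ← map_smul, ha s hs, map_zero, zero_add, Submodule.mkQ_apply, Submodule.Quotient.mk_eq_zero]
    intro r hr
    rw [smul_smul, show r * (x^N * c) = c * (x^N * r) by ring, mul_smul, mul_smul, hN r hr, smul_zero]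
  · rw [finite_annS_iff] at h ⊢
    exact EX.fin_right (Submodule.injective_subtype (annS (I^n) L)) (exact_mkQ _) (Submodule.mkQ_surjective _) 0 h
      (EX.finite_of_finite _)

end ArtFG

end Part9

section Part10
open CategoryTheory

section Loc
variable {R : Type u} [CommRing R] [IsNoetherianRing R]

lemma loc_key {I : Ideal R} {x : R} (h2 : ∀ p q : Ideal R, p.IsPrime → q.IsPrime → I ≤ p → p < q → x ∈ q)
    (L : Type u) [AddCommGroup L] [Module R L] (hL : IsTors I L) (h : Module.Finite R (annS I L)) :
    ∃ (P : Type u) (_ : PartialOrder P) (_ : WellFoundedLT P) (Φ : Submodule R L → P), Monotone Φ ∧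
      (∀ N N' : Submodule R L, Φ N = Φ N' → ∀ l ∈ N, ∃ k : ℕ, x^k • l ∈ N') ∧
      ∀ N : Submodule R L, ∃ y ∈ I, ∃ n : ℕ, ∀ l ∈ N, ∀ r ∈ I^n, ∃ k : ℕ, ∃ l1 ∈ N, x^k • r • l = y • l1 := by
  let M := Submonoid.powers x
  let R' := Localization M
  let L' := LocalizedModule M L
  let f : L →ₗ[R] L' := LocalizedModule.mkLinearMap M L
  let J : Ideal R' := I.map (algebraMap R R')
  have hf0 : ∀ l : L, f l = 0 → ∃ k : ℕ, x^k • l = 0 := by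
    intro l hl
    obtain ⟨⟨_, k, rfl⟩, hk⟩ := (IsLocalizedModule.eq_zero_iff M f).1 hl
    exact ⟨k, hk⟩
  have hsurj : ∀ z : L', ∃ (l : L) (k : ℕ), x^k • z = f l := by
    intro z
    obtain ⟨⟨l, ⟨_, k, rfl⟩⟩, hk⟩ := IsLocalizedModule.surj M f z
    exact ⟨l, k, hk⟩
  have hunit : ∀ k : ℕ, IsUnit (algebraMap R R' (x^k)) := fun k =>
    IsLocalization.map_units R' (⟨x^k, k, rfl⟩ : M)
  have hmemloc : ∀ (N : Submodule R L) (z : L'), z ∈ N.localized M ↔ ∃ l ∈ N, ∃ k : ℕ, x^k • z = f l := by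
    intro N z
    constructor
    · rintro ⟨l, hl, ⟨_, k, rfl⟩, rfl⟩
      exact ⟨l, hl, k, IsLocalizedModule.mk'_cancel' f l (⟨x^k, k, rfl⟩ : M)⟩
    · rintro ⟨l, hl, k, e⟩
      refine ⟨l, hl, ⟨x^k, k, rfl⟩, ?_⟩
      rw [IsLocalizedModule.mk'_eq_iff, ← e]; rfl
  have hJpow : ∀ n : ℕ, J^n = (I^n).map (algebraMap R R') := fun n => (Ideal.map_pow _ I n).symm
  have hann : ∀ n : ℕ, ∀ z ∈ annS (J^n) L', z ∈ (annS (I^n) L).localized M := by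
    intro n z hz
    obtain ⟨l, k, e⟩ := hsurj z
    have h3 := fg_tors_bound (I := Ideal.span {x}) (Submodule.map (LinearMap.toSpanSingleton R L l) (I^n))
        (Submodule.FG.map _ (IsNoetherian.noetherian _)) (by
          rintro _ ⟨r, hr, rfl⟩
          have : f (r • l) = 0 := by
            rw [map_smul, ← e, smul_comm, ← algebraMap_smul R' r, hz, smul_zero]
            rw [hJpow]
            exact Ideal.mem_map_of_mem _ hr
          obtain ⟨N, hN⟩ := hf0 _ this
          refine ⟨N, fun s hs => ?_⟩
          rw [Ideal.span_singleton_pow, Ideal.mem_span_singleton] at hs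
          obtain ⟨c, rfl⟩ := hs
          rw [mul_comm, mul_smul]
          simp only [LinearMap.toSpanSingleton_apply]
          rw [hN, smul_zero])
    obtain ⟨N, hN⟩ := h3
    refine (hmemloc _ z).2 ⟨x^N • l, ?_, N + k, ?_⟩
    · intro r hr
      rw [smul_comm]
      exact hN (x^N) (Ideal.pow_mem_pow (Ideal.mem_span_singleton_self x) N) _ ⟨r, hr, rfl⟩
    · rw [map_smul, ← e, smul_smul, pow_add]
  have hfin : ∀ n : ℕ, Module.Finite R' (annS (J^n) L') := by
    intro n
    have h3 : ((annS (I^n) L).localized M).FG :=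
      Submodule.localized_fg _ (Module.Finite.iff_fg.1 (annS_pow_finite h n))
    have : Module.Finite R' ((annS (I^n) L).localized M) := Module.Finite.iff_fg.2 h3
    exact Module.Finite.of_injective (Submodule.inclusion (hann n)) (Submodule.inclusion_injective _)
  have htors : IsTors J L' := by
    intro z
    obtain ⟨l, k, e⟩ := hsurj z
    obtain ⟨n, hn⟩ := hL l
    refine ⟨n, fun r hr => ?_⟩
    rw [hJpow] at hr
    have h4 : (I^n).map (algebraMap R R') ≤ Ideal.comap (RingHom.id R') (Module.annihilator R' (Submodule.span R' {z})) := by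
      rw [Ideal.map_le_iff_le_comap]
      intro s hs
      rw [Ideal.mem_comap, Ideal.mem_comap, RingHom.id_apply, Module.mem_annihilator]
      rintro ⟨w, hw⟩
      obtain ⟨c, rfl⟩ := Submodule.mem_span_singleton.1 hw
      apply Subtype.ext
      change algebraMap R R' s • c • z = 0
      rw [smul_comm]
      have : algebraMap R R' s • z = 0 := by
        have h5 : algebraMap R R' (x^k) • algebraMap R R' s • z = 0 := by
          rw [algebraMap_smul, algebraMap_smul, smul_comm, e, ← map_smul, hn s hs, map_zero]
        exact (hunit k).smul_eq_zero.1 h5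
      rw [this, smul_zero]
    have h6 := h4 hr
    rw [Ideal.mem_comap, RingHom.id_apply, Module.mem_annihilator] at h6
    exact congrArg Subtype.val (h6 ⟨z, Submodule.mem_span_singleton_self z⟩)
  have hmax : ∀ p : Ideal R', p.IsPrime → J ≤ p → p.IsMaximal := by
    intro p hp hle
    obtain ⟨m, hm, hpm⟩ := Ideal.exists_le_maximal p hp.ne_top
    rcases hpm.lt_or_eq with hlt | rfl
    · exfalso
      have h7 := h2 (p.comap (algebraMap R R')) (m.comap (algebraMap R R')) inferInstance inferInstance
        (Ideal.map_le_iff_le_comap.1 hle) (by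
          refine lt_of_le_of_ne (Ideal.comap_mono hpm) ?_
          intro he
          apply hlt.ne
          change Ideal.under R p = Ideal.under R m at he
          rw [← IsLocalization.map_under M R' p, ← IsLocalization.map_under M R' m, he])
      apply hm.ne_top
      have h7' : algebraMap R R' x ∈ m := h7
      apply Ideal.eq_top_of_isUnit_mem _ h7'
      simpa using hunit 1
    · exact hm
  have hArt : IsArtinian R' L' := by
    apply lemArt J (IsNoetherian.noetherian J)
    · intro l y hy
      obtain ⟨n, hn⟩ := htors l
      exact ⟨n, hn _ (Ideal.pow_mem_pow hy n)⟩
    · have h8 := hfin 1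
      rw [pow_one] at h8
      exact artFG J hmax _ h8 (IsTors.bound (IsTors.of_inj htors _ (Submodule.injective_subtype _)))
  refine ⟨Submodule R' L', inferInstance, inferInstance, fun N => N.localized M, ?_, ?_, ?_⟩
  · intro N N' hle z hz
    obtain ⟨l, hl, k, e⟩ := (hmemloc _ _).1 hz
    exact (hmemloc _ _).2 ⟨l, hle hl, k, e⟩
  · intro N N' he l hl
    have : f l ∈ N'.localized M := by
      have he' : N.localized M = N'.localized M := he
      rw [← he']; exact (hmemloc _ _).2 ⟨l, hl, 0, by simp⟩
    obtain ⟨l', hl', k, e⟩ := (hmemloc _ _).1 this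
    rw [← map_smul, ← sub_eq_zero, ← map_sub] at e
    obtain ⟨j, hj⟩ := hf0 _ e
    refine ⟨j + k, ?_⟩
    rw [smul_sub, sub_eq_zero, smul_smul, ← pow_add] at hj
    rw [hj]; exact N'.smul_mem _ hl'
  · intro N
    let N' := N.localized M
    obtain ⟨y, hy, hyfin⟩ := lemSec J N' (fun k => annS_finite_of_inj N'.subtype (Submodule.injective_subtype _) (hfin k))
    have htQ : IsTors J (N' ⧸ LinearMap.range (LinearMap.lsmul R' N' y)) :=
      IsTors.of_surj (IsTors.of_inj htors N'.subtype (Submodule.injective_subtype _)) _ (Submodule.mkQ_surjective _)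
    obtain ⟨n, hn⟩ := htQ.bound
    obtain ⟨⟨⟨y0, hy0⟩, ⟨_, a, rfl⟩⟩, hya⟩ := (IsLocalization.mem_map_algebraMap_iff M R').1 hy
    refine ⟨y0, hy0, n, ?_⟩
    intro l hl r hr
    have hl' : f l ∈ N' := (hmemloc _ _).2 ⟨l, hl, 0, by simp⟩
    have h9 := hn (algebraMap R R' r) (by rw [hJpow]; exact Ideal.mem_map_of_mem _ hr) (Submodule.Quotient.mk ⟨f l, hl'⟩)
    rw [← Submodule.Quotient.mk_smul, Submodule.Quotient.mk_eq_zero] at h9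
    obtain ⟨⟨w, hw⟩, hwe⟩ := h9
    have hwe' : y • w = algebraMap R R' r • f l := congrArg Subtype.val hwe
    obtain ⟨l1, hl1, k, e⟩ := (hmemloc _ _).1 hw
    -- x^(a+k) r f l = x^k * y0 ...
    have h10 : f (x^(a+k) • r • l) = f (y0 • l1) := by
      rw [map_smul, map_smul, map_smul, ← e, ← algebraMap_smul R' r, ← hwe', pow_add, mul_comm, mul_smul, ← algebraMap_smul R' (x^a),
        smul_smul, mul_comm, hya, algebraMap_smul, smul_comm]
    rw [← sub_eq_zero, ← map_sub] at h10
    obtain ⟨j, hj⟩ := hf0 _ h10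
    refine ⟨j + (a + k), x^j • l1, N.smul_mem _ hl1, ?_⟩
    rw [smul_sub, sub_eq_zero] at hj
    rw [smul_comm y0, ← hj, pow_add, mul_smul]

end Loc

end Part10

section Part11
open CategoryTheory

section Melk
variable {R : Type u} [CommRing R] [IsNoetherianRing R]

lemma melk {I : Ideal R} {x : R} (h1 : ∀ p : Ideal R, p.IsPrime → I ≤ p → x ∈ p → p.IsMaximal)
    (h2 : ∀ p q : Ideal R, p.IsPrime → q.IsPrime → I ≤ p → p < q → x ∈ q)
    (L : Type u) [AddCommGroup L] [Module R L] (hL : IsTors I L) (e0 : Module.Finite R (EX R (R ⧸ I) L 0))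
    (e1 : Module.Finite R (EX R (R ⧸ I) L 1)) : ExtFin (R := R) (R ⧸ I) L := by
  obtain ⟨P, _, _, Φ, hmono, hΦ, hsec⟩ := loc_key h2 L hL (finite_annS_iff.2 e0)
  suffices H : ∀ (a : P) (N : Submodule R L), Φ N = a → Module.Finite R (EX R (R ⧸ I) N 1) → ExtFin (R := R) (R ⧸ I) N from
    ExtFin.congr (Submodule.topEquiv) (H _ ⊤ rfl (Module.Finite.equiv (EX.postEquiv Submodule.topEquiv.symm 1)))
  intro a
  induction a using WellFoundedLT.induction with
  | ind a ih =>
  rintro N rfl hN1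
  have hNt : IsTors I N := hL.of_inj N.subtype (Submodule.injective_subtype _)
  have hN0 : Module.Finite R (EX R (R ⧸ I) N 0) := EX.fin_zero_left (Submodule.injective_subtype N) e0
  obtain ⟨y, hy, n, hyn⟩ := hsec N
  let μ := LinearMap.lsmul R N y
  let A := LinearMap.ker μ
  let A' := A.map N.subtype
  have hle : A' ≤ N := Submodule.map_subtype_le _ _
  by_cases hA : Φ N = Φ A'
  · refine btype h1 N hNt (finite_annS_iff.2 hN0) n ?_
    rintro ⟨l, hl⟩ r hr
    obtain ⟨k, l1, hl1, e⟩ := hyn l hl r hr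
    obtain ⟨j, z, hz, hzz⟩ := hΦ _ _ hA l1 hl1
    refine ⟨j + k, Subtype.ext ?_⟩
    change x^(j+k) • r • l = 0
    rw [pow_add, mul_smul, e, smul_comm, ← hzz]
    exact congrArg Subtype.val hz
  · have hlt : Φ A' < Φ N := lt_of_le_of_ne (hmono hle) (Ne.symm hA)
    have hex : Function.Exact A.subtype μ.rangeRestrict := by
      rw [LinearMap.exact_iff, LinearMap.ker_rangeRestrict, Submodule.range_subtype]
    have hr0 : Module.Finite R (EX R (R ⧸ I) (LinearMap.range μ) 0) :=
      EX.fin_zero_left (Submodule.injective_subtype _) hN0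
    have hA1 : Module.Finite R (EX R (R ⧸ I) A 1) :=
      EX.fin_one_left (Submodule.injective_subtype A) hex μ.surjective_rangeRestrict 0 hr0 hN1
    have eA : A ≃ₗ[R] A' := Submodule.equivSubtypeMap _ _
    have hAfin : ExtFin (R := R) (R ⧸ I) A :=
      ExtFin.congr eA.symm (ih _ hlt A' rfl (Module.Finite.equiv (EX.postEquiv eA 1)))
    have hr1 : Module.Finite R (EX R (R ⧸ I) (LinearMap.range μ) 1) :=
      EX.fin_right (Submodule.injective_subtype A) hex μ.surjective_rangeRestrict 1 hN1 (hAfin 2)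
    refine lemC y hy hAfin ?_
    have hB0 : Module.Finite R (EX R (R ⧸ I) (N ⧸ LinearMap.range μ) 0) :=
      EX.fin_right (Submodule.injective_subtype _) (exact_mkQ _) (Submodule.mkQ_surjective _) 0 hN0 hr1
    refine btype h1 _ (hNt.of_surj _ (Submodule.mkQ_surjective _)) (finite_annS_iff.2 hB0) n ?_
    intro q r hr
    obtain ⟨⟨l, hl⟩, rfl⟩ := Submodule.mkQ_surjective _ q
    obtain ⟨k, l1, hl1, e⟩ := hyn l hl r hr
    refine ⟨k, ?_⟩
    rw [← map_smul, ← map_smul, Submodule.mkQ_apply, Submodule.Quotient.mk_eq_zero]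
    exact ⟨⟨l1, hl1⟩, Subtype.ext e.symm⟩

lemma partB_aux {I : Ideal R} {x : R} (h1 : ∀ p : Ideal R, p.IsPrime → I ≤ p → x ∈ p → p.IsMaximal)
    (h2 : ∀ p q : Ideal R, p.IsPrime → q.IsPrime → I ≤ p → p < q → x ∈ q) (i : ℕ) :
    ∀ (M : Type u) [AddCommGroup M] [Module R M], ExtFin (R := R) (R ⧸ I) M →
      ExtFin (R := R) (R ⧸ I) (gam I M) ∧ ExtFin (R := R) (R ⧸ I) (Hc I i M) := by
  have hg : ∀ (M : Type u) [AddCommGroup M] [Module R M], ExtFin (R := R) (R ⧸ I) M →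
      ExtFin (R := R) (R ⧸ I) (gam I M) := by
    intro M _ _ hM
    refine melk h1 h2 _ isTors_gam (EX.fin_zero_left (Submodule.injective_subtype _) (hM 0)) ?_
    refine EX.fin_one_left (Submodule.injective_subtype _) (exact_mkQ _) (Submodule.mkQ_surjective _) 0 ?_ (hM 1)
    have := EX.subsingleton_zero_of_torsFree (torsFree_quot (I := I) (M := M)) 1
    rw [pow_one] at this
    infer_instance
  induction i with
  | zero =>
    intro M _ _ hM
    obtain ⟨e⟩ := lcZero (I := I) (M := M)
    exact ⟨hg M hM, ExtFin.congr e.symm (hg M hM)⟩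
  | succ i ih =>
    intro M _ _ hM
    refine ⟨hg M hM, ?_⟩
    obtain ⟨e⟩ := lcModGam (I := I) (M := M) i
    refine ExtFin.congr e.symm ?_
    have hM' : ExtFin (R := R) (R ⧸ I) (M ⧸ gam I M) :=
      ExtFin.right (Submodule.injective_subtype _) (exact_mkQ _) (Submodule.mkQ_surjective _) (hg M hM) hM
    obtain ⟨E, f, hE, hf, hEt⟩ := exists_injective_embedding_torsFree (I := I) (M ⧸ gam I M) torsFree_quot
    have hsub : ∀ n j, Subsingleton (EX R (R ⧸ I^n) E j) := by
      intro n j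
      rcases j with _ | j
      · exact EX.subsingleton_zero_of_torsFree hEt n
      · exact EX.subsingleton_injective _ _ j
    have hex : Function.Exact f (LinearMap.range f).mkQ := by
      rw [LinearMap.exact_iff, Submodule.ker_mkQ]
    have hEfin : ExtFin (R := R) (R ⧸ I) E := ExtFin.of_subsingleton (fun j => by
      have := hsub 1 j
      rwa [pow_one] at this)
    have hQ := ExtFin.right hf hex (Submodule.mkQ_surjective _) hM' hEfin
    obtain ⟨e⟩ := lcShift (I := I) hf hex (Submodule.mkQ_surjective _) i (fun n => hsub n i) (fun n => hsub n (i+1))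
    exact ExtFin.congr e (ih _ hQ).2

lemma partB [IsLocalRing R] {I : Ideal R} (hI : ringKrullDim (R ⧸ I) ≤ 1)
    (M : Type u) [AddCommGroup M] [Module R M] [Module.Finite R M] (i : ℕ) : ExtFin (R := R) (R ⧸ I) (Hc I i M) := by
  have hm : ∀ p q : Ideal R, p.IsPrime → q.IsPrime → I ≤ p → p < q → q = IsLocalRing.maximalIdeal R := by
    intro p q hp hq hle hlt
    by_contra hne
    have hqm : q < IsLocalRing.maximalIdeal R := lt_of_le_of_ne (IsLocalRing.le_maximalIdeal hq.ne_top) hne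
    have : (2 : WithBot ℕ∞) ≤ ringKrullDim (R ⧸ I) := by
      rw [ringKrullDim_quotient]
      let l : LTSeries (PrimeSpectrum.zeroLocus (I : Set R)) :=
        { length := 2
          toFun := ![⟨⟨p, hp⟩, hle⟩, ⟨⟨q, hq⟩, hle.trans hlt.le⟩, ⟨⟨IsLocalRing.maximalIdeal R, inferInstance⟩, hle.trans (hlt.trans hqm).le⟩]
          step := by
            intro i
            fin_cases i
            · exact hlt
            · exact hqm }
      exact Order.le_krullDim_iff.2 ⟨l, rfl⟩
    have := this.trans hI
    exact absurd this (by decide)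
  obtain ⟨x, hx⟩ : ∃ x : R, ∀ p : Ideal R, p.IsPrime → I ≤ p → (x ∈ p ↔ p = IsLocalRing.maximalIdeal R) := by
    classical
    have hfin := Ideal.finite_minimalPrimes_of_isNoetherianRing R I
    let s := hfin.toFinset.filter (fun p => p ≠ IsLocalRing.maximalIdeal R)
    have hs : ∀ p ∈ s, p.IsPrime ∧ p ≠ IsLocalRing.maximalIdeal R := by
      intro p hp
      have := Finset.mem_filter.1 hp
      exact ⟨(hfin.mem_toFinset.1 this.1).1.1, this.2⟩
    obtain ⟨x, hxm, hxs⟩ : ∃ x ∈ IsLocalRing.maximalIdeal R, ∀ p ∈ s, x ∉ p := by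
      by_contra hcon
      push Not at hcon
      have hsub : ((IsLocalRing.maximalIdeal R : Ideal R) : Set R) ⊆ ⋃ p ∈ (s : Set (Ideal R)), (p : Set R) := by
        intro z hz
        obtain ⟨p, hp, hzp⟩ := hcon z hz
        exact Set.mem_biUnion hp hzp
      obtain ⟨p, hp, hle⟩ := (Ideal.subset_union_prime (f := id) ⊥ ⊥ (fun p hp _ _ => (hs p hp).1)).1 hsub
      exact (hs p hp).2 ((IsLocalRing.maximalIdeal.isMaximal R).eq_of_le (hs p hp).1.ne_top hle).symm
    refine ⟨x, fun p hp hle => ⟨fun hxp => ?_, fun h => h ▸ hxm⟩⟩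
    obtain ⟨q, hq, hqp⟩ := Ideal.exists_minimalPrimes_le hle
    by_cases hqm : q = IsLocalRing.maximalIdeal R
    · exact le_antisymm (IsLocalRing.le_maximalIdeal hp.ne_top) (hqm ▸ hqp)
    · have hqs : q ∈ s := Finset.mem_filter.2 ⟨hfin.mem_toFinset.2 hq, hqm⟩
      refine hm q p hq.1.1 hp hq.1.2 (lt_of_le_of_ne hqp ?_)
      rintro rfl
      exact hxs _ hqs hxp
  refine (partB_aux (x := x) (I := I) ?_ ?_ i M ExtFin.of_finite).2
  · intro p hp hle hxp
    rw [(hx p hp hle).1 hxp]; infer_instance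
  · intro p q hp hq hle hlt
    exact (hx q hq (hle.trans hlt.le)).2 (hm p q hp hq hle hlt)

end Melk

end Part11

section Part12
open CategoryTheory

section RegBasics
open IsLocalRing Pointwise

lemma avoid1 {R : Type u} [CommRing R] (J a : Ideal R) (s : Set (Ideal R)) (hs : s.Finite)
    (hp : ∀ p ∈ s, p.IsPrime) (ha : ¬ J ≤ a) (h : ∀ p ∈ s, ¬ J ≤ p) :
    ∃ x ∈ J, x ∉ a ∧ ∀ p ∈ s, x ∉ p := by
  classical
  by_contra hcon
  push Not at hcon
  have hsub : (J : Set R) ⊆ (a : Set R) ∪ a ∪ ⋃ p ∈ (hs.toFinset : Set (Ideal R)), (p : Set R) := by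
    intro x hx
    by_cases hxa : x ∈ a
    · exact Or.inl (Or.inl hxa)
    · obtain ⟨p, hp, hxp⟩ := hcon x hx hxa
      refine Or.inr ?_
      simp only [Set.mem_iUnion]
      exact ⟨p, by simpa using hp, hxp⟩
  rcases (Ideal.subset_union_prime' (f := id) (fun p hp' => hp p (by simpa using hp'))).1 hsub with h1 | h1 | ⟨p, hp', h1⟩
  · exact ha h1
  · exact ha h1
  · exact h p (by simpa using hp') h1

lemma avoid {R : Type u} [CommRing R] (J : Ideal R) (s : Set (Ideal R)) (hs : s.Finite)
    (hp : ∀ p ∈ s, p.IsPrime) (h : ∀ p ∈ s, ¬ J ≤ p) :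
    ∃ x ∈ J, ∀ p ∈ s, x ∉ p := by
  by_cases hJ : J = ⊥
  · subst hJ
    refine ⟨0, zero_mem _, fun p hp' _ => h p hp' bot_le⟩
  · obtain ⟨x, h1, -, h2⟩ := avoid1 J ⊥ s hs hp (by simpa using hJ) h
    exact ⟨x, h1, h2⟩

lemma wb_cancel {a : WithBot ℕ∞} {d : ℕ} (h : a + 1 = ((d+1 : ℕ):WithBot ℕ∞)) : a = d := by
  cases a with
  | bot => exact absurd h.symm (by rw [WithBot.bot_add]; exact WithBot.natCast_ne_bot _)
  | coe a =>
    cases a with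
    | top =>
      have : ((⊤ : ℕ∞) + 1 : ℕ∞) = ((d+1 : ℕ) : ℕ∞) := by exact_mod_cast h
      simp at this
      exact absurd this.symm (by exact_mod_cast ENat.natCast_ne_top (d+1))
    | coe a =>
      have : a + 1 = d + 1 := by exact_mod_cast h
      have : a = d := by omega
      subst this; rfl

def Reg (d : ℕ) (S : Type u) [CommRing S] [IsLocalRing S] : Prop :=
  (∃ s : Fin d → S, Ideal.span (Set.range s) = maximalIdeal S) ∧ ringKrullDim S = d

lemma quot_local {S : Type u} [CommRing S] [IsLocalRing S] {x : S} (hx : x ∈ maximalIdeal S) :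
    IsLocalRing (S ⧸ Ideal.span {x}) := by
  have : Nontrivial (S ⧸ Ideal.span {x}) := Ideal.Quotient.nontrivial_iff.2 (by
    rw [Ne, Ideal.span_singleton_eq_top]; exact hx)
  exact IsLocalRing.of_surjective' _ Ideal.Quotient.mk_surjective

variable {S : Type u} [CommRing S] [IsNoetherianRing S] [IsLocalRing S]

lemma dim_quot_eq {x : S} (hx : x ∈ maximalIdeal S) (hmin : ∀ p ∈ minimalPrimes S, x ∉ p) :
    ringKrullDim (S ⧸ Ideal.span {x}) + 1 = ringKrullDim S := by
  have h : Ideal.span {x} = x • (⊤ : Ideal S) := by simp [← Submodule.ideal_span_singleton_smul]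
  rw [ringKrullDim_eq_of_ringEquiv (Ideal.quotientEquivAlgOfEq S h).toRingEquiv,
    ← Module.supportDim_quotient_eq_ringKrullDim, ← Module.supportDim_self_eq_ringKrullDim]
  refine Module.supportDim_quotSMulTop_succ_eq_of_notMem_minimalPrimes_of_mem_jacobson ?_ ?_
  · simpa [Module.annihilator_eq_bot.2] using hmin
  · apply (Module.annihilator S S).ringJacobson_le_jacobson
    rwa [IsLocalRing.ringJacobson_eq_maximalIdeal]

lemma reg_core (d : ℕ) (h : Reg (d+1) S) : ∃ x, ∃ hx : x ∈ maximalIdeal S, (∀ p ∈ minimalPrimes S, x ∉ p) ∧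
    @Reg d (S ⧸ Ideal.span {x}) _ (quot_local hx) := by
  obtain ⟨⟨s, hs⟩, hd⟩ := h
  have h1 : ∀ p ∈ minimalPrimes S, ¬ maximalIdeal S ≤ p := by
    intro p hp hle
    have hpr : p.IsPrime := hp.1.1
    have : p = maximalIdeal S := le_antisymm (IsLocalRing.le_maximalIdeal hpr.ne_top) hle
    have h2 := IsLocalRing.maximalIdeal_height_eq_ringKrullDim (R := S)
    have h3 : (maximalIdeal S).height = 0 := by
      rw [Ideal.height_eq_zero_iff]
      rwa [this] at hp
    rw [h3, hd] at h2
    have : ((0:ℕ) : WithBot ℕ∞) = ((d+1 : ℕ) : WithBot ℕ∞) := by simpa using h2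
    rw [Nat.cast_inj] at this
    omega
  have h2 : ¬ maximalIdeal S ≤ maximalIdeal S • maximalIdeal S := by
    intro hle
    have h0 : maximalIdeal S = ⊥ := Submodule.eq_bot_of_le_smul_of_le_jacobson_bot (maximalIdeal S) _
      (IsNoetherian.noetherian _) hle (IsLocalRing.maximalIdeal_le_jacobson _)
    obtain ⟨p, hp⟩ := Ideal.nonempty_minimalPrimes (R := S) (I := ⊥) bot_ne_top
    exact h1 p hp (h0 ▸ bot_le)
  obtain ⟨x, hx, hx2, hxp⟩ := avoid1 _ _ _ (minimalPrimes.finite_of_isNoetherianRing S) (fun p hp => hp.1.1) h2 h1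
  refine ⟨x, hx, hxp, ?_⟩
  have := quot_local hx
  refine ⟨?_, ?_⟩
  · have hx' := hx
    rw [← hs, Ideal.mem_span_range_iff_exists_fun] at hx'
    obtain ⟨c, hc⟩ := hx'
    have : ∃ j, IsUnit (c j) := by
      by_contra hcon
      push Not at hcon
      apply hx2
      rw [← hc]
      refine Submodule.sum_mem _ fun i _ => Submodule.smul_mem_smul (hcon i) ?_
      rw [← hs]; exact Ideal.subset_span ⟨i, rfl⟩
    obtain ⟨j, hj⟩ := this
    refine ⟨fun i => Ideal.Quotient.mk _ (s (j.succAbove i)), ?_⟩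
    rw [← IsLocalRing.map_maximalIdeal_of_surjective (Ideal.Quotient.mk (Ideal.span {x})) Ideal.Quotient.mk_surjective, ← hs,
      Ideal.map_span]
    apply le_antisymm
    · apply Ideal.span_mono
      rintro _ ⟨i, rfl⟩
      exact ⟨_, ⟨_, rfl⟩, rfl⟩
    · rw [Ideal.span_le]
      rintro _ ⟨_, ⟨i, rfl⟩, rfl⟩
      rcases Fin.eq_self_or_eq_succAbove j i with rfl | ⟨k, rfl⟩
      · rw [Fin.sum_univ_succAbove _ i] at hc
        have h3 : (Ideal.Quotient.mk (Ideal.span {x})) x = 0 := Ideal.Quotient.eq_zero_iff_mem.2 (Ideal.mem_span_singleton_self x)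
        have hc2 := congrArg (Ideal.Quotient.mk (Ideal.span {x})) hc
        rw [h3, map_add, map_mul, map_sum] at hc2
        have h4 : IsUnit ((Ideal.Quotient.mk (Ideal.span {x})) (c i)) := hj.map _
        rw [SetLike.mem_coe, ← Ideal.unit_mul_mem_iff_mem _ h4, eq_neg_of_add_eq_zero_left hc2]
        refine neg_mem (sum_mem fun k _ => ?_)
        rw [map_mul]
        exact Ideal.mul_mem_left _ _ (Ideal.subset_span ⟨k, rfl⟩)
      · exact Ideal.subset_span ⟨k, rfl⟩
  · have := dim_quot_eq hx hxp
    rw [hd] at this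
    exact wb_cancel this

omit [IsNoetherianRing S] in
lemma reg_zero (h : Reg 0 S) : maximalIdeal S = ⊥ := by
  obtain ⟨⟨s, hs⟩, -⟩ := h
  rw [← hs]; simp

lemma reg_dom (d : ℕ) : ∀ (S : Type u) [CommRing S] [IsNoetherianRing S] [IsLocalRing S], Reg d S → IsDomain S := by
  induction d with
  | zero =>
    intro S _ _ _ h
    have := (IsLocalRing.isField_iff_maximalIdeal_eq (R := S)).2 (reg_zero h)
    exact this.isDomain
  | succ d ih =>
    intro S _ _ _ h
    obtain ⟨x, hx, hmin, hr⟩ := reg_core d h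
    have := quot_local hx
    have hdom := ih _ hr
    have hpr : (Ideal.span {x}).IsPrime := (Ideal.Quotient.isDomain_iff_prime _).1 hdom
    obtain ⟨P, hP, hPx⟩ := Ideal.exists_minimalPrimes_le (I := (⊥ : Ideal S)) (J := Ideal.span {x}) bot_le
    have hPp : P.IsPrime := hP.1.1
    have hxP := hmin P hP
    have : P = ⊥ := by
      apply Submodule.eq_bot_of_le_smul_of_le_jacobson_bot (Ideal.span {x}) P (IsNoetherian.noetherian _)
      · intro y hy
        obtain ⟨z, rfl⟩ := Ideal.mem_span_singleton'.1 (hPx hy)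
        rcases hPp.mem_or_mem hy with h1 | h1
        · rw [mul_comm]
          exact Submodule.smul_mem_smul (Ideal.mem_span_singleton_self x) h1
        · exact absurd h1 hxP
      · exact ((Ideal.span_singleton_le_iff_mem _).2 hx).trans (IsLocalRing.maximalIdeal_le_jacobson _)
    subst this
    exact IsDomain.of_bot_isPrime S

/-- A chain of primes each generated by one more element -/
structure RChain (d : ℕ) (J : ℕ → Ideal S) (x : ℕ → S) : Prop where
  zero : J 0 = ⊥
  succ : ∀ i, J (i+1) = J i ⊔ Ideal.span {x i}
  notMem : ∀ i, i < d → x i ∉ J i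
  prime : ∀ i, i ≤ d → (J i).IsPrime
  last : J d = maximalIdeal S

lemma reg_chain (d : ℕ) : ∀ (S : Type u) [CommRing S] [IsNoetherianRing S] [IsLocalRing S], Reg d S →
    ∃ J x, RChain (S := S) d J x := by
  induction d with
  | zero =>
    intro S _ _ _ h
    have := reg_dom 0 S h
    exact ⟨fun _ => ⊥, fun _ => 0, rfl, by simp, by simp, fun _ _ => Ideal.isPrime_bot, (reg_zero h).symm⟩
  | succ d ih =>
    intro S _ _ _ h
    obtain ⟨x, hx, hmin, hr⟩ := reg_core d h
    have := quot_local hx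
    have hdom := reg_dom _ _ h
    obtain ⟨J, y, hJ⟩ := ih _ hr
    choose z hz using fun i => Ideal.Quotient.mk_surjective (I := Ideal.span {x}) (y i)
    refine ⟨fun i => Nat.casesOn i ⊥ fun i => (J i).comap (Ideal.Quotient.mk _), fun i => Nat.casesOn i x z, rfl, ?_, ?_, ?_, ?_⟩
    · rintro (_ | i)
      · simp [hJ.zero, ← RingHom.ker_eq_comap_bot]
      · simp only [hJ.succ i]
        rw [← hz, ← Set.image_singleton, ← Ideal.map_span]
        have h1 : J i = ((J i).comap (Ideal.Quotient.mk (Ideal.span {x}))).map (Ideal.Quotient.mk _) :=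
          (Ideal.map_comap_of_surjective _ Ideal.Quotient.mk_surjective _).symm
        conv_lhs => rw [h1]
        rw [← Ideal.map_sup, Ideal.comap_map_of_surjective _ Ideal.Quotient.mk_surjective]
        apply sup_eq_left.2
        exact (Ideal.comap_mono bot_le).trans le_sup_left
    · rintro (_ | i) hi
      · exact fun h0 => hmin ⊥ (by simp [IsDomain.minimalPrimes_eq_singleton_bot]) h0
      · simpa [hz] using hJ.notMem i (by omega)
    · rintro (_ | i) hi
      · exact Ideal.isPrime_bot
      · have := hJ.prime i (by omega)
        exact Ideal.comap_isPrime _ _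
    · change (J d).comap (Ideal.Quotient.mk _) = _
      rw [hJ.last]
      have hm := ((Ideal.comap_isMaximal_of_surjective (Ideal.Quotient.mk (Ideal.span {x})) Ideal.Quotient.mk_surjective (K := maximalIdeal _)))
      exact IsLocalRing.eq_maximalIdeal hm

lemma reg_step (d : ℕ) (h : Reg (d+1) S) : ∃ x, ∃ hx : x ∈ maximalIdeal S, x ≠ 0 ∧
    @Reg d (S ⧸ Ideal.span {x}) _ (quot_local hx) := by
  obtain ⟨x, hx, hmin, hr⟩ := reg_core d h
  have hdom := reg_dom _ _ h
  exact ⟨x, hx, fun h0 => hmin ⊥ (by simp [IsDomain.minimalPrimes_eq_singleton_bot]) (by simp [h0]), hr⟩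
end RegBasics

end Part12

section Part13
open CategoryTheory

section FFR
open IsLocalRing Pointwise

def PD (S : Type u) [CommRing S] : ℕ → ∀ (M : Type u) [AddCommGroup M] [Module S M], Prop
  | 0, M, _, _ => Module.Free S M
  | n+1, M, _, _ => ∀ (r : ℕ) (f : (Fin r → S) →ₗ[S] M), Function.Surjective f → PD S n (LinearMap.ker f)

lemma PD.congr {S : Type u} [CommRing S] (n : ℕ) : ∀ {M N : Type u} [AddCommGroup M] [Module S M] [AddCommGroup N] [Module S N]
    (e : M ≃ₗ[S] N), PD S n M → PD S n N := by
  induction n with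
  | zero =>
    intro M N _ _ _ _ e h
    have : Module.Free S M := h
    exact Module.Free.of_equiv e
  | succ n ih =>
    intro M N _ _ _ _ e h r f hf
    exact ih (LinearEquiv.ofEq _ _ (LinearEquiv.ker_comp _ _)) (h r (e.symm.toLinearMap ∘ₗ f) (e.symm.surjective.comp hf))

lemma ker_quot {S : Type u} [CommRing S] {M : Type u} [AddCommGroup M] [Module S M] (x : S) (hx : IsSMulRegular M x) {r : ℕ}
    (f : (Fin r → S) →ₗ[S] M) (hf : Function.Surjective f) :
    ∃ fb : (Fin r → S ⧸ Ideal.span {x}) →ₗ[S ⧸ Ideal.span {x}] QuotSMulTop x M, Function.Surjective fb ∧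
      Nonempty (LinearMap.ker fb ≃ₗ[S ⧸ Ideal.span {x}] QuotSMulTop x (LinearMap.ker f)) := by
  classical
  let v : Fin r → QuotSMulTop x M := fun i => Submodule.Quotient.mk (f (Pi.single i 1))
  let fb := Fintype.linearCombination (S ⧸ Ideal.span {x}) v
  have h1 : ∀ a : Fin r → S, fb (fun i => Ideal.Quotient.mk _ (a i)) = Submodule.Quotient.mk (f a) := by
    intro a
    rw [Fintype.linearCombination_apply]
    conv_rhs => rw [← pi_eq_sum_univ' a |>.symm, map_sum, ← Submodule.mkQ_apply, map_sum]
    refine Finset.sum_congr rfl fun i _ => ?_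
    rw [map_smul, map_smul]
    rfl
  have hl : ∀ a : Fin r → S ⧸ Ideal.span {x}, ∃ b : Fin r → S, a = fun i => Ideal.Quotient.mk _ (b i) := by
    intro a
    choose b hb using fun i => Ideal.Quotient.mk_surjective (a i)
    exact ⟨b, funext fun i => (hb i).symm⟩
  refine ⟨fb, ?_, ?_⟩
  · intro y
    obtain ⟨m, rfl⟩ := Submodule.Quotient.mk_surjective _ y
    obtain ⟨a, rfl⟩ := hf m
    exact ⟨_, h1 a⟩
  · let g : LinearMap.ker f →ₗ[S] LinearMap.ker fb :=
      { toFun := fun k => ⟨fun i => Ideal.Quotient.mk _ (k.1 i), by rw [LinearMap.mem_ker, h1, LinearMap.mem_ker.1 k.2]; rfl⟩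
        map_add' := fun a b => by ext; simp
        map_smul' := fun a b => by ext; rfl }
    have hg : Function.Surjective g := by
      rintro ⟨a, ha⟩
      obtain ⟨b, rfl⟩ := hl a
      rw [LinearMap.mem_ker, h1, Submodule.Quotient.mk_eq_zero] at ha
      obtain ⟨y, -, hy⟩ := ha
      obtain ⟨c, rfl⟩ := hf y
      refine ⟨⟨b - x • c, ?_⟩, ?_⟩
      · rw [LinearMap.mem_ker, map_sub, map_smul, ← hy]; simp
      · ext i
        simp [g]
    have hker : LinearMap.ker g = x • ⊤ := by
      apply le_antisymm
      · rintro ⟨k, hk⟩ h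
        have h2 : ∀ i, k i ∈ Ideal.span {x} := fun i => Ideal.Quotient.eq_zero_iff_mem.1 (congrFun (congrArg Subtype.val h) i)
        choose c hc using fun i => Ideal.mem_span_singleton'.1 (h2 i)
        have h3 : k = x • c := by ext i; simp [← hc, mul_comm]
        have h4 : f c = 0 := by
          apply hx
          rw [LinearMap.mem_ker, h3, map_smul] at hk
          simpa using hk
        rw [← SetLike.mem_coe, Submodule.coe_pointwise_smul]
        exact ⟨⟨c, h4⟩, trivial, by ext i; simp [h3]⟩
      · rintro _ ⟨k, -, rfl⟩
        rw [LinearMap.mem_ker]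
        ext i
        have : (Ideal.Quotient.mk (Ideal.span {x})) x = 0 := Ideal.Quotient.eq_zero_iff_mem.2 (Ideal.mem_span_singleton_self x)
        change (Ideal.Quotient.mk (Ideal.span {x})) (x * k.1 i) = 0
        rw [map_mul, this, zero_mul]
    exact ⟨(((Submodule.quotEquivOfEq _ _ hker.symm).trans (g.quotKerEquivOfSurjective hg)).extendScalarsOfSurjective
      Ideal.Quotient.mk_surjective).symm⟩

lemma PD.of_quot {S : Type u} [CommRing S] [IsNoetherianRing S] [IsLocalRing S] {x : S} (hxm : x ∈ maximalIdeal S)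
    (hxS : IsSMulRegular S x) (n : ℕ) :
    ∀ {M : Type u} [AddCommGroup M] [Module S M] [Module.Finite S M], IsSMulRegular M x →
    PD (S ⧸ Ideal.span {x}) n (QuotSMulTop x M) → PD S n M := by
  induction n with
  | zero =>
    intro M _ _ _ hx h
    have : Module.FinitePresentation S M := Module.finitePresentation_of_finite S M
    exact (Module.free_quotSMulTop_iff_free S M (IsLocalRing.maximalIdeal_le_jacobson _ hxm) hx).1 h
  | succ n ih =>
    intro M _ _ _ hx h r f hf
    obtain ⟨fb, hfb, ⟨e⟩⟩ := ker_quot x hx f hf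
    apply ih
    · intro a b hab
      ext i
      exact hxS (congrFun (congrArg Subtype.val hab) i)
    · exact PD.congr n e (h r fb hfb)

lemma reg_PD (d : ℕ) : ∀ (S : Type u) [CommRing S] [IsNoetherianRing S] [IsLocalRing S], Reg d S →
    ∀ (M : Type u) [AddCommGroup M] [Module S M] [Module.Finite S M], PD S d M := by
  induction d with
  | zero =>
    intro S _ _ _ h M _ _ _
    have := (IsLocalRing.isField_iff_maximalIdeal_eq (R := S)).2 (reg_zero h)
    let := this.toField
    exact Module.Free.of_divisionRing S M
  | succ d ih =>
    intro S _ _ _ h M _ _ _ r f hf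
    obtain ⟨x, hx, hx0, hr⟩ := reg_step d h
    have hdom := reg_dom _ _ h
    have := quot_local hx
    have hxS : IsSMulRegular S x := fun a b hab => mul_left_cancel₀ hx0 hab
    have : Module.Finite (S ⧸ Ideal.span {x}) (QuotSMulTop x (LinearMap.ker f)) :=
      Module.Finite.of_restrictScalars_finite S _ _
    refine PD.of_quot hx hxS d ?_ (ih _ hr _)
    intro a b hab
    ext i
    exact hxS (congrFun (congrArg Subtype.val hab) i)
end FFR

end Part13

section Part14
open CategoryTheory

section UFD1

lemma complete_field {k : Type u} [Field k] {m r : ℕ} (v : Fin m → (Fin m ⊕ Fin r) → k) (hv : LinearIndependent k v) :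
    ∃ w : Fin r → (Fin m ⊕ Fin r) → k, LinearIndependent k (Sum.elim v w) := by
  classical
  let B := Module.Basis.sumExtend hv
  have : Fintype (Module.Basis.sumExtendIndex hv) := by
    have : Finite (Fin m ⊕ Module.Basis.sumExtendIndex hv) := Module.Finite.finite_basis B
    have : Finite (Module.Basis.sumExtendIndex hv) := Finite.of_injective (Sum.inr (α := Fin m)) Sum.inr_injective
    exact Fintype.ofFinite _
  have hc : Fintype.card (Module.Basis.sumExtendIndex hv) = r := by
    have := Module.finrank_eq_card_basis B
    rw [Module.finrank_fintype_fun_eq_card, Fintype.card_sum, Fintype.card_sum, Fintype.card_fin, Fintype.card_fin] at this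
    omega
  let e : Fin r ≃ Module.Basis.sumExtendIndex hv := (Fintype.equivFinOfCardEq hc).symm
  refine ⟨fun i => B (Sum.inr (e i)), ?_⟩
  have h := B.linearIndependent.comp (Sum.map id e) (Function.injective_id.sumMap e.injective)
  have h2 : Sum.elim v (fun i => B (Sum.inr (e i))) = B ∘ Sum.map id e := by
    ext i j
    rcases i with i | i
    · simp [B, Module.Basis.sumExtend]
      rfl
    · rfl
  rw [h2]; exact h

lemma complete_dom {D : Type u} [CommRing D] [IsDomain D] {m r : ℕ} (v : Fin m → (Fin m ⊕ Fin r) → D) (hv : LinearIndependent D v) :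
    ∃ w : Fin r → (Fin m ⊕ Fin r) → D, (Matrix.of (Sum.elim v w)).det ≠ 0 := by
  classical
  let K := FractionRing D
  let j : ((Fin m ⊕ Fin r) → D) →ₗ[D] ((Fin m ⊕ Fin r) → K) := LinearMap.compLeft (Algebra.linearMap D K) _
  have hj : Function.Injective j := by
    intro a b h
    ext l
    exact IsFractionRing.injective D K (congrFun h l)
  have h1 : LinearIndependent D (j ∘ v) := hv.map' j (LinearMap.ker_eq_bot.2 hj)
  obtain ⟨w', hw'⟩ := complete_field (j ∘ v) (h1.localization K (nonZeroDivisors D))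
  obtain ⟨b, hb⟩ := IsLocalization.exist_integer_multiples_of_finite (nonZeroDivisors D) (fun t : Fin r × (Fin m ⊕ Fin r) => w' t.1 t.2)
  choose w hw using hb
  refine ⟨fun i l => w (i, l), fun hdet => ?_⟩
  have hb0 : algebraMap D K b ≠ 0 := IsFractionRing.to_map_ne_zero_of_mem_nonZeroDivisors b.2
  have h2 := hw'.units_smul (Sum.elim (fun _ => 1) (fun _ => Units.mk0 _ hb0))
  have h3 := Matrix.linearIndependent_rows_iff_isUnit (A := (Matrix.of (Sum.elim v fun i l => w (i, l))).map (algebraMap D K)) |>.1 (by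
    convert h2 using 1
    ext i l
    rcases i with i | i
    · simp [Matrix.row, j]
    · simp [Matrix.row, hw, Algebra.smul_def, Units.smul_def])
  rw [Matrix.isUnit_iff_isUnit_det, ← RingHom.mapMatrix_apply, ← RingHom.map_det, hdet] at h3
  simp at h3

variable {S : Type u} [CommRing S] [IsDomain S]

def DD (q : Ideal S) : Prop := q.IsPrime ∧ ∃ β c : S, β ≠ 0 ∧ ∀ a, a ∈ q ↔ β ∣ a * c

def QB {X : Type u} [AddCommGroup X] [Module S X] (q : Ideal S) {r : ℕ} (x : Fin r → X) : Prop :=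
  ∀ y, ∃ s, s ∉ q ∧ s • y ∈ Submodule.span S (Set.range x)

variable (S) in
def TF (X : Type u) [AddCommGroup X] [Module S X] : Prop := ∀ (s : S) (y : X), s ≠ 0 → s • y = 0 → y = 0

lemma exchange {X : Type u} [AddCommGroup X] [Module S X] {m r : ℕ} (f : ((Fin m ⊕ Fin r) → S) →ₗ[S] X) (hX : TF S X)
    {q : Ideal S} (hq : DD q) (k : Fin m → LinearMap.ker f) (hk : QB q k) (hli : LinearIndependent S k) :
    ∃ w : Fin r → (Fin m ⊕ Fin r) → S, (Matrix.of (Sum.elim (fun i => (k i).1) w)).det ∉ q := by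
  classical
  obtain ⟨hqp, β, c, hβ, hqc⟩ := hq
  have h1 : LinearIndependent (S ⧸ q) (fun i l => Ideal.Quotient.mk q ((k i).1 l)) := by
    rw [Fintype.linearIndependent_iff]
    intro g hg
    choose a ha using fun i => Ideal.Quotient.mk_surjective (g i)
    have h2 : ∀ l, ∑ i, a i * (k i).1 l ∈ q := by
      intro l
      rw [← Ideal.Quotient.eq_zero_iff_mem, map_sum]
      have := congrFun hg l
      simpa [← ha] using this
    choose z hz using fun l => (hqc _).1 (h2 l)
    have h3 : c • ∑ i, a i • (k i).1 = β • z := by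
      ext l
      simp only [Pi.smul_apply, Finset.sum_apply, smul_eq_mul]
      rw [← hz, mul_comm]
    have h4 : f z = 0 := by
      apply hX β _ hβ
      rw [← map_smul, ← h3, map_smul, map_sum, Finset.sum_eq_zero, smul_zero]
      intro i _
      rw [map_smul, LinearMap.mem_ker.1 (k i).2, smul_zero]
    obtain ⟨s, hs, hsz⟩ := hk ⟨z, h4⟩
    rw [Submodule.mem_span_range_iff_exists_fun] at hsz
    obtain ⟨b, hb⟩ := hsz
    have h5 : ∑ i, (s * (c * a i) - β * b i) • k i = 0 := by
      apply Subtype.ext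
      ext l
      have e1 : ∑ i, b i * (k i).1 l = s * z l := by
        have := congrFun (congrArg Subtype.val hb) l
        simpa using this
      have e2 := hz l
      have e3 : ∀ i, (s * (c * a i) - β * b i) * (k i).1 l = s * c * (a i * (k i).1 l) - β * (b i * (k i).1 l) := fun i => by ring
      simp only [Submodule.coe_sum, Submodule.coe_smul, Finset.sum_apply, Pi.smul_apply, smul_eq_mul, e3, Finset.sum_sub_distrib, ← Finset.mul_sum]
      rw [e1, mul_assoc, mul_comm c, e2]
      simp; ring
    rw [Fintype.linearIndependent_iff] at hli
    intro i
    have h6 := hli _ h5 i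
    rw [← ha, Ideal.Quotient.eq_zero_iff_mem]
    have h7 : s * a i ∈ q := (hqc _).2 ⟨b i, by rw [← sub_eq_zero, ← h6]; ring⟩
    exact (hqp.mem_or_mem h7).resolve_left hs
  obtain ⟨w, hw⟩ := complete_dom _ h1
  choose w' hw' using fun i l => Ideal.Quotient.mk_surjective (w i l)
  refine ⟨w', fun h => hw ?_⟩
  rw [← Ideal.Quotient.eq_zero_iff_mem, RingHom.map_det] at h
  rw [← h]
  congr 1
  ext i l
  rcases i with i | i
  · simp
  · simp [hw']

variable (S) in
def GoodM (X : Type u) [AddCommGroup X] [Module S X] : Prop :=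
  ∃ (r : ℕ) (ι : X →ₗ[S] (Fin r → FractionRing S)) (γ : FractionRing S), γ ≠ 0 ∧ ∀ q : Ideal S, DD q →
    ∃ x : Fin r → X, QB q x ∧ ∃ u v : S, u ∉ q ∧ v ∉ q ∧
      (Matrix.of fun i => ι (x i)).det * algebraMap S _ v = γ * algebraMap S _ u

lemma GoodM.congr {X Y : Type u} [AddCommGroup X] [Module S X] [AddCommGroup Y] [Module S Y] (e : X ≃ₗ[S] Y) (h : GoodM S X) : GoodM S Y := by
  obtain ⟨r, ι, γ, hγ, H⟩ := h
  refine ⟨r, ι ∘ₗ e.symm.toLinearMap, γ, hγ, fun q hq => ?_⟩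
  obtain ⟨x, hx, u, v, hu, hv, h⟩ := H q hq
  refine ⟨e ∘ x, fun y => ?_, u, v, hu, hv, by simpa using h⟩
  obtain ⟨s, hs, h2⟩ := hx (e.symm y)
  refine ⟨s, hs, ?_⟩
  have := Submodule.mem_map_of_mem (f := e.toLinearMap) h2
  rw [Submodule.map_span] at this
  simpa [Set.range_comp] using this

lemma GoodM.free (n : ℕ) : GoodM S (Fin n → S) := by
  classical
  refine ⟨n, LinearMap.compLeft (Algebra.linearMap S _) _, 1, one_ne_zero, fun q hq =>
    ⟨fun i => Pi.single i 1, fun y => ⟨1, fun h => hq.1.ne_top (q.eq_top_iff_one.2 h), ?_⟩, 1, 1,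
      fun h => hq.1.ne_top (q.eq_top_iff_one.2 h), fun h => hq.1.ne_top (q.eq_top_iff_one.2 h), ?_⟩⟩
  · rw [Submodule.mem_span_range_iff_exists_fun]
    exact ⟨y, by rw [one_smul]; ext l; simp [Pi.single_apply]⟩
  · have : (Matrix.of fun i : Fin n => (LinearMap.compLeft (Algebra.linearMap S (FractionRing S)) (Fin n)) (Pi.single i 1)) = 1 := by
      ext i j
      simp [Matrix.one_apply, Pi.single_apply, eq_comm, apply_ite]
    rw [this]; simp

end UFD1

end Part14

section Part15
open CategoryTheory

section UFD2
variable {S : Type u} [CommRing S] [IsDomain S]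

lemma li_of_det {X : Type u} [AddCommGroup X] [Module S X] {r : ℕ} (ι : X →ₗ[S] (Fin r → FractionRing S)) (x : Fin r → X)
    (h : (Matrix.of fun i => ι (x i)).det ≠ 0) : LinearIndependent S x := by
  have h1 : IsUnit (Matrix.of fun i => ι (x i)) := (Matrix.isUnit_iff_isUnit_det _).2 (isUnit_iff_ne_zero.2 h)
  have h2 := Matrix.linearIndependent_rows_iff_isUnit.2 h1
  have h3 : LinearIndependent S (ι ∘ x) := h2.restrict_scalars (by
    intro a b hab
    apply IsFractionRing.injective S (FractionRing S)
    simpa [Algebra.smul_def] using hab)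
  exact LinearIndependent.of_comp ι h3

lemma good_core {X : Type u} [AddCommGroup X] [Module S X] {m r : ℕ} (f : ((Fin m ⊕ Fin r) → S) →ₗ[S] X) (hf : Function.Surjective f)
    (hX : TF S X) (ι : LinearMap.ker f →ₗ[S] (Fin m → FractionRing S)) (γ : FractionRing S) (hγ : γ ≠ 0)
    (H : ∀ q : Ideal S, DD q →
      ∃ x : Fin m → LinearMap.ker f, QB q x ∧ ∃ u v : S, u ∉ q ∧ v ∉ q ∧
        (Matrix.of fun i => ι (x i)).det * algebraMap S _ v = γ * algebraMap S _ u)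
    (q0 : Ideal S) (hq0 : DD q0) : GoodM S X := by
  classical
  let K := FractionRing S
  have inj := IsFractionRing.injective S K
  have hdet : ∀ (q : Ideal S) (x : Fin m → LinearMap.ker f) (u v : S), u ∉ q →
      (Matrix.of fun i => ι (x i)).det * algebraMap S _ v = γ * algebraMap S _ u → (Matrix.of fun i => ι (x i)).det ≠ 0 := by
    intro q x u v hu h h0
    rw [h0, zero_mul, eq_comm, mul_eq_zero] at h
    rcases h with h | h
    · exact hγ h
    · rw [map_eq_zero_iff _ inj] at h
      exact hu (h ▸ q.zero_mem)
  obtain ⟨k0, hk0, u0, v0, hu0, hv0, he0⟩ := H q0 hq0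
  have hd0 := hdet _ _ _ _ hu0 he0
  have hli0 := li_of_det ι k0 hd0
  let j : ((Fin m ⊕ Fin r) → S) →ₗ[S] ((Fin m ⊕ Fin r) → K) := LinearMap.compLeft (Algebra.linearMap S K) _
  have hj : Function.Injective j := by
    intro a b h
    ext l
    exact inj (congrFun h l)
  have h1 : LinearIndependent S (j ∘ (fun i => (k0 i).1)) :=
    (hli0.map' (LinearMap.ker f).subtype (by simp)).map' j (LinearMap.ker_eq_bot.2 hj)
  obtain ⟨w0, hw0⟩ := complete_field _ (h1.localization K (nonZeroDivisors S))
  set T : Matrix (Fin m ⊕ Fin r) (Fin m ⊕ Fin r) K := Matrix.of (Sum.elim (j ∘ (fun i => (k0 i).1)) w0) with hT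
  have hTu : IsUnit T := Matrix.linearIndependent_rows_iff_isUnit.1 hw0
  have hTd : IsUnit T.det := (Matrix.isUnit_iff_isUnit_det _).1 hTu
  let co : ((Fin m ⊕ Fin r) → S) →ₗ[S] ((Fin m ⊕ Fin r) → K) := (T⁻¹.vecMulLinear).restrictScalars S ∘ₗ j
  -- coordinates of kernel elements
  have hco : ∀ k : LinearMap.ker f, (∀ t, co k.1 (Sum.inr t) = 0) ∧ ι k = ∑ l, co k.1 (Sum.inl l) • ι (k0 l) := by
    intro k
    obtain ⟨s, hs, hsk⟩ := hk0 k
    have hs0 : algebraMap S K s ≠ 0 := by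
      rw [Ne, map_eq_zero_iff _ inj]
      rintro rfl; exact hs q0.zero_mem
    rw [Submodule.mem_span_range_iff_exists_fun] at hsk
    obtain ⟨a, ha⟩ := hsk
    have e1 : j (s • k.1) = Matrix.vecMul (Sum.elim (fun l => algebraMap S K (a l)) 0) T := by
      have : s • k.1 = ∑ l, a l • (k0 l).1 := by
        have := congrArg Subtype.val ha
        simpa using this.symm
      rw [this]
      ext l
      simp [j, Matrix.vecMul, dotProduct, hT]
    have e2 : s • co k.1 = Sum.elim (fun l => algebraMap S K (a l)) 0 := by
      rw [← map_smul]
      change Matrix.vecMul (j (s • k.1)) T⁻¹ = _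
      rw [e1, Matrix.vecMul_vecMul, Matrix.mul_nonsing_inv _ hTd, Matrix.vecMul_one]
    refine ⟨fun t => ?_, ?_⟩
    · have := congrFun e2 (Sum.inr t)
      simp [Algebra.smul_def] at this
      rcases this with h | h
      · exact absurd h (by rintro rfl; exact hs q0.zero_mem)
      · exact h
    · have e3 : algebraMap S K s • ι k = algebraMap S K s • ∑ l, co k.1 (Sum.inl l) • ι (k0 l) := by
        rw [Finset.smul_sum, algebraMap_smul, ← map_smul, ← ha, map_sum]
        refine Finset.sum_congr rfl fun l _ => ?_
        have := congrFun e2 (Sum.inl l)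
        simp [Algebra.smul_def] at this
        rw [smul_smul, this, algebraMap_smul, map_smul]
      exact smul_right_injective _ hs0 e3
  let g : ((Fin m ⊕ Fin r) → S) →ₗ[S] (Fin r → K) :=
    { toFun := fun y t => co y (Sum.inr t)
      map_add' := fun a b => by ext; simp
      map_smul' := fun a b => by ext; simp }
  have hg : LinearMap.ker f ≤ LinearMap.ker g := by
    intro y hy
    rw [LinearMap.mem_ker]
    ext t
    exact (hco ⟨y, hy⟩).1 t
  let ιX : X →ₗ[S] (Fin r → K) := (LinearMap.ker f).liftQ g hg ∘ₗ (f.quotKerEquivOfSurjective hf).symm.toLinearMap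
  have hιX : ∀ y, ιX (f y) = g y := by
    intro y
    have : (f.quotKerEquivOfSurjective hf).symm (f y) = Submodule.Quotient.mk y := by
      rw [LinearEquiv.symm_apply_eq]; rfl
    simp [ιX, this]
  refine ⟨r, ιX, T⁻¹.det * (Matrix.of fun i => ι (k0 i)).det / γ, ?_, fun q hq => ?_⟩
  · refine div_ne_zero (mul_ne_zero ?_ hd0) hγ
    rw [Matrix.det_nonsing_inv]
    rw [Ring.inverse_eq_inv']; exact inv_ne_zero hTd.ne_zero
  obtain ⟨k, hk, u, v, hu, hv, he⟩ := H q hq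
  have hd := hdet _ _ _ _ hu he
  obtain ⟨w, hw⟩ := exchange f hX hq k hk (li_of_det ι k hd)
  set M := Matrix.of (Sum.elim (fun i => (k i).1) w) with hM
  refine ⟨fun t => f (w t), ?_, M.det * v, u, ?_, hu, ?_⟩
  · intro y
    obtain ⟨z, rfl⟩ := hf y
    refine ⟨M.det, hw, ?_⟩
    have e1 : M.det • z = Matrix.vecMul (Matrix.vecMul z M.adjugate) M := by
      rw [Matrix.vecMul_vecMul, Matrix.adjugate_mul, Matrix.vecMul_smul, Matrix.vecMul_one]
    rw [← map_smul, e1, Matrix.vecMul_eq_sum, map_sum, Fintype.sum_sum_type]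
    refine add_mem ?_ ?_
    · refine sum_mem fun i _ => ?_
      rw [map_smul]
      have : f (M (Sum.inl i)) = 0 := (k i).2
      rw [this, smul_zero]; exact zero_mem _
    · refine sum_mem fun i _ => ?_
      rw [map_smul]
      exact Submodule.smul_mem _ _ (Submodule.subset_span ⟨i, rfl⟩)
  · exact fun h => (hq.1.mem_or_mem h).elim hw hv
  · set A : Matrix (Fin m) (Fin m) K := Matrix.of fun i l => co (k i).1 (Sum.inl l) with hA
    have e1 : M.map (algebraMap S K) * T⁻¹ = Matrix.fromBlocks A 0 (Matrix.of fun i l => co (w i) (Sum.inl l))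
        (Matrix.of fun i => ιX (f (w i))) := by
      ext i l
      have hrow : (M.map (algebraMap S K) * T⁻¹) i l = co (M i) l := rfl
      rw [hrow]
      rcases i with i | i <;> rcases l with l | l
      · rfl
      · exact (hco (k i)).1 l
      · rfl
      · simp only [Matrix.fromBlocks_apply₂₂, Matrix.of_apply, hιX]
        rfl
    have e2 := congrArg Matrix.det e1
    rw [Matrix.det_mul, Matrix.det_fromBlocks_zero₁₂, ← RingHom.mapMatrix_apply, ← RingHom.map_det] at e2
    have e3 : (Matrix.of fun i => ι (k i)) = A * (Matrix.of fun i => ι (k0 i)) := by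
      ext i l
      rw [Matrix.of_apply, (hco (k i)).2]
      simp [Matrix.mul_apply, hA]
    rw [e3, Matrix.det_mul] at he
    rw [map_mul, div_mul_eq_mul_div, eq_div_iff hγ]
    linear_combination (-(Matrix.of fun i => ιX (f (w i))).det) * he - algebraMap S K v * (Matrix.of fun i => ι (k0 i)).det * e2

lemma good_of_PD (n : ℕ) [IsNoetherianRing S] : ∀ (X : Type u) [AddCommGroup X] [Module S X] [Module.Finite S X], TF S X → PD S n X → GoodM S X := by
  induction n with
  | zero =>
    intro X _ _ _ _ h
    have : Module.Free S X := h
    let b := Module.finBasis S X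
    exact (GoodM.free _).congr b.equivFun.symm
  | succ n ih =>
    intro X _ _ _ hX h
    by_cases hD : ∃ q : Ideal S, DD q
    swap
    · push Not at hD
      exact ⟨0, 0, 1, one_ne_zero, fun q hq => absurd hq (hD q)⟩
    obtain ⟨q0, hq0⟩ := hD
    obtain ⟨N, f, hf⟩ := Module.Finite.exists_fin' S X
    have h1 := ih (LinearMap.ker f) (by
      intro s y hs hy
      ext l
      have := congrFun (congrArg Subtype.val hy) l
      simpa [hs] using this) (h N f hf)
    have hm : ∃ r, N = (Classical.choose h1) + r := by
      obtain ⟨ι, γ, hγ, H⟩ := Classical.choose_spec h1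
      obtain ⟨x, hx, u, v, hu, hv, he⟩ := H q0 hq0
      have hli := li_of_det ι x (by
        intro h0
        rw [h0, zero_mul, eq_comm, mul_eq_zero] at he
        rcases he with h | h
        · exact hγ h
        · rw [map_eq_zero_iff _ (IsFractionRing.injective S _)] at h
          exact hu (h ▸ q0.zero_mem))
      have h2 := (hli.map' (LinearMap.ker f).subtype (by simp)).fintype_card_le_finrank
      simp only [Fintype.card_fin, Module.finrank_fintype_fun_eq_card] at h2
      exact Nat.exists_eq_add_of_le h2
    obtain ⟨ι, γ, hγ, H⟩ := Classical.choose_spec h1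
    generalize Classical.choose h1 = m at ι H hm
    obtain ⟨r, rfl⟩ := hm
    let e : ((Fin m ⊕ Fin r) → S) ≃ₗ[S] (Fin (m + r) → S) := LinearEquiv.funCongrLeft S S finSumFinEquiv.symm
    let e' : LinearMap.ker f ≃ₗ[S] LinearMap.ker (f ∘ₗ e.toLinearMap) :=
      (LinearEquiv.ofSubmodule' e (LinearMap.ker f)).symm.trans (LinearEquiv.ofEq _ _ (by rw [LinearMap.ker_comp]))
    refine good_core (f ∘ₗ e.toLinearMap) (hf.comp e.surjective) hX (ι ∘ₗ e'.symm.toLinearMap) γ hγ (fun q hq => ?_) q0 hq0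
    obtain ⟨x, hx, u, v, hu, hv, h⟩ := H q hq
    refine ⟨e' ∘ x, fun y => ?_, u, v, hu, hv, by simpa using h⟩
    obtain ⟨s, hs, h2⟩ := hx (e'.symm y)
    refine ⟨s, hs, ?_⟩
    have := Submodule.mem_map_of_mem (f := e'.toLinearMap) h2
    rw [Submodule.map_span] at this
    simpa [Set.range_comp] using this
end UFD2

end Part15

section Part16
open CategoryTheory

section UFD3
variable {S : Type u} [CommRing S] [IsNoetherianRing S]

lemma ass_iff {X : Type u} [AddCommGroup X] [Module S X] (p : Ideal S) :
    IsAssociatedPrime p X ↔ p.IsPrime ∧ ∃ x : X, ∀ a, a ∈ p ↔ a • x = 0 := by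
  rw [isAssociatedPrime_iff]
  constructor
  · rintro ⟨h, x, rfl⟩
    exact ⟨h, x, fun a => by rw [Submodule.mem_colon_singleton, Submodule.mem_bot]⟩
  · rintro ⟨h, x, hx⟩
    refine ⟨h, x, ?_⟩
    ext a
    rw [Submodule.mem_colon_singleton, Submodule.mem_bot, hx]

lemma ass_above {X : Type u} [AddCommGroup X] [Module S X] (x : X) (hx : x ≠ 0) :
    ∃ p : Ideal S, IsAssociatedPrime p X ∧ ∀ a : S, a • x = 0 → a ∈ p := by
  obtain ⟨p, hp, h⟩ := exists_le_isAssociatedPrime_of_isNoetherianRing S x hx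
  exact ⟨p, hp, fun a ha => h (by rwa [Submodule.mem_colon_singleton, Submodule.mem_bot])⟩

lemma DD_of_ass [IsDomain S] {b : S} (hb : b ≠ 0) {p : Ideal S} (hp : IsAssociatedPrime p (S ⧸ Ideal.span {b})) : DD p := by
  obtain ⟨h, x, hx⟩ := (ass_iff _).1 hp
  obtain ⟨c, rfl⟩ := Ideal.Quotient.mk_surjective x
  refine ⟨h, b, c, hb, fun a => ?_⟩
  rw [hx, Algebra.smul_def, Ideal.Quotient.algebraMap_eq, ← map_mul, Ideal.Quotient.eq_zero_iff_mem, Ideal.mem_span_singleton]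

lemma exists_DD [IsDomain S] {a b : S} (hb : b ≠ 0) (h : ¬ b ∣ a) : ∃ p : Ideal S, DD p ∧ ∀ s, b ∣ s * a → s ∈ p := by
  obtain ⟨p, hp, h2⟩ := ass_above (S := S) (X := S ⧸ Ideal.span {b}) (Ideal.Quotient.mk _ a)
    (fun h0 => h (by rwa [Ideal.Quotient.eq_zero_iff_mem, Ideal.mem_span_singleton] at h0))
  refine ⟨p, DD_of_ass hb hp, fun s hs => h2 s ?_⟩
  rw [Algebra.smul_def, Ideal.Quotient.algebraMap_eq, ← map_mul, Ideal.Quotient.eq_zero_iff_mem, Ideal.mem_span_singleton]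
  exact hs

lemma mem_of_DD [IsDomain S] (z : FractionRing S) (h : ∀ q : Ideal S, DD q → ∃ s, s ∉ q ∧ ∃ t, algebraMap S (FractionRing S) s * z = algebraMap S _ t) :
    ∃ t, z = algebraMap S _ t := by
  obtain ⟨a, b, hb, rfl⟩ := IsFractionRing.div_surjective (A := S) z
  have hb0 : b ≠ 0 := nonZeroDivisors.ne_zero hb
  have hb1 : algebraMap S (FractionRing S) b ≠ 0 := IsFractionRing.to_map_ne_zero_of_mem_nonZeroDivisors hb
  by_cases hd : b ∣ a
  · obtain ⟨t, rfl⟩ := hd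
    exact ⟨t, by rw [map_mul]; field_simp⟩
  · obtain ⟨p, hp, h2⟩ := exists_DD hb0 hd
    obtain ⟨s, hs, t, ht⟩ := h p hp
    refine absurd (h2 s ⟨t, ?_⟩) hs
    apply IsFractionRing.injective S (FractionRing S)
    rw [map_mul, map_mul, ← ht]
    field_simp

lemma DD_of_minimal [IsDomain S] {a : S} (ha : a ≠ 0) {p : Ideal S} (hp : p ∈ (Ideal.span {a}).minimalPrimes) : DD p := by
  apply DD_of_ass ha
  apply Module.associatedPrimes.minimalPrimes_annihilator_subset_associatedPrimes
  rwa [Ideal.annihilator_quotient]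

lemma principal_of_good [IsDomain S] {P : Ideal S} (hP : DD P) (hP0 : P ≠ ⊥) (hg : GoodM S P) : ∃ θ, P = Ideal.span {θ} := by
  obtain ⟨r, ι, γ, hγ, H⟩ := hg
  have inj := IsFractionRing.injective S (FractionRing S)
  have nz : ∀ {q : Ideal S} {u : S}, u ∉ q → algebraMap S (FractionRing S) u ≠ 0 := by
    intro q u hu h0
    rw [← map_zero (algebraMap S (FractionRing S))] at h0
    exact hu (inj h0 ▸ q.zero_mem)
  obtain ⟨p0, hp0, hp0'⟩ := Submodule.exists_mem_ne_zero_of_ne_bot hP0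
  have hr : r = 1 := by
    obtain ⟨x, hx, u, v, hu, hv, h⟩ := H P hP
    have hli := li_of_det ι x (fun h0 => by
      rw [h0, zero_mul] at h
      exact mul_ne_zero hγ (nz hu) h.symm)
    have hli2 : LinearIndependent S (P.subtype ∘ x) := hli.map' _ (by simp)
    have := hli2.fintype_card_le_finrank
    simp at this
    rcases Nat.lt_or_ge r 1 with h1 | h1
    · have : r = 0 := by omega
      subst this
      obtain ⟨s, hs, hs2⟩ := hx ⟨p0, hp0⟩
      rw [Set.range_eq_empty, Submodule.span_empty, Submodule.mem_bot] at hs2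
      have : s * p0 = 0 := congrArg Subtype.val hs2
      rcases mul_eq_zero.1 this with h | h
      · exact absurd (h ▸ P.zero_mem) hs
      · exact absurd h hp0'
    · omega
  subst hr
  let A := algebraMap S (FractionRing S)
  have hp0A : A p0 ≠ 0 := fun h0 => hp0' (inj (by rw [map_zero]; exact h0))
  let δ := ι ⟨p0, hp0⟩ 0 / A p0
  have hδ : ∀ p : P, ι p 0 = δ * A p := by
    intro p
    have h1 : p0 • p = (p : S) • (⟨p0, hp0⟩ : P) := Subtype.ext (mul_comm _ _)
    have h2 := congrFun (congrArg ι h1) 0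
    simp only [map_smul, Pi.smul_apply, Algebra.smul_def] at h2
    change A p0 * _ = A p * _ at h2
    simp only [δ]
    field_simp
    linear_combination h2
  have H2 : ∀ q : Ideal S, DD q → ∃ x : P, (∀ y : P, ∃ s, s ∉ q ∧ ∃ t, s * (y : S) = t * x) ∧ ∃ u v : S, u ∉ q ∧ v ∉ q ∧ δ * A x * A v = γ * A u := by
    intro q hq
    obtain ⟨x, hx, u, v, hu, hv, h⟩ := H q hq
    refine ⟨x 0, fun y => ?_, u, v, hu, hv, ?_⟩
    · obtain ⟨s, hs, h2⟩ := hx y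
      rw [Submodule.mem_span_range_iff_exists_fun] at h2
      obtain ⟨c, hc⟩ := h2
      refine ⟨s, hs, c 0, ?_⟩
      have := congrArg Subtype.val hc
      simpa using this.symm
    · rw [← hδ]
      simpa [Matrix.det_fin_one] using h
  have hδ0 : δ ≠ 0 := by
    intro h0
    obtain ⟨x, hx, u, v, hu, hv, h⟩ := H2 P hP
    rw [h0, zero_mul, zero_mul] at h
    exact mul_ne_zero hγ (nz hu) h.symm
  obtain ⟨θ, hθ⟩ := mem_of_DD (γ / δ) (by
    intro q hq
    obtain ⟨x, hx, u, v, hu, hv, h⟩ := H2 q hq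
    refine ⟨u, hu, x * v, ?_⟩
    change A u * _ = A _
    rw [map_mul]
    field_simp
    linear_combination -h)
  have hθ0 : A θ ≠ 0 := by
    intro h0
    change _ = A θ at hθ
    rw [h0] at hθ
    exact div_ne_zero hγ hδ0 hθ
  have hγ2 : γ = δ * A θ := by
    change _ = A θ at hθ
    rw [← hθ]; field_simp
  have H3 : ∀ q : Ideal S, DD q → ∃ x : P, (∀ y : P, ∃ s, s ∉ q ∧ ∃ t, s * (y : S) = t * x) ∧ ∃ u v : S, u ∉ q ∧ v ∉ q ∧ x * v = θ * u := by
    intro q hq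
    obtain ⟨x, hx, u, v, hu, hv, h⟩ := H2 q hq
    refine ⟨x, hx, u, v, hu, hv, inj ?_⟩
    rw [map_mul, map_mul]
    rw [hγ2] at h
    apply mul_left_cancel₀ hδ0
    linear_combination h
  refine ⟨θ, le_antisymm ?_ ?_⟩
  · intro p hp
    rw [Ideal.mem_span_singleton]
    obtain ⟨t, ht⟩ := mem_of_DD (A p / A θ) (by
      intro q hq
      obtain ⟨x, hx, u, v, hu, hv, h⟩ := H3 q hq
      obtain ⟨s, hs, t, hst⟩ := hx ⟨p, hp⟩
      refine ⟨s * v, fun hh => (hq.1.mem_or_mem hh).elim hs hv, t * u, ?_⟩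
      have h1 : s * v * p = t * u * θ := by
        simp only at hst
        linear_combination v * hst + t * h
      have h2 := congrArg A h1
      change A _ * _ = A _
      rw [map_mul] at h2
      rw [map_mul A _ θ] at h2
      field_simp
      linear_combination h2)
    refine ⟨t, inj ?_⟩
    change _ = A t at ht
    change A p = A _
    rw [map_mul, ← ht]; field_simp
  · rw [Ideal.span_singleton_le_iff_mem]
    obtain ⟨x, hx, u, v, hu, hv, h⟩ := H3 P hP
    have : θ * u ∈ P := h ▸ P.mul_mem_right v x.2
    exact (hP.1.mem_or_mem this).resolve_right hu

lemma reg_ufd (d : ℕ) [IsLocalRing S] [IsDomain S] (h : Reg d S) : UniqueFactorizationMonoid S := by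
  rw [UniqueFactorizationMonoid.iff_exists_prime_mem_of_isPrime]
  intro Q hQ0 hQ
  obtain ⟨a, haQ, ha⟩ := Submodule.exists_mem_ne_zero_of_ne_bot hQ0
  obtain ⟨P, hP, hPQ⟩ := Ideal.exists_minimalPrimes_le (I := Ideal.span {a}) (J := Q) ((Ideal.span_singleton_le_iff_mem _).2 haQ)
  have hD := DD_of_minimal ha hP
  have haP : a ∈ P := hP.1.2 (Ideal.mem_span_singleton_self a)
  have hP0 : P ≠ ⊥ := by
    rintro rfl
    exact ha (by simpa using haP)
  obtain ⟨θ, hθ⟩ := principal_of_good hD hP0 (good_of_PD d P (by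
    intro s y hs h
    have : s * (y : S) = 0 := congrArg Subtype.val h
    exact Subtype.ext ((mul_eq_zero.1 this).resolve_left hs)) (reg_PD d S h P))
  refine ⟨θ, hPQ (hθ ▸ Ideal.mem_span_singleton_self θ), ?_⟩
  rw [← Ideal.span_singleton_prime, ← hθ]
  · exact hD.1
  · rintro rfl
    exact hP0 (by simpa using hθ)

end UFD3

end Part16

section Part17
open CategoryTheory IsLocalRing

section WRsec
variable {S : Type u} [CommRing S]

def WR : Ideal S → List S → Prop
  | _, [] => True
  | K, x :: l => (∀ y, x * y ∈ K → y ∈ K) ∧ WR (K ⊔ Ideal.span {x}) l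

lemma mem_sup_span {K : Ideal S} {x z : S} : z ∈ K ⊔ Ideal.span {x} ↔ ∃ k ∈ K, ∃ w, z = k + x * w := by
  rw [Submodule.mem_sup]
  constructor
  · rintro ⟨k, hk, y, hy, rfl⟩
    obtain ⟨w, rfl⟩ := Ideal.mem_span_singleton'.1 hy
    exact ⟨k, hk, w, by ring⟩
  · rintro ⟨k, hk, w, rfl⟩
    exact ⟨k, hk, _, Ideal.mem_span_singleton'.2 ⟨w, rfl⟩, by ring⟩

lemma nak [IsNoetherianRing S] [IsLocalRing S] {K N : Ideal S} {x : S} (hx : x ∈ maximalIdeal S)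
    (h : ∀ z ∈ N, ∃ k ∈ K, ∃ w ∈ N, z = k + x * w) : N ≤ K := by
  have h2 : N ≤ K ⊔ Ideal.span {x} • N := by
    intro z hz
    obtain ⟨k, hk, w, hw, rfl⟩ := h z hz
    exact Submodule.add_mem_sup hk (Submodule.smul_mem_smul (Ideal.mem_span_singleton_self x) hw)
  apply Submodule.le_of_le_smul_of_le_jacobson_bot (IsNoetherian.noetherian N) _ h2
  rw [Ideal.span_singleton_le_iff_mem]
  exact maximalIdeal_le_jacobson _ hx

lemma WR.swap [IsNoetherianRing S] [IsLocalRing S] {K : Ideal S} {x y : S} {l : List S} (hx : x ∈ maximalIdeal S)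
    (h : WR K (x :: y :: l)) : WR K (y :: x :: l) := by
  obtain ⟨h1, h2, h3⟩ := h
  have key : ∀ z, y * z ∈ K → z ∈ K := by
    let N : Ideal S :=
      { carrier := {z | y * z ∈ K}
        add_mem' := fun {a b} ha hb => by
          simp only [Set.mem_setOf_eq] at *
          rw [mul_add]; exact K.add_mem ha hb
        zero_mem' := by simp
        smul_mem' := fun c a ha => by
          simp only [Set.mem_setOf_eq, smul_eq_mul] at *
          rw [mul_left_comm]; exact K.mul_mem_left c ha }
    refine nak (N := N) hx ?_
    intro z hz
    have hz : y * z ∈ K := hz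
    obtain ⟨k, hk, w, rfl⟩ := mem_sup_span.1 (h2 z (Ideal.mem_sup_left hz))
    refine ⟨k, hk, w, h1 _ ?_, rfl⟩
    have : x * (y * w) = y * (k + x * w) - y * k := by ring
    rw [this]
    exact K.sub_mem hz (K.mul_mem_left _ hk)
  refine ⟨key, fun z hz => ?_, by rwa [sup_right_comm]⟩
  obtain ⟨k, hk, w, hw⟩ := mem_sup_span.1 hz
  obtain ⟨k', hk', w', rfl⟩ := mem_sup_span.1 (h2 w (mem_sup_span.2 ⟨-k, K.neg_mem hk, z, by rw [hw]; ring⟩))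
  have : x * (z - y * w') ∈ K := by
    have : x * (z - y * w') = k + y * k' := by rw [mul_sub, hw]; ring
    rw [this]
    exact K.add_mem hk (K.mul_mem_left _ hk')
  exact mem_sup_span.2 ⟨_, h1 _ this, w', by ring⟩

lemma WR.perm [IsNoetherianRing S] [IsLocalRing S] {l l' : List S} (hp : l.Perm l') : ∀ {K : Ideal S}
    (hl : ∀ x ∈ l, x ∈ maximalIdeal S), WR K l → WR K l' := by
  induction hp with
  | nil => intro K _ h; exact h
  | cons x p ih =>
    intro K hl h
    exact ⟨h.1, ih (fun y hy => hl y (List.mem_cons_of_mem _ hy)) h.2⟩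
  | swap x y l =>
    intro K hl h
    exact h.swap (hl y (by simp))
  | trans p1 p2 ih1 ih2 =>
    intro K hl h
    exact ih2 (fun x hx => hl x (p1.mem_iff.2 hx)) (ih1 hl h)

lemma WR.append {l l' : List S} : ∀ {K : Ideal S}, WR K (l ++ l') ↔ WR K l ∧ WR (K ⊔ Ideal.ofList l) l' := by
  induction l with
  | nil => intro K; simp [WR]
  | cons x l ih =>
    intro K
    rw [List.cons_append, WR, WR, ih, and_assoc, Ideal.ofList_cons, sup_assoc]

lemma WR.quot {J : Ideal S} (l : List S) : ∀ {K : Ideal S} (hJK : J ≤ K), WR K l → WR (K.map (Ideal.Quotient.mk J)) (l.map (Ideal.Quotient.mk J)) := by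
  induction l with
  | nil => intro K _ _; trivial
  | cons x l ih =>
    intro K hJK h
    have hmem : ∀ y, Ideal.Quotient.mk J y ∈ K.map (Ideal.Quotient.mk J) ↔ y ∈ K := by
      intro y
      rw [← Ideal.mem_comap, Ideal.comap_map_of_surjective _ Ideal.Quotient.mk_surjective, ← RingHom.ker_eq_comap_bot, Ideal.mk_ker, sup_eq_left.2 hJK]
    refine ⟨fun y hy => ?_, ?_⟩
    · obtain ⟨y, rfl⟩ := Ideal.Quotient.mk_surjective y
      rw [← map_mul] at hy
      rw [hmem] at hy ⊢
      exact h.1 y hy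
    · have := ih (le_sup_of_le_left hJK) h.2
      rwa [Ideal.map_sup, Ideal.map_span, Set.image_singleton] at this

lemma dim_quot_step [IsNoetherianRing S] {K : Ideal S} {x : S} (hx : ∀ y, x * y ∈ K → y ∈ K) :
    ringKrullDim (S ⧸ (K ⊔ Ideal.span {x})) + 1 ≤ ringKrullDim (S ⧸ K) := by
  have h1 : Ideal.Quotient.mk K x ∈ nonZeroDivisors (S ⧸ K) := by
    rw [mem_nonZeroDivisors_iff_right]
    intro z hz
    obtain ⟨z, rfl⟩ := Ideal.Quotient.mk_surjective z
    rw [← map_mul, Ideal.Quotient.eq_zero_iff_mem] at hz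
    rw [Ideal.Quotient.eq_zero_iff_mem]
    exact hx z (by rwa [mul_comm])
  have h2 := ringKrullDim_quotient_succ_le_of_nonZeroDivisor h1
  have e := DoubleQuot.quotQuotEquivQuotSup K (Ideal.span {x})
  rw [Ideal.map_span, Set.image_singleton] at e
  rwa [ringKrullDim_eq_of_ringEquiv e] at h2

lemma WR.dim [IsNoetherianRing S] {l : List S} : ∀ {K : Ideal S}, WR K l →
    ringKrullDim (S ⧸ (K ⊔ Ideal.ofList l)) + (l.length : ℕ) ≤ ringKrullDim (S ⧸ K) := by
  induction l with
  | nil => intro K _; rw [Ideal.ofList_nil, sup_bot_eq]; simp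
  | cons x l ih =>
    intro K h
    have h1 := ih h.2
    have h2 := dim_quot_step h.1
    rw [Ideal.ofList_cons, ← sup_assoc, List.length_cons]
    push_cast
    rw [← add_assoc]
    exact le_trans (by gcongr) h2

end WRsec

end Part17

section Part18
open CategoryTheory IsLocalRing

section Depth
variable {S : Type u} [CommRing S]

noncomputable abbrev mulq (K : Ideal S) (x : S) : (S ⧸ K) →ₗ[S] (S ⧸ K) := x • LinearMap.id

noncomputable def facq (K : Ideal S) (x : S) : (S ⧸ K) →ₗ[S] (S ⧸ (K ⊔ Ideal.span {x})) := Submodule.factor le_sup_left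

lemma facq_mk (K : Ideal S) (x s : S) : facq K x (Submodule.Quotient.mk s) = Submodule.Quotient.mk s := rfl

lemma facq_surj (K : Ideal S) (x : S) : Function.Surjective (facq K x) := by
  intro y
  obtain ⟨s, rfl⟩ := Submodule.Quotient.mk_surjective _ y
  exact ⟨Submodule.Quotient.mk s, rfl⟩

lemma mulq_inj {K : Ideal S} {x : S} (h : ∀ y, x * y ∈ K → y ∈ K) : Function.Injective (mulq K x) := by
  rw [injective_iff_map_eq_zero]
  intro y hy
  obtain ⟨s, rfl⟩ := Submodule.Quotient.mk_surjective _ y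
  rw [Submodule.Quotient.mk_eq_zero]
  apply h
  rw [← smul_eq_mul, ← Submodule.Quotient.mk_eq_zero K]
  exact hy

lemma mulq_exact (K : Ideal S) (x : S) : Function.Exact (mulq K x) (facq K x) := by
  intro y
  obtain ⟨s, rfl⟩ := Submodule.Quotient.mk_surjective _ y
  rw [facq_mk, Submodule.Quotient.mk_eq_zero, mem_sup_span]
  constructor
  · rintro ⟨k, hk, w, rfl⟩
    refine ⟨Submodule.Quotient.mk w, ?_⟩
    change x • (Submodule.Quotient.mk w : S ⧸ K) = _
    rw [← Submodule.Quotient.mk_smul, eq_comm, Submodule.Quotient.eq]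
    simpa using hk
  · rintro ⟨z, hz⟩
    obtain ⟨w, rfl⟩ := Submodule.Quotient.mk_surjective _ z
    change x • (Submodule.Quotient.mk w : S ⧸ K) = _ at hz
    rw [← Submodule.Quotient.mk_smul, eq_comm, Submodule.Quotient.eq] at hz
    exact ⟨_, hz, w, by simp⟩

def Dp (n : ℕ) [IsLocalRing S] (K : Ideal S) : Prop := ∀ i < n, Subsingleton (EX S (S ⧸ maximalIdeal S) (S ⧸ K) i)

variable [IsLocalRing S]

lemma Dp.quot {n : ℕ} {K : Ideal S} (h : Dp n K) {x : S} (hx : ∀ y, x * y ∈ K → y ∈ K) : Dp (n-1) (K ⊔ Ideal.span {x}) := by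
  intro i hi
  exact sub_mid _ _ (EX.exact_right (mulq_inj hx) (mulq_exact K x) (facq_surj K x) i) (h i (by omega)) (h (i+1) (by omega))

lemma Dp.lift {n : ℕ} {K : Ideal S} {x : S} (hxm : x ∈ maximalIdeal S) (hx : ∀ y, x * y ∈ K → y ∈ K) (h : Dp n (K ⊔ Ideal.span {x})) : Dp (n+1) K := by
  intro i hi
  rw [subsingleton_iff_forall_eq 0]
  intro e
  have h0 : EX.post (S ⧸ maximalIdeal S) (mulq K x) i e = 0 := by
    rw [EX.post_smul_id]
    exact EX.smul_eq_zero_left x (quot_kill x hxm) i e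
  rcases i with _ | i
  · exact EX.post_zero_inj (mulq_inj hx) (by rw [h0, map_zero])
  · obtain ⟨y, rfl⟩ := (EX.exact_left (mulq_inj hx) (mulq_exact K x) (facq_surj K x) i e).1 h0
    have := h i (by omega)
    rw [Subsingleton.elim y 0, map_zero]

lemma RChain.reg {d : ℕ} {J : ℕ → Ideal S} {x : ℕ → S} (h : RChain d J x) (i : ℕ) (hi : i < d) : ∀ y, x i * y ∈ J i → y ∈ J i :=
  fun y hy => ((h.prime i hi.le).mem_or_mem hy).resolve_left (h.notMem i hi)

lemma RChain.mem {d : ℕ} {J : ℕ → Ideal S} {x : ℕ → S} (h : RChain d J x) (i : ℕ) (hi : i < d) : x i ∈ maximalIdeal S := by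
  have := h.prime (i+1) hi
  apply IsLocalRing.le_maximalIdeal this.ne_top
  rw [h.succ]
  exact Ideal.mem_sup_right (Ideal.mem_span_singleton_self _)

lemma RChain.Dp {d : ℕ} {J : ℕ → Ideal S} {x : ℕ → S} (h : RChain d J x) (j : ℕ) : ∀ i, i + j = d → Dp j (J i) := by
  induction j with
  | zero => intro i _ k hk; omega
  | succ j ih =>
    intro i hi
    have := ih (i+1) (by omega)
    rw [h.succ] at this
    exact this.lift (h.mem i (by omega)) (h.reg i (by omega))

/-- vanishing above. -/
lemma RChain.van {d : ℕ} {J : ℕ → Ideal S} {x : ℕ → S} (h : RChain d J x) (D : Type u) [AddCommGroup D] [Module S D] (i : ℕ) :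
    i ≤ d → ∀ j, i < j → Subsingleton (EX S (S ⧸ J i) D j) := by
  induction i with
  | zero =>
    intro _ j hj
    obtain ⟨j, rfl⟩ := Nat.exists_eq_succ_of_ne_zero hj.ne'
    have h0 := h.zero
    have : Module.Projective S (S ⧸ J 0) := Module.Projective.of_equiv ((Submodule.quotEquivOfEqBot _ h0).symm)
    exact EX.subsingleton_projective _ D j
  | succ i ih =>
    intro hi j hj
    obtain ⟨j, rfl⟩ := Nat.exists_eq_succ_of_ne_zero (show j ≠ 0 by omega)
    rw [h.succ]
    exact sub_mid _ _ (EX.exact_left' (mulq_inj (h.reg i hi)) (mulq_exact (J i) (x i)) (facq_surj (J i) (x i)) j)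
      (ih (by omega) j (by omega)) (ih (by omega) (j+1) (by omega))

lemma RChain.top {d : ℕ} {J : ℕ → Ideal S} {x : ℕ → S} (h : RChain d J x) (D : Type u) [AddCommGroup D] [Module S D] (i : ℕ) :
    i ≤ d → ∃ ψ : D →ₗ[S] EX S (S ⧸ J i) D i, Function.Surjective ψ ∧ LinearMap.ker ψ = J i • ⊤ := by
  induction i with
  | zero =>
    intro _
    have h0 := h.zero
    let e : D ≃ₗ[S] EX S (S ⧸ J 0) D 0 := (LinearMap.ringLmapEquivSelf S S D).symm.trans
      (((Submodule.quotEquivOfEqBot _ h0).congrLeft D S).symm.trans EX.zeroEquiv.symm)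
    refine ⟨e.toLinearMap, e.surjective, ?_⟩
    have h1 : J 0 • (⊤ : Submodule S D) = ⊥ := by rw [h0, Submodule.bot_smul]
    rw [h1]
    exact LinearMap.ker_eq_bot.2 e.injective
  | succ i ih =>
    intro hi
    obtain ⟨ψ, hψ, hk⟩ := ih (by omega)
    have hs := h.succ i
    rw [hs]
    have hv := h.van D i (by omega) (i+1) (by omega)
    refine ⟨(EX.δ' D (mulq_inj (h.reg i hi)) (mulq_exact (J i) (x i)) (facq_surj (J i) (x i)) i) ∘ₗ ψ, ?_, ?_⟩
    · rw [LinearMap.coe_comp]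
      exact (EX.δ'_surj _ _ _ i hv).comp hψ
    · ext y
      rw [LinearMap.mem_ker, LinearMap.comp_apply, EX.exact_right' (mulq_inj (h.reg i hi)) (mulq_exact (J i) (x i)) (facq_surj (J i) (x i)) i (ψ y),
        Submodule.sup_smul, Submodule.mem_sup]
      constructor
      · rintro ⟨e, he⟩
        obtain ⟨z, rfl⟩ := hψ e
        rw [EX.pre_smul_id] at he
        have : y - x i • z ∈ J i • (⊤ : Submodule S D) := by
          rw [← hk, LinearMap.mem_ker, map_sub, map_smul, ← he]
          simp
        exact ⟨_, this, x i • z, Submodule.smul_mem_smul (Ideal.mem_span_singleton_self _) trivial, by simp⟩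
      · rintro ⟨y', hy', z', hz', rfl⟩
        rw [Submodule.ideal_span_singleton_smul, Submodule.mem_smul_pointwise_iff_exists] at hz'
        obtain ⟨z, -, rfl⟩ := hz'
        refine ⟨ψ z, ?_⟩
        rw [← hk, LinearMap.mem_ker] at hy'
        rw [EX.pre_smul_id, map_add, hy', map_smul]
        simp

lemma RChain.fin {d : ℕ} {J : ℕ → Ideal S} {x : ℕ → S} (h : RChain d J x) (D : Type u) [AddCommGroup D] [Module S D]
    (hf : Module.Finite S (EX S (S ⧸ maximalIdeal S) D d)) : Module.Finite S (D ⧸ (maximalIdeal S • ⊤ : Submodule S D)) := by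
  obtain ⟨ψ, hψ, hk⟩ := h.top D d le_rfl
  rw [← h.last] at hf ⊢
  rw [← hk]
  exact Module.Finite.equiv (ψ.quotKerEquivOfSurjective hψ).symm

/-- dimension of associated primes vs depth. -/
lemma Dp.ass [IsNoetherianRing S] (n : ℕ) : ∀ {K : Ideal S} (_ : Dp n K) (p : Ideal S) (_ : IsAssociatedPrime p (S ⧸ K)),
    (n : WithBot ℕ∞) ≤ ringKrullDim (S ⧸ p) := by
  induction n with
  | zero =>
    intro K h p hp
    have := hp.isPrime
    exact_mod_cast ringKrullDim_nonneg_of_nontrivial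
  | succ n ih =>
    intro K h p hp
    have hm : ∀ q ∈ associatedPrimes S (S ⧸ K), ¬ maximalIdeal S ≤ q := by
      intro q hq hle
      obtain ⟨hq1, t, ht⟩ := (ass_iff _).1 hq
      have h0 := h 0 (by omega)
      have h1 : Subsingleton ((S ⧸ maximalIdeal S) →ₗ[S] (S ⧸ K)) := EX.zeroEquiv.symm.toEquiv.subsingleton
      have h2 := LinearMap.congr_fun (Subsingleton.elim (cycHom (maximalIdeal S) t (fun a ha => (ht a).1 (hle ha))) 0) (Submodule.Quotient.mk 1)
      rw [cycHom_mk] at h2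
      have h3 : (1 : S) ∈ q := (ht 1).2 (by simpa using h2)
      exact hq1.ne_top (q.eq_top_iff_one.2 h3)
    obtain ⟨x, hxm, hx⟩ := avoid (maximalIdeal S) (associatedPrimes S (S ⧸ K)) (associatedPrimes.finite S (S ⧸ K))
      (fun q hq => hq.isPrime) hm
    have hreg : ∀ y, x * y ∈ K → y ∈ K := by
      intro y hy
      by_contra hyK
      obtain ⟨q, hq, hq2⟩ := ass_above (S := S) (X := S ⧸ K) (Submodule.Quotient.mk y) (by rwa [Ne, Submodule.Quotient.mk_eq_zero])
      refine hx q hq (hq2 x ?_)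
      rw [← Submodule.Quotient.mk_smul, Submodule.Quotient.mk_eq_zero]
      exact hy
    obtain ⟨hpp, t, ht⟩ := (ass_iff _).1 hp
    obtain ⟨t, rfl⟩ := Submodule.Quotient.mk_surjective _ t
    have ht' : ∀ a, a ∈ p ↔ a * t ∈ K := by
      intro a
      rw [ht, ← Submodule.Quotient.mk_smul, Submodule.Quotient.mk_eq_zero]; rfl
    let U : Ideal S :=
      { carrier := {z | ∀ a ∈ p, a * z ∈ K}
        add_mem' := fun {z w} hz hw a ha => by rw [mul_add]; exact K.add_mem (hz a ha) (hw a ha)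
        zero_mem' := fun a ha => by simp
        smul_mem' := fun c z hz a ha => by rw [smul_eq_mul, mul_left_comm]; exact K.mul_mem_left c (hz a ha) }
    have hU : ¬ U ≤ K ⊔ Ideal.span {x} := by
      intro hle
      have h1 : U ≤ K := by
        refine nak hxm ?_
        intro z hz
        obtain ⟨k, hk, w, rfl⟩ := mem_sup_span.1 (hle hz)
        refine ⟨k, hk, w, fun a ha => hreg _ ?_, rfl⟩
        have h2 := K.sub_mem (hz a ha) (K.mul_mem_left a hk)
        have : x * (a * w) = a * (k + x * w) - a * k := by ring
        rwa [this]
      have h3 : (1 : S) ∈ p := (ht' 1).2 (by rw [one_mul]; exact h1 (fun a ha => (ht' a).1 ha))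
      exact hpp.ne_top (p.eq_top_iff_one.2 h3)
    obtain ⟨z, hzU, hzK⟩ := Set.not_subset.1 hU
    obtain ⟨q, hq, hq2⟩ := ass_above (S := S) (X := S ⧸ (K ⊔ Ideal.span {x})) (Submodule.Quotient.mk z)
      (by rwa [Ne, Submodule.Quotient.mk_eq_zero])
    have hq3 : ∀ a, a * z ∈ K ⊔ Ideal.span {x} → a ∈ q := by
      intro a ha
      apply hq2
      rw [← Submodule.Quotient.mk_smul, Submodule.Quotient.mk_eq_zero]
      exact ha
    have hpq : p ⊔ Ideal.span {x} ≤ q := by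
      rw [sup_le_iff, Ideal.span_singleton_le_iff_mem]
      refine ⟨fun a ha => hq3 a (Ideal.mem_sup_left (hzU a ha)), hq3 x ?_⟩
      exact Ideal.mem_sup_right (Ideal.mul_mem_right _ _ (Ideal.mem_span_singleton_self x))
    have h1 := ih (h.quot hreg) q hq
    have h2 : ringKrullDim (S ⧸ q) ≤ ringKrullDim (S ⧸ (p ⊔ Ideal.span {x})) :=
      ringKrullDim_le_of_surjective (Ideal.Quotient.factor hpq) (Ideal.Quotient.factor_surjective hpq)
    have h3 := dim_quot_step (K := p) (x := x) (fun y hy => (hpp.mem_or_mem hy).resolve_left (hx p hp))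
    push_cast
    exact le_trans (by gcongr; exact h1.trans h2) h3

end Depth

end Part18

section Part19
open CategoryTheory IsLocalRing

section Cpart
variable {S : Type u} [CommRing S]

lemma WR.modify {K : Ideal S} {x x' : S} {l : List S} (hx : x' - x ∈ K) (h : WR K (x :: l)) : WR K (x' :: l) := by
  refine ⟨fun y hy => h.1 y ?_, ?_⟩
  · have : x * y = x' * y - (x' - x) * y := by ring
    rw [this]; exact K.sub_mem hy (K.mul_mem_right _ hx)
  · have : K ⊔ Ideal.span {x'} = K ⊔ Ideal.span {x} := by
      apply le_antisymm
      · refine sup_le le_sup_left ((Ideal.span_singleton_le_iff_mem _).2 (mem_sup_span.2 ⟨_, hx, 1, by ring⟩))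
      · refine sup_le le_sup_left ((Ideal.span_singleton_le_iff_mem _).2 (mem_sup_span.2 ⟨_, K.neg_mem hx, 1, by ring⟩))
    rw [this]; exact h.2

lemma WR.comap {B : Type u} [CommRing B] (φ : B →+* S) (hφ : Function.Surjective φ) (l : List B) : ∀ {K : Ideal S},
    WR K (l.map φ) → WR (K.comap φ) l := by
  induction l with
  | nil => intro K _; trivial
  | cons x l ih =>
    intro K h
    refine ⟨fun y hy => h.1 (φ y) (by rw [← map_mul]; exact hy), ?_⟩
    have : K.comap φ ⊔ Ideal.span {x} = (K ⊔ Ideal.span {φ x}).comap φ := by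
      ext z
      rw [Ideal.mem_comap, mem_sup_span, mem_sup_span]
      constructor
      · rintro ⟨k, hk, w, rfl⟩
        exact ⟨φ k, hk, φ w, by simp⟩
      · rintro ⟨k, hk, w, hw⟩
        obtain ⟨w, rfl⟩ := hφ w
        exact ⟨z - x * w, by simpa [hw] using hk, w, by ring⟩
    rw [this]
    exact ih h.2

lemma krull_closed [IsNoetherianRing S] [IsLocalRing S] (K : Ideal S) (z : S) (h : ∀ n : ℕ, z ∈ K ⊔ maximalIdeal S ^ n) : z ∈ K := by
  have hh : IsHausdorff (maximalIdeal S) (S ⧸ K) := IsHausdorff.of_isLocalRing _ _ (Ideal.IsPrime.ne_top inferInstance)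
  rw [← Submodule.Quotient.mk_eq_zero K]
  apply hh.haus
  intro n
  rw [SModEq.zero]
  obtain ⟨k, hk, y, hy, rfl⟩ := Submodule.mem_sup.1 (h n)
  have : (Submodule.Quotient.mk (k + y) : S ⧸ K) = y • Submodule.Quotient.mk 1 := by
    rw [← Submodule.Quotient.mk_smul, Submodule.Quotient.eq]
    simpa using hk
  rw [this]
  exact Submodule.smul_mem_smul hy trivial

lemma reg_vpow {K : Ideal S} {v a : S} (h : WR K [v, a]) (n : ℕ) : ∀ z, a * z ∈ K ⊔ Ideal.span {v^n} → z ∈ K ⊔ Ideal.span {v^n} := by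
  induction n with
  | zero => intro z _; simp
  | succ n ih =>
    intro z hz
    obtain ⟨k, hk, w, hw⟩ := mem_sup_span.1 hz
    obtain ⟨k', hk', z', rfl⟩ := mem_sup_span.1 (h.2.1 z (mem_sup_span.2 ⟨k, hk, v^n * w, by rw [hw]; ring⟩))
    have h1 : v * (a * z' - v^n * w) ∈ K := by
      have : v * (a * z' - v^n * w) = k - a * k' := by linear_combination hw
      rw [this]; exact K.sub_mem hk (K.mul_mem_left _ hk')
    obtain ⟨k2, hk2, z2, rfl⟩ := mem_sup_span.1 (ih z' (mem_sup_span.2 ⟨_, h.1 _ h1, w, by ring⟩))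
    exact mem_sup_span.2 ⟨k' + v * k2, K.add_mem hk' (K.mul_mem_left _ hk2), z2, by ring⟩

lemma slice [IsNoetherianRing S] [IsLocalRing S] {K : Ideal S} {v a : S} (hv : v ∈ maximalIdeal S) (h : WR K [v, a]) (t : ℕ → S)
    (ht : ∀ k, v * t (k+1) + a * t k ∈ K) (k : ℕ) : t k ∈ K := by
  apply krull_closed
  intro n
  have : ∀ k, t k ∈ K ⊔ Ideal.span {v^n} := by
    induction n with
    | zero => intro k; simp
    | succ n ih =>
      intro k
      apply reg_vpow h
      obtain ⟨k', hk', w, hw⟩ := mem_sup_span.1 (ih (k+1))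
      refine mem_sup_span.2 ⟨(v * t (k+1) + a * t k) - v * k', K.sub_mem (ht k) (K.mul_mem_left _ hk'), -w, ?_⟩
      rw [hw]; ring
  refine sup_le_sup_left ?_ K (this k)
  rw [Ideal.span_singleton_le_iff_mem]
  exact Ideal.pow_mem_pow hv n

lemma closing [IsNoetherianRing S] [IsLocalRing S] {K : Ideal S} {u v : S} (hu : u ∈ maximalIdeal S) (hv : v ∈ maximalIdeal S)
    (h : WR K [u, v]) (g : S) (hg : ∀ i : ℕ, g ∈ K ⊔ Ideal.span {u + v^(i+1)}) : g ∈ K := by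
  have hl : ∀ i : ℕ, u + v^(i+1) ∈ maximalIdeal S := fun i =>
    Ideal.add_mem _ hu (Ideal.pow_mem_of_mem _ hv _ (by omega))
  have hW : ∀ i : ℕ, WR K [u + v^(i+1), v] := by
    intro i
    have h1 : WR K [v, u] := h.perm (List.Perm.swap _ _ _) (by intro y hy; simp only [List.mem_cons, List.not_mem_nil, or_false] at hy; rcases hy with rfl | rfl; exacts [hu, hv])
    have h2 : WR K [v, u + v^(i+1)] := ⟨h1.1, WR.modify (mem_sup_span.2 ⟨0, K.zero_mem, v^i, by ring⟩) h1.2⟩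
    exact h2.perm (List.Perm.swap _ _ _) (by intro y hy; simp only [List.mem_cons, List.not_mem_nil, or_false] at hy; rcases hy with rfl | rfl; exacts [hv, hl i])
  have hreg : ∀ i j : ℕ, i < j → ∀ y, (u + v^(i+1)) * y ∈ K ⊔ Ideal.span {u + v^(j+1)} → y ∈ K ⊔ Ideal.span {u + v^(j+1)} := by
    intro i j hij y hy
    obtain ⟨s, rfl⟩ : ∃ s, j = i + s + 1 := ⟨j - i - 1, by omega⟩
    have h1 : v^(i+1) * ((1 - v^(s+1)) * y) ∈ K ⊔ Ideal.span {u + v^(i+s+1+1)} := by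
      have : v^(i+1) * ((1 - v^(s+1)) * y) = (u + v^(i+1)) * y - (u + v^(i+s+1+1)) * y := by ring
      rw [this]
      exact Ideal.sub_mem _ hy (Ideal.mem_sup_right (Ideal.mul_mem_right _ _ (Ideal.mem_span_singleton_self _)))
    have h2 : ∀ m : ℕ, ∀ z, v^m * z ∈ K ⊔ Ideal.span {u + v^(i+s+1+1)} → z ∈ K ⊔ Ideal.span {u + v^(i+s+1+1)} := by
      intro m
      induction m with
      | zero => intro z hz; simpa using hz
      | succ m ih =>
        intro z hz
        apply ih
        apply (hW _).2.1
        rwa [← mul_assoc, ← pow_succ']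
    have h3 := h2 _ _ h1
    have hunit : IsUnit (1 - v^(s+1)) := by
      by_contra hn
      have h4 : 1 - v^(s+1) ∈ maximalIdeal S := hn
      have h5 := Ideal.add_mem _ h4 (Ideal.pow_mem_of_mem _ hv (s+1) (by omega))
      rw [sub_add_cancel] at h5
      exact (Ideal.ne_top_iff_one _).1 (Ideal.IsPrime.ne_top inferInstance) h5
    obtain ⟨w, hw⟩ := hunit
    rw [← hw] at h3
    have := Ideal.mul_mem_left _ (↑w⁻¹ : S) h3
    rwa [← mul_assoc, Units.inv_mul, one_mul] at this
  apply krull_closed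
  intro n
  have : ∀ (j0 : ℕ) (g : S), (∀ i ≥ j0, g ∈ K ⊔ Ideal.span {u + v^(i+1)}) → g ∈ K ⊔ maximalIdeal S ^ n := by
    induction n with
    | zero => intro j0 g _; simp
    | succ n ih =>
      intro j0 g hg
      obtain ⟨k, hk, y, rfl⟩ := mem_sup_span.1 (hg j0 le_rfl)
      have h1 := ih (j0 + 1) y (fun i hi => by
        apply hreg j0 i (by omega)
        have := Ideal.sub_mem _ (hg i (by omega)) (Ideal.mem_sup_left hk)
        simpa using this)
      obtain ⟨k2, hk2, z, hz, rfl⟩ := Submodule.mem_sup.1 h1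
      rw [mul_add, ← add_assoc]
      refine Submodule.add_mem_sup (K.add_mem hk (K.mul_mem_left _ hk2)) ?_
      rw [pow_succ']
      exact Ideal.mul_mem_mul (hl _) hz
  exact this 0 g (fun i _ => hg i)

end Cpart

end Part19

section Part20
open CategoryTheory IsLocalRing

section Cprops
variable {S : Type u} [CommRing S] [IsNoetherianRing S] [IsLocalRing S]

open PowerSeries in
lemma coeff_mem_of_map {I : Ideal S} {f : PowerSeries S} (hf : f ∈ I.map (PowerSeries.C (R := S))) (n : ℕ) : coeff n f ∈ I := by
  have h : I.map (PowerSeries.C (R := S)) ≤ RingHom.ker (PowerSeries.map (Ideal.Quotient.mk I)) := by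
    rw [Ideal.map_le_iff_le_comap]
    intro x hx
    rw [Ideal.mem_comap, RingHom.mem_ker, PowerSeries.map_C, Ideal.Quotient.eq_zero_iff_mem.2 hx, map_zero]
  have := congrArg (coeff n) ((RingHom.mem_ker).1 (h hf))
  rw [PowerSeries.coeff_map, map_zero] at this
  exact Ideal.Quotient.eq_zero_iff_mem.1 this

lemma WR.mu {K : Ideal S} {a b u v : S} (ha : a ∈ maximalIdeal S) (hb : b ∈ maximalIdeal S) (hu : u ∈ maximalIdeal S)
    (hv : v ∈ maximalIdeal S) (h : WR K [a,b,u,v]) (μ : S) : WR (K ⊔ Ideal.span {b - μ * a} ⊔ Ideal.span {u + μ * v}) [v, a] := by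
  have hb' : b - μ * a ∈ maximalIdeal S := Ideal.sub_mem _ hb (Ideal.mul_mem_left _ _ ha)
  have hu' : u + μ * v ∈ maximalIdeal S := Ideal.add_mem _ hu (Ideal.mul_mem_left _ _ hv)
  have h1 : WR K [a, b - μ * a, u, v] :=
    ⟨h.1, WR.modify (mem_sup_span.2 ⟨0, K.zero_mem, -μ, by ring⟩) h.2⟩
  have h2 : WR K [v, b - μ * a, a, u] := by
    refine h1.perm ?_ ?_
    · rw [← Multiset.coe_eq_coe]
      classical
      ext x
      simp only [← Multiset.cons_coe, Multiset.count_cons, Multiset.coe_nil, Multiset.count_zero]; omega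
    · intro y hy
      simp only [List.mem_cons, List.not_mem_nil, or_false] at hy
      rcases hy with rfl | rfl | rfl | rfl <;> assumption
  have h3 : WR K [b - μ * a, v, u, a] := by
    refine h2.perm ?_ ?_
    · rw [← Multiset.coe_eq_coe]
      classical
      ext x
      simp only [← Multiset.cons_coe, Multiset.count_cons, Multiset.coe_nil, Multiset.count_zero]; omega
    · intro y hy
      simp only [List.mem_cons, List.not_mem_nil, or_false] at hy
      rcases hy with rfl | rfl | rfl | rfl <;> assumption
  have h4 : WR (K ⊔ Ideal.span {b - μ * a}) [v, u + μ * v, a] :=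
    ⟨h3.2.1, WR.modify (mem_sup_span.2 ⟨0, Ideal.zero_mem _, μ, by ring⟩) h3.2.2⟩
  have h5 : WR (K ⊔ Ideal.span {b - μ * a}) [u + μ * v, v, a] := by
    refine h4.perm (List.Perm.swap _ _ _) ?_
    intro y hy
    simp only [List.mem_cons, List.not_mem_nil, or_false] at hy
    rcases hy with rfl | rfl | rfl <;> assumption
  exact h5.2

lemma ofList_map {A B : Type*} [CommRing A] [CommRing B] (φ : A →+* B) (l : List A) : Ideal.ofList (l.map φ) = (Ideal.ofList l).map φ := by
  induction l with
  | nil => simp [Ideal.map_bot]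
  | cons x l ih => simp only [List.map_cons, Ideal.ofList_cons, ih, Ideal.map_sup, Ideal.map_span, Set.image_singleton]

open PowerSeries in
lemma Cprops (l : List S) (a b u v : S) (h : WR ⊥ (l ++ [a, b, u, v])) (hm : ∀ x ∈ l ++ [a, b, u, v], x ∈ maximalIdeal S) :
    ∃ (C : Type u) (_ : AddCommGroup C) (_ : Module S C) (c0 : C),
      (∀ c : C, a • c = 0 → c = 0) ∧ (∀ c c' : C, b • c = a • c' → ∃ c'', c = a • c'') ∧
      (∀ c : C, (∀ n : ℕ, c ∈ (maximalIdeal S ^ n • ⊤ : Submodule S C)) → c = 0) ∧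
      (a * u + b * v) • c0 = 0 ∧ (∀ j ∈ l, j • c0 = 0) ∧
      ∀ g : S, g • c0 = 0 → g ∈ Ideal.ofList l ⊔ Ideal.span {a} ⊔ Ideal.span {b} := by
  have hml : ∀ x ∈ l, x ∈ maximalIdeal S := fun x hx => hm x (by simp [hx])
  have ha : a ∈ maximalIdeal S := hm a (List.mem_append_right _ (by simp))
  have hb : b ∈ maximalIdeal S := hm b (List.mem_append_right _ (by simp))
  have hu : u ∈ maximalIdeal S := hm u (List.mem_append_right _ (by simp))
  have hv : v ∈ maximalIdeal S := hm v (List.mem_append_right _ (by simp))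
  have hloc : IsLocalRing (PowerSeries S) := inferInstanceAs (IsLocalRing (MvPowerSeries Unit S))
  have hmem : ∀ f : PowerSeries S, constantCoeff f ∈ maximalIdeal S → f ∈ maximalIdeal (PowerSeries S) := by
    intro f hf hun
    exact hf (hun.map _)
  let p : PowerSeries S := C u - C b * X
  let q : PowerSeries S := C v + C a * X
  let L : List (PowerSeries S) := l.map (C (R := S)) ++ [p, q, C a, C b]
  have hLmap : L.map (constantCoeff (R := S)) = l ++ [u, v, a, b] := by
    simp only [L, p, q, List.map_append, List.map_map, List.map_cons, List.map_nil, map_sub, map_add, map_mul, constantCoeff_C, constantCoeff_X, mul_zero, sub_zero, add_zero]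
    congr 1
    conv_rhs => rw [← List.map_id l]
    try (ext x; simp)
  have hX : (⊥ : Ideal (PowerSeries S)) ⊔ Ideal.span {X} = (⊥ : Ideal S).comap (constantCoeff (R := S)) := by
    ext f
    rw [bot_sup_eq, Ideal.mem_span_singleton, X_dvd_iff, Ideal.mem_comap, Ideal.mem_bot]
  have h1 : WR ⊥ (l ++ [u, v, a, b]) := by
    refine h.perm ?_ hm
    refine List.Perm.append_left _ ?_
    rw [← Multiset.coe_eq_coe]
    classical
    ext x
    simp only [← Multiset.cons_coe, Multiset.count_cons, Multiset.coe_nil, Multiset.count_zero]; omega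
  have h2 : WR ⊥ (X :: L) := by
    refine ⟨fun y hy => ?_, ?_⟩
    · rw [Ideal.mem_bot] at hy ⊢
      ext n
      have := congrArg (coeff (n+1)) hy
      rwa [coeff_succ_X_mul] at this
    · rw [hX]
      apply WR.comap _ constantCoeff_surj
      rw [hLmap]; exact h1
  have hLm : ∀ x ∈ X :: L, x ∈ maximalIdeal (PowerSeries S) := by
    intro x hx
    apply hmem
    rcases List.mem_cons.1 hx with rfl | hx
    · simp
    · have : constantCoeff x ∈ L.map (constantCoeff (R := S)) := List.mem_map_of_mem hx
      rw [hLmap] at this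
      apply hm
      simp only [List.mem_append, List.mem_cons, List.not_mem_nil, or_false] at this ⊢
      tauto
  have h3 : WR ⊥ ((l.map (C (R := S)) ++ [p, q]) ++ [C a, C b, X]) := by
    refine h2.perm ?_ hLm
    have : (l.map (C (R := S)) ++ [p, q]) ++ [C a, C b, X] = L ++ [X] := by simp [L]
    rw [this]
    exact (List.perm_append_singleton _ _).symm
  have h4 := (WR.append.1 h3).2
  rw [bot_sup_eq] at h4
  set Q : Ideal (PowerSeries S) := Ideal.ofList (l.map (C (R := S)) ++ [p, q]) with hQ
  have hsm : ∀ (s : S) (f : PowerSeries S), s • (Ideal.Quotient.mk Q f) = Ideal.Quotient.mk Q (C s * f) := by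
    intro s f
    rw [← PowerSeries.smul_eq_C_mul]; rfl
  have hmk : ∀ f, Ideal.Quotient.mk Q f = 0 ↔ f ∈ Q := fun f => Ideal.Quotient.eq_zero_iff_mem
  have hpQ : p ∈ Q := Ideal.subset_span (by simp)
  have hqQ : q ∈ Q := Ideal.subset_span (by simp)
  refine ⟨PowerSeries S ⧸ Q, inferInstance, inferInstance, Ideal.Quotient.mk Q 1, ?_, ?_, ?_, ?_, ?_, ?_⟩
  · intro c hc
    obtain ⟨c, rfl⟩ := Ideal.Quotient.mk_surjective c
    rw [hsm, hmk] at hc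
    rw [hmk]; exact h4.1 _ hc
  · intro c c' hc
    obtain ⟨c, rfl⟩ := Ideal.Quotient.mk_surjective c
    obtain ⟨c', rfl⟩ := Ideal.Quotient.mk_surjective c'
    rw [hsm, hsm, Ideal.Quotient.eq] at hc
    obtain ⟨k, hk, w, hw⟩ := mem_sup_span.1 (h4.2.1 c (mem_sup_span.2 ⟨_, hc, c', by ring⟩))
    refine ⟨Ideal.Quotient.mk Q w, ?_⟩
    rw [hsm, Ideal.Quotient.eq, hw]
    simpa using hk
  · intro c hc
    obtain ⟨c, rfl⟩ := Ideal.Quotient.mk_surjective c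
    rw [hmk]
    apply krull_closed
    intro n
    have hle : ∀ x ∈ (maximalIdeal S ^ n • ⊤ : Submodule S (PowerSeries S ⧸ Q)), x ∈ (maximalIdeal (PowerSeries S) ^ n).map (Ideal.Quotient.mk Q) := by
      intro x hx
      refine Submodule.smul_induction_on hx ?_ ?_
      · intro r hr y _
        obtain ⟨y, rfl⟩ := Ideal.Quotient.mk_surjective y
        rw [hsm]
        apply Ideal.mem_map_of_mem
        apply Ideal.mul_mem_right
        have : (maximalIdeal S).map (C (R := S)) ≤ maximalIdeal (PowerSeries S) := by
          rw [Ideal.map_le_iff_le_comap]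
          intro z hz
          exact hmem _ (by simpa using hz)
        refine Ideal.pow_right_mono this n ?_
        rw [← Ideal.map_pow]
        exact Ideal.mem_map_of_mem _ hr
      · intro x y hx hy; exact Ideal.add_mem _ hx hy
    have := hle _ (hc n)
    rw [Ideal.mem_map_iff_of_surjective _ Ideal.Quotient.mk_surjective] at this
    obtain ⟨z, hz, hzc⟩ := this
    rw [eq_comm, Ideal.Quotient.eq] at hzc
    have e : c = (c - z) + z := by ring
    rw [e]; exact Submodule.add_mem_sup hzc hz
  · rw [hsm, hmk]
    have : C (a * u + b * v) * 1 = C a * p + C b * q := by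
      simp only [p, q, map_add, map_mul]; ring
    rw [this]
    exact Ideal.add_mem _ (Ideal.mul_mem_left _ _ hpQ) (Ideal.mul_mem_left _ _ hqQ)
  · intro j hj
    rw [hsm, hmk, mul_one]
    refine Ideal.subset_span ?_
    have : C j ∈ l.map (C (R := S)) := List.mem_map_of_mem hj
    simp only [Set.mem_ofPred_eq, List.mem_append]
    exact Or.inl this
  · intro g hg
    rw [hsm, hmk, mul_one] at hg
    have hQ' : Q = (Ideal.ofList l).map (C (R := S)) ⊔ Ideal.span {p} ⊔ Ideal.span {q} := by
      rw [hQ, Ideal.ofList_append, ofList_map, Ideal.ofList_cons, Ideal.ofList_cons, Ideal.ofList_nil, sup_bot_eq, sup_assoc]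
    rw [hQ'] at hg
    obtain ⟨k, hk, f2, hf2⟩ := mem_sup_span.1 hg
    obtain ⟨j, hj, f1, rfl⟩ := mem_sup_span.1 hk
    have h0 : g = coeff 0 j + u * coeff 0 f1 + v * coeff 0 f2 := by
      have := congrArg (coeff 0) hf2
      simpa [p, q, sub_mul, add_mul, mul_assoc] using this
    have hs : ∀ k, 0 = coeff (k+1) j + (u * coeff (k+1) f1 - b * coeff k f1) + (v * coeff (k+1) f2 + a * coeff k f2) := by
      intro k
      have := congrArg (coeff (k+1)) hf2
      simpa [p, q, sub_mul, add_mul, mul_assoc, coeff_C, coeff_succ_X_mul] using this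
    have hcj : ∀ k, coeff k j ∈ Ideal.ofList l := coeff_mem_of_map hj
    have hW : WR (Ideal.ofList l) [a, b, u, v] := by
      have := (WR.append.1 h).2
      rwa [bot_sup_eq] at this
    have hμ : ∀ μ : S, g ∈ Ideal.ofList l ⊔ Ideal.span {b - μ * a} ⊔ Ideal.span {u + μ * v} := by
      intro μ
      have hB : b - μ * a ∈ Ideal.ofList l ⊔ Ideal.span {b - μ * a} ⊔ Ideal.span {u + μ * v} :=
        Ideal.mem_sup_left (Ideal.mem_sup_right (Ideal.mem_span_singleton_self _))
      have hU : u + μ * v ∈ Ideal.ofList l ⊔ Ideal.span {b - μ * a} ⊔ Ideal.span {u + μ * v} :=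
        (Ideal.mem_sup_right (Ideal.mem_span_singleton_self _))
      have hJ : ∀ k, coeff k j ∈ Ideal.ofList l ⊔ Ideal.span {b - μ * a} ⊔ Ideal.span {u + μ * v} := fun k =>
        Ideal.mem_sup_left (Ideal.mem_sup_left (hcj k))
      have := slice hv (WR.mu ha hb hu hv hW μ) (fun k => coeff k f2 - μ * coeff k f1) (fun k => by
        have e : v * (coeff (k+1) f2 - μ * coeff (k+1) f1) + a * (coeff k f2 - μ * coeff k f1) =
          - coeff (k+1) j - coeff (k+1) f1 * (u + μ * v) + coeff k f1 * (b - μ * a) := by linear_combination - hs k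
        rw [e]
        exact Ideal.add_mem _ (Ideal.sub_mem _ (neg_mem (hJ _)) (Ideal.mul_mem_left _ _ hU)) (Ideal.mul_mem_left _ _ hB)) 0
      have e : g = coeff 0 j + coeff 0 f1 * (u + μ * v) + v * (coeff 0 f2 - μ * coeff 0 f1) := by rw [h0]; ring
      rw [e]
      exact Ideal.add_mem _ (Ideal.add_mem _ (hJ _) (Ideal.mul_mem_left _ _ hU)) (Ideal.mul_mem_left _ _ this)
    apply closing hu hv hW.2.2
    intro i
    suffices hle : Ideal.ofList l ⊔ Ideal.span {b - v^i * a} ⊔ Ideal.span {u + v^i * v} ≤ Ideal.ofList l ⊔ Ideal.span {a} ⊔ Ideal.span {b} ⊔ Ideal.span {u + v^(i+1)} from hle (hμ (v^i))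
    refine sup_le (sup_le ?_ ?_) ?_
    · exact le_sup_left.trans (le_sup_left.trans le_sup_left)
    · refine le_trans ?_ le_sup_left
      rw [Ideal.span_singleton_le_iff_mem]
      exact Ideal.sub_mem _ (Ideal.mem_sup_right (Ideal.mem_span_singleton_self _)) (Ideal.mem_sup_left (Ideal.mem_sup_right (Ideal.mul_mem_left _ _ (Ideal.mem_span_singleton_self _))))
    · rw [pow_succ]; exact le_sup_right

end Cprops

end Part20

section Part21
open CategoryTheory IsLocalRing

section Dpart
variable {S : Type u} [CommRing S]

/-- saturation -/
def satD (I : Ideal S) {M E : Type u} [AddCommGroup M] [Module S M] [AddCommGroup E] [Module S E] (ι : M →ₗ[S] E) : Submodule S E :=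
  (gam I (E ⧸ LinearMap.range ι)).comap (LinearMap.range ι).mkQ

variable {I : Ideal S} {M E : Type u} [AddCommGroup M] [Module S M] [AddCommGroup E] [Module S E] {ι : M →ₗ[S] E}

lemma mem_satD {e : E} : e ∈ satD I ι ↔ ∃ k : ℕ, ∀ r ∈ I^k, r • e ∈ LinearMap.range ι := by
  unfold satD
  rw [Submodule.mem_comap, mem_gam]
  simp only [← map_smul]
  simp only [Submodule.mkQ_apply, Submodule.Quotient.mk_eq_zero]

lemma le_satD : LinearMap.range ι ≤ satD I ι := fun e he => mem_satD.2 ⟨0, fun r _ => Submodule.smul_mem _ _ he⟩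

lemma extFin_satD [IsNoetherianRing S] [Module.Finite S M] (hι : Function.Injective ι)
    (h0 : ∀ n, Subsingleton (EX S (S ⧸ I^n) E 0)) (h1 : ∀ n, Subsingleton (EX S (S ⧸ I^n) E 1))
    (hc : ExtFin (R := S) (S ⧸ I) (Hc I 1 M)) : ExtFin (R := S) (S ⧸ I) (satD I ι) := by
  have hfg : Function.Exact ι (LinearMap.range ι).mkQ := by rw [LinearMap.exact_iff]; exact Submodule.ker_mkQ _
  obtain ⟨e⟩ := lcShift (I := I) hι hfg (Submodule.mkQ_surjective _) 0 h0 h1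
  obtain ⟨e'⟩ := lcZero (I := I) (M := E ⧸ LinearMap.range ι)
  have hc' : ExtFin (R := S) (S ⧸ I) (gam I (E ⧸ LinearMap.range ι)) := ExtFin.congr (e.symm.trans e') hc
  let f : M →ₗ[S] satD I ι := ι.codRestrict _ (fun m => le_satD ⟨m, rfl⟩)
  let g : satD I ι →ₗ[S] gam I (E ⧸ LinearMap.range ι) := ((LinearMap.range ι).mkQ.restrict (p := satD I ι) (q := gam I _) (fun x hx => hx))
  refine ExtFin.mid (f := f) (g := g) ?_ ?_ ?_ ExtFin.of_finite hc'
  · intro x y hxy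
    exact hι (congrArg Subtype.val hxy)
  · intro x
    rw [Subtype.ext_iff]
    change (LinearMap.range ι).mkQ x = 0 ↔ _
    rw [Submodule.mkQ_apply, Submodule.Quotient.mk_eq_zero]
    constructor
    · rintro ⟨m, hm⟩; exact ⟨m, Subtype.ext hm⟩
    · rintro ⟨m, hm⟩; exact ⟨m, congrArg Subtype.val hm⟩
  · rintro ⟨y, hy⟩
    obtain ⟨x, rfl⟩ := Submodule.mkQ_surjective _ y
    exact ⟨⟨x, hy⟩, rfl⟩

/-- powers of a grade-2 pair -/
lemma grade_pow {C : Type u} [AddCommGroup C] [Module S C] {a b : S} (ha : ∀ c : C, a • c = 0 → c = 0)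
    (hb : ∀ c c' : C, b • c = a • c' → ∃ c'', c = a • c'') (k n : ℕ) : ∀ c c' : C, b^k • c = a^n • c' → ∃ c'', c = a^n • c'' := by
  have hb1 : ∀ c c' : C, b^k • c = a • c' → ∃ c'', c = a • c'' := by
    induction k with
    | zero => intro c c' h; exact ⟨c', by simpa using h⟩
    | succ k ih =>
      intro c c' h
      rw [pow_succ', mul_smul] at h
      obtain ⟨c1, h1⟩ := hb _ _ h
      exact ih _ _ h1
  induction n with
  | zero => intro c c' h; exact ⟨c, by simp⟩
  | succ n ih =>
    intro c c' h
    rw [pow_succ', mul_smul] at h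
    obtain ⟨c1, rfl⟩ := hb1 _ _ h
    rw [smul_comm, ← sub_eq_zero, ← smul_sub] at h
    obtain ⟨c2, rfl⟩ := ih _ _ (sub_eq_zero.1 (ha _ h))
    exact ⟨c2, by rw [pow_succ', mul_smul]⟩

lemma satD_embed [IsNoetherianRing S] {C : Type u} [AddCommGroup C] [Module S C] {a b : S} (haI : a ∈ I) (hbI : b ∈ I)
    (ha : ∀ c : C, a • c = 0 → c = 0)
    (hb : ∀ c c' : C, b • c = a • c' → ∃ c'', c = a • c'') (φ : M →ₗ[S] C) (hφ : Function.Injective φ)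
    (hι : Function.Injective ι) (hE : TorsFree I E) : ∃ ψ : satD I ι →ₗ[S] C, Function.Injective ψ := by
  have hC : TorsFree (Ideal.span {a}) C := fun c hc => ha c (hc a (Ideal.mem_span_singleton_self a))
  obtain ⟨E', j, hE', hj, htf⟩ := exists_injective_embedding_torsFree C hC
  obtain ⟨Φ, hΦ⟩ := hE'.out ι hι (j ∘ₗ φ)
  have hland : ∀ x : satD I ι, Φ x ∈ LinearMap.range j := by
    rintro ⟨x, hx⟩
    obtain ⟨k, hk⟩ := mem_satD.1 hx
    obtain ⟨m, hm⟩ := hk _ (Ideal.pow_mem_pow haI k)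
    obtain ⟨m', hm'⟩ := hk _ (Ideal.pow_mem_pow hbI k)
    have e1 : a^k • Φ x = j (φ m) := by rw [← map_smul, ← hm, hΦ]; rfl
    have e2 : b^k • Φ x = j (φ m') := by rw [← map_smul, ← hm', hΦ]; rfl
    have e3 : b^k • φ m = a^k • φ m' := by
      apply hj
      rw [map_smul, map_smul, ← e1, ← e2, smul_comm]
    obtain ⟨c, hc⟩ := grade_pow ha hb k k _ _ e3
    refine ⟨c, ?_⟩
    rw [eq_comm, ← sub_eq_zero]
    apply htf.pow k
    intro r hr
    rw [Ideal.span_singleton_pow] at hr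
    obtain ⟨s, rfl⟩ := Ideal.mem_span_singleton'.1 hr
    rw [mul_smul, smul_sub, e1, hc, map_smul, sub_self, smul_zero]
  let e := (LinearEquiv.ofInjective j hj).symm
  refine ⟨e.toLinearMap ∘ₗ (Φ ∘ₗ (satD I ι).subtype).codRestrict _ hland, ?_⟩
  refine e.injective.comp ?_
  rw [injective_iff_map_eq_zero]
  rintro ⟨x, hx⟩ h
  have h : Φ x = 0 := congrArg Subtype.val h
  obtain ⟨k, hk⟩ := mem_satD.1 hx
  apply Subtype.ext
  apply hE.pow k
  intro r hr
  obtain ⟨m, hm⟩ := hk r hr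
  have : j (φ m) = 0 := by
    have h2 := hΦ m
    rw [hm, map_smul, h, smul_zero] at h2
    exact h2.symm
  rw [← hm, hφ ((hj (this.trans (map_zero j).symm)).trans (map_zero φ).symm), map_zero]

lemma precomplete_pi (I : Ideal S) [IsPrecomplete I S] (n : ℕ) : IsPrecomplete I (Fin n → S) := by
  have hmem : ∀ (m : ℕ) (x : Fin n → S), x ∈ (I^m • ⊤ : Submodule S (Fin n → S)) ↔ ∀ i, x i ∈ I^m := by
    intro m x
    constructor
    · intro hx i
      refine Submodule.smul_induction_on hx ?_ ?_
      · intro r hr y _; exact Ideal.mul_mem_right _ _ hr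
      · intro x y hx hy; exact Ideal.add_mem _ hx hy
    · intro hx
      rw [pi_eq_sum_univ x]
      exact Submodule.sum_mem _ (fun i _ => Submodule.smul_mem_smul (hx i) trivial)
  refine ⟨fun f hf => ?_⟩
  have : ∀ i, ∃ L : S, ∀ m, f m i ≡ L [SMOD (I^m • ⊤ : Ideal S)] := by
    intro i
    refine IsPrecomplete.prec inferInstance (fun {m k} hmk => ?_)
    have := hf hmk
    rw [SModEq.sub_mem, hmem] at this
    rw [SModEq.sub_mem, smul_eq_mul, Ideal.mul_top]
    exact this i
  choose L hL using this
  refine ⟨L, fun m => ?_⟩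
  rw [SModEq.sub_mem, hmem]
  intro i
  have := hL i m
  rwa [SModEq.sub_mem, smul_eq_mul, Ideal.mul_top] at this

lemma finite_of_hausdorff (I : Ideal S) [IsPrecomplete I S] (D : Type u) [AddCommGroup D] [Module S D] [IsHausdorff I D]
    (h : Module.Finite S (D ⧸ (I • ⊤ : Submodule S D))) : Module.Finite S D := by
  obtain ⟨n, s, hs⟩ := Module.Finite.exists_fin (R := S) (M := D ⧸ (I • ⊤ : Submodule S D))
  choose t ht using fun i => Submodule.mkQ_surjective _ (s i)
  have := precomplete_pi I n
  let f : (Fin n → S) →ₗ[S] D := Fintype.linearCombination S t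
  have hf : Function.Surjective f := by
    apply surjective_of_mkQ_comp_surjective (I := I)
    rw [← LinearMap.range_eq_top, eq_top_iff, ← hs, Submodule.span_le]
    rintro _ ⟨i, rfl⟩
    refine ⟨Pi.single i 1, ?_⟩
    rw [LinearMap.comp_apply, Fintype.linearCombination_apply_single, one_smul, ht]
  exact Module.Finite.of_surjective f hf

end Dpart

end Part21

section Part22
open CategoryTheory IsLocalRing

section Core2
variable {S : Type u} [CommRing S] [IsNoetherianRing S]
variable {I : Ideal S} {M E : Type u} [AddCommGroup M] [Module S M] [AddCommGroup E] [Module S E] {ι : M →ₗ[S] E}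

lemma satD_closed (e : E) (h : ∀ i ∈ I, i • e ∈ satD I ι) : e ∈ satD I ι := by
  have h0 : (gam I (E ⧸ LinearMap.range ι)).mkQ ((LinearMap.range ι).mkQ e) = 0 := by
    apply torsFree_quot (I := I)
    intro r hr
    rw [← map_smul, ← map_smul, Submodule.mkQ_apply, Submodule.Quotient.mk_eq_zero]
    exact h r hr
  rwa [Submodule.mkQ_apply, Submodule.Quotient.mk_eq_zero] at h0

lemma satD_div [Module.Injective S E] (hE : TorsFree I E) (a : S) (ha : ∀ y ∈ satD I ι, a • y = 0 → y = 0) (x : E)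
    (hx : ∀ i ∈ I, ∃ y ∈ satD I ι, a • y = i • x) : ∃ y ∈ satD I ι, a • y = x := by
  have huniq : ∀ y ∈ satD I ι, ∀ y' ∈ satD I ι, a • y = a • y' → y = y' := by
    intro y hy y' hy' h
    rw [← sub_eq_zero]
    apply ha _ (Submodule.sub_mem _ hy hy')
    rw [smul_sub, h, sub_self]
  choose y hy hay using hx
  let φ : I →ₗ[S] E :=
    { toFun := fun i => y i.1 i.2
      map_add' := fun i j => by
        apply huniq _ (hy _ _) _ (Submodule.add_mem _ (hy _ _) (hy _ _))
        rw [smul_add, hay, hay, hay, Submodule.coe_add, add_smul]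
      map_smul' := fun r i => by
        apply huniq _ (hy _ _) _ (Submodule.smul_mem _ _ (hy _ _))
        rw [RingHom.id_apply, smul_comm, hay, hay, Submodule.coe_smul, smul_eq_mul, mul_smul] }
  obtain ⟨Φ, hΦ⟩ := (inferInstance : Module.Injective S E).out I.subtype Subtype.val_injective φ
  have key : ∀ i (hi : i ∈ I), i • Φ 1 = y i hi := by
    intro i hi
    rw [← map_smul, smul_eq_mul, mul_one]
    exact hΦ ⟨i, hi⟩
  refine ⟨Φ 1, satD_closed _ (fun i hi => by rw [key i hi]; exact hy _ _), ?_⟩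
  rw [← sub_eq_zero]
  apply hE
  intro i hi
  rw [smul_sub, smul_comm, key i hi, hay, sub_self]

omit [IsNoetherianRing S] in
lemma ann_quot_le {D : Type u} [AddCommGroup D] [Module S D] [Module.Finite S D] {p : Ideal S} [p.IsPrime] {a : S} (hap : a ∈ p)
    (hD : ∀ s : S, (∀ x : D, s • x = 0) → s ∈ p) (s : S) (hs : ∀ x : D, ∃ y : D, s • x = a • y) : s ∈ p := by
  have hr : LinearMap.range (algebraMap S (Module.End S D) s) ≤ Ideal.span {a} • ⊤ := by
    rintro _ ⟨x, rfl⟩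
    obtain ⟨y, hy⟩ := hs x
    rw [Module.algebraMap_end_apply, hy]
    exact Submodule.smul_mem_smul (Ideal.mem_span_singleton_self a) trivial
  obtain ⟨P, hP, -, hc, h0⟩ := LinearMap.exists_monic_and_natDegree_eq_and_coeff_mem_pow_and_aeval_eq_zero _ _ _ hr
  rw [Polynomial.aeval_algebraMap_apply] at h0
  have h1 : Polynomial.aeval s P ∈ p := by
    apply hD
    intro x
    have := LinearMap.congr_fun h0 x
    rwa [Module.algebraMap_end_apply] at this
  rw [Polynomial.aeval_def, Polynomial.eval₂_eq_sum_range, Finset.sum_range_succ] at h1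
  have h2 : ∑ x ∈ Finset.range P.natDegree, (algebraMap S S) (P.coeff x) * s ^ x ∈ p := by
    refine Ideal.sum_mem _ (fun k hk => Ideal.mul_mem_right _ _ ?_)
    have hk := Finset.mem_range.1 hk
    have h3 := Ideal.pow_le_self (I := Ideal.span {a}) (n := P.natDegree - k) (by omega) (hc k)
    exact (Ideal.span_singleton_le_iff_mem _).2 hap h3
  have h4 := (Ideal.add_mem_iff_right _ h2).1 h1
  rw [hP.coeff_natDegree, map_one, one_mul] at h4
  exact Ideal.IsPrime.mem_of_pow_mem inferInstance _ h4

lemma case2_core [IsLocalRing S] [IsAdicComplete (maximalIdeal S) S] {d : ℕ} {J : ℕ → Ideal S} {x : ℕ → S} (hch : RChain d J x)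
    (hI : I ≤ maximalIdeal S) (p : Ideal S) [p.IsPrime] (hIp : I ≤ p) (l : List S) (a b u v : S)
    (h : WR ⊥ (l ++ [a, b, u, v])) (hm : ∀ x ∈ l ++ [a, b, u, v], x ∈ maximalIdeal S) (hl : ∀ j ∈ l, j ∈ I) (ha : a ∈ I) (hb : b ∈ I)
    (hv : v ∉ p) (hmin : ∀ q : Ideal S, q.IsPrime → q ≤ p → (∀ j ∈ l, j ∈ q) → a ∈ q → b ∈ q → p ≤ q)
    (hcof : ∀ (M : Type u) [AddCommGroup M] [Module S M] [Module.Finite S M], ExtFin (R := S) (S ⧸ I) (Hc I 1 M)) : False := by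
  obtain ⟨C, _, _, c0, hCa, hCb, hsep, hf, hlc, hg⟩ := Cprops l a b u v h hm
  let M := Submodule.span S {c0}
  have hMtf : TorsFree I M := fun m hm' => Subtype.ext (hCa _ (congrArg Subtype.val (hm' a ha)))
  obtain ⟨E, ι, hE, hι, htf⟩ := exists_injective_embedding_torsFree (I := I) M hMtf
  have hDfin := extFin_satD hι (fun n => EX.subsingleton_zero_of_torsFree htf n) (fun n => EX.subsingleton_injective _ _ 0) (hcof M)
  obtain ⟨ψ, hψ⟩ := satD_embed (ι := ι) ha hb hCa hCb M.subtype Subtype.val_injective hι htf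
  have hH : IsHausdorff (maximalIdeal S) (satD I ι) := ⟨fun y hy => by
    apply hψ
    rw [map_zero]
    apply hsep
    intro n
    have h1 := hy n
    rw [SModEq.zero] at h1
    have h2 := Submodule.mem_map_of_mem (f := ψ) h1
    rw [Submodule.map_smul''] at h2
    exact Submodule.smul_mono le_rfl le_top h2⟩
  have hDf : Module.Finite S (satD I ι) := by
    apply finite_of_hausdorff (maximalIdeal S)
    apply hch.fin
    refine EX.finite_serre (I := I) d (fun j _ => hDfin j) d le_rfl _ 1 ?_
    intro r hr y
    rw [pow_one] at hr
    exact quot_kill r (hI hr) y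
  have hareg : ∀ y ∈ satD I ι, a • y = 0 → y = 0 := by
    intro y hy h0
    have : ψ ⟨y, hy⟩ = 0 := by
      apply hCa
      rw [← map_smul]
      have : a • (⟨y, hy⟩ : satD I ι) = 0 := Subtype.ext h0
      rw [this, map_zero]
    exact congrArg Subtype.val (hψ (this.trans (map_zero ψ).symm))
  have hkill : ∀ s : S, s • c0 = 0 → ∀ y ∈ satD I ι, s • y = 0 := by
    intro s hs y hy
    obtain ⟨k, hk⟩ := mem_satD.1 hy
    apply htf.pow k
    intro r hr
    obtain ⟨⟨m, hm'⟩, hm⟩ := hk r hr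
    rw [smul_comm, ← hm, ← map_smul]
    obtain ⟨t, rfl⟩ := Submodule.mem_span_singleton.1 hm'
    have : s • (⟨t • c0, hm'⟩ : M) = 0 := Subtype.ext (by
      change s • t • c0 = 0
      rw [smul_comm, hs, smul_zero])
    rw [this, map_zero]
  let N : Submodule S (satD I ι) := LinearMap.range (LinearMap.lsmul S (satD I ι) a)
  have hNmem : ∀ y, y ∈ N ↔ ∃ z, a • z = y := fun y => Iff.rfl
  have hann : ∀ s, s ∈ Module.annihilator S ((satD I ι) ⧸ N) ↔ ∀ y : satD I ι, ∃ z : satD I ι, s • y = a • z := by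
    intro s
    rw [Module.mem_annihilator]
    constructor
    · intro h y
      have := h (N.mkQ y)
      rw [← map_smul, Submodule.mkQ_apply, Submodule.Quotient.mk_eq_zero, hNmem] at this
      obtain ⟨z, hz⟩ := this
      exact ⟨z, hz.symm⟩
    · intro h y
      obtain ⟨y, rfl⟩ := Submodule.mkQ_surjective _ y
      rw [← map_smul, Submodule.mkQ_apply, Submodule.Quotient.mk_eq_zero, hNmem]
      obtain ⟨z, hz⟩ := h y
      exact ⟨z, hz.symm⟩
  have hlist : Ideal.ofList l ⊔ Ideal.span {a} ⊔ Ideal.span {b} ≤ I := by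
    refine sup_le (sup_le (Ideal.span_le.2 hl) ?_) ?_
    · exact (Ideal.span_singleton_le_iff_mem _).2 ha
    · exact (Ideal.span_singleton_le_iff_mem _).2 hb
  have hannp : Module.annihilator S ((satD I ι) ⧸ N) ≤ p := by
    intro s hs
    refine ann_quot_le (D := satD I ι) (hIp ha) ?_ s ((hann s).1 hs)
    intro t ht
    apply hIp
    apply hlist
    apply hg
    have h1 := congrArg Subtype.val (ht ⟨ι ⟨c0, Submodule.mem_span_singleton_self c0⟩, le_satD ⟨_, rfl⟩⟩)
    change t • ι ⟨c0, _⟩ = 0 at h1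
    rw [← map_smul] at h1
    exact congrArg Subtype.val (hι (h1.trans (map_zero ι).symm))
  have hpmin : p ∈ (Module.annihilator S ((satD I ι) ⧸ N)).minimalPrimes := by
    refine ⟨⟨inferInstance, hannp⟩, ?_⟩
    rintro q ⟨hq, hqa⟩ hqp
    refine hmin q hq hqp ?_ ?_ ?_
    · intro j hj
      apply hqa
      rw [hann]
      intro y
      exact ⟨0, by rw [smul_zero]; exact Subtype.ext (hkill j (hlc j hj) _ y.2)⟩
    · apply hqa
      rw [hann]
      intro y; exact ⟨y, rfl⟩
    · have : b * v ∈ q := by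
        apply hqa
        rw [hann]
        intro y
        refine ⟨-(u • y), ?_⟩
        have h0 : (a * u + b * v) • y = 0 := Subtype.ext (hkill _ hf _ y.2)
        rw [add_smul] at h0
        rw [smul_neg, ← mul_smul]
        exact eq_neg_of_add_eq_zero_right h0
      rcases hq.mem_or_mem this with h | h
      · exact h
      · exact absurd (hqp h) hv
  have hass := Module.associatedPrimes.minimalPrimes_annihilator_subset_associatedPrimes S _ hpmin
  obtain ⟨hpp, y, hy⟩ := (ass_iff p).1 hass
  obtain ⟨y, rfl⟩ := Submodule.mkQ_surjective _ y
  have : N.mkQ y = 0 := by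
    obtain ⟨z, hz, hzy⟩ := satD_div htf a hareg y.1 (fun i hi => by
      have := (hy i).1 (hIp hi)
      rw [← map_smul, Submodule.mkQ_apply, Submodule.Quotient.mk_eq_zero, hNmem] at this
      obtain ⟨z, hz⟩ := this
      exact ⟨z.1, z.2, congrArg Subtype.val hz⟩)
    rw [Submodule.mkQ_apply, Submodule.Quotient.mk_eq_zero, hNmem]
    exact ⟨⟨z, hz⟩, Subtype.ext hzy⟩
  have h1 : (1 : S) ∈ p := (hy 1).2 (by rw [this, smul_zero])
  exact hpp.ne_top ((Ideal.eq_top_iff_one p).2 h1)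

end Core2

end Part22

section Part23
open CategoryTheory IsLocalRing

section Sel
variable {S : Type u} [CommRing S] [IsNoetherianRing S]

lemma dim_mono {K L : Ideal S} (h : K ≤ L) : ringKrullDim (S ⧸ L) ≤ ringKrullDim (S ⧸ K) :=
  ringKrullDim_le_of_surjective _ (Ideal.Quotient.factor_surjective h)

lemma dim_nat [IsLocalRing S] {d : ℕ} (hd : ringKrullDim S = d) (K : Ideal S) (hK : K ≠ ⊤) : ∃ j : ℕ, ringKrullDim (S ⧸ K) = j := by
  have : Nontrivial (S ⧸ K) := Ideal.Quotient.nontrivial_iff.2 hK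
  have h0 := ringKrullDim_nonneg_of_nontrivial (R := S ⧸ K)
  have h1 := (ringKrullDim_quotient_le K).trans hd.le
  generalize ringKrullDim (S ⧸ K) = x at h0 h1
  cases x with
  | bot => simp at h0
  | coe x =>
    cases x with
    | top => exact absurd h1 (by
        intro h
        have : (⊤ : ℕ∞) ≤ (d : ℕ∞) := by exact_mod_cast h
        simp at this)
    | coe j => exact ⟨j, rfl⟩

lemma dim_lt [IsLocalRing S] {d : ℕ} (hd : ringKrullDim S = d) {q q' : Ideal S} [hq : q.IsPrime] (hq' : q' ≠ ⊤) (h : q < q')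
    {j j' : ℕ} (hj : ringKrullDim (S ⧸ q) ≤ j) (hj' : j' ≤ ringKrullDim (S ⧸ q')) : j' + 1 ≤ j := by
  obtain ⟨x, hx, hxq⟩ := SetLike.exists_of_lt h
  have h1 := dim_quot_step (K := q) (x := x) (fun y hy => (hq.mem_or_mem hy).resolve_left hxq)
  have h2 : q ⊔ Ideal.span {x} ≤ q' := sup_le h.le ((Ideal.span_singleton_le_iff_mem _).2 hx)
  have h3 := (add_le_add_left ((hj'.trans (dim_mono h2))) 1).trans (h1.trans hj)
  exact_mod_cast h3

lemma exists_dim_prime [IsLocalRing S] {e : ℕ} {I : Ideal S} (he : ringKrullDim (S ⧸ I) = e) :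
    ∃ p : Ideal S, p.IsPrime ∧ I ≤ p ∧ ringKrullDim (S ⧸ p) = e := by
  have h1 := he
  rw [ringKrullDim_quotient] at h1
  obtain ⟨l, hl⟩ := Order.le_krullDim_iff.1 h1.ge
  let p := l.head
  have hIp : I ≤ p.1.asIdeal := p.2
  refine ⟨p.1.asIdeal, p.1.isPrime, hIp, le_antisymm ((dim_mono hIp).trans he.le) ?_⟩
  rw [ringKrullDim_quotient]
  refine Order.le_krullDim_iff.2 ⟨⟨l.length, fun i => ⟨(l i).1, ?_⟩, fun i => l.step i⟩, hl⟩
  exact (LTSeries.head_le l i)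

lemma dim_max [IsLocalRing S] : ringKrullDim (S ⧸ maximalIdeal S) = 0 := by
  have : (maximalIdeal S).IsMaximal := inferInstance
  let _ := Ideal.Quotient.field (maximalIdeal S)
  exact ringKrullDim_eq_zero_of_field (S ⧸ maximalIdeal S)

lemma reg_of_avoid {K : Ideal S} {x : S} (h : ∀ p : Ideal S, IsAssociatedPrime p (S ⧸ K) → x ∉ p) (y : S) (hy : x * y ∈ K) : y ∈ K := by
  by_contra hn
  obtain ⟨p, hp, hp'⟩ := ass_above (S := S) (X := S ⧸ K) (Ideal.Quotient.mk K y) (fun h => hn (Ideal.Quotient.eq_zero_iff_mem.1 h))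
  apply h p hp
  apply hp'
  change Ideal.Quotient.mk K (x * y) = 0
  exact Ideal.Quotient.eq_zero_iff_mem.2 hy

lemma le_of_ass {K p : Ideal S} (hp : IsAssociatedPrime p (S ⧸ K)) : K ≤ p := by
  obtain ⟨_, x, hx⟩ := (ass_iff p).1 hp
  intro r hr
  exact (hx r).2 (quot_kill r hr x)

lemma seq_exists [IsLocalRing S] {I : Ideal S} (hI : I ≤ maximalIdeal S) {u v : S} {e : ℕ}
    (hdim : ∀ q : Ideal S, q.IsPrime → I ≤ q → u ∈ q → v ∈ q → ringKrullDim (S ⧸ q) ≤ e) (n : ℕ) :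
    ∀ K : Ideal S, u ∈ K → v ∈ K → Dp (n + e) K → ∃ l : List S, l.length = n ∧ (∀ x ∈ l, x ∈ I) ∧ WR K l := by
  induction n with
  | zero => intro K _ _ _; exact ⟨[], rfl, by simp, trivial⟩
  | succ n ih =>
    intro K hu hv hD
    obtain ⟨a, haI, ha⟩ := avoid I (associatedPrimes S (S ⧸ K)) (associatedPrimes.finite S _) (fun p hp => hp.isPrime) (by
      intro q hq hIq
      have h1 := hD.ass _ q hq
      have h2 := hdim q hq.isPrime hIq (le_of_ass hq hu) (le_of_ass hq hv)
      have h3 := h1.trans h2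
      have h3 : n + 1 + e ≤ e := by exact_mod_cast h3
      omega)
    have hreg := reg_of_avoid ha
    have hD' := hD.quot hreg
    rw [show n + 1 + e - 1 = n + e by omega] at hD'
    obtain ⟨l, hl, hlI, hW⟩ := ih _ (Ideal.mem_sup_left hu) (Ideal.mem_sup_left hv) hD'
    refine ⟨a :: l, by simp [hl], ?_, hreg, hW⟩
    intro x hx
    rcases List.mem_cons.1 hx with rfl | hx
    · exact haI
    · exact hlI x hx

lemma case2 [IsLocalRing S] [IsAdicComplete (maximalIdeal S) S] (d : ℕ) (hS : Reg d S) (I : Ideal S) (e : ℕ)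
    (he : ringKrullDim (S ⧸ I) = ((e + 2 : ℕ) : WithBot ℕ∞)) (hI0 : I ≠ ⊥) (hpr : ∀ π : S, Prime π → ¬ I ≤ Ideal.span {π})
    (hcof : ∀ (M : Type u) [AddCommGroup M] [Module S M] [Module.Finite S M], ExtFin (R := S) (S ⧸ I) (Hc I 1 M)) : False := by
  have hdom := reg_dom d S hS
  have hufd := reg_ufd d hS
  have hd := hS.2
  obtain ⟨J, xx, hch⟩ := reg_chain d S hS
  obtain ⟨p, hp, hIp, hpe⟩ := exists_dim_prime he
  have hpm : p ≤ maximalIdeal S := le_maximalIdeal hp.ne_top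
  have hI : I ≤ maximalIdeal S := hIp.trans hpm
  have hpne : p ≠ maximalIdeal S := by
    rintro rfl
    rw [dim_max] at hpe
    have : 0 = e + 2 := by exact_mod_cast hpe
    omega
  have hp0 : p ≠ ⊥ := fun h => hI0 (le_bot_iff.1 (h ▸ hIp))
  have hbotp : (⊥ : Ideal S).IsPrime := Ideal.isPrime_bot
  have hbot : ringKrullDim (S ⧸ (⊥ : Ideal S)) ≤ d := (ringKrullDim_quotient_le _).trans hd.le
  -- e + 4 ≤ d
  have hed : e + 4 ≤ d := by
    obtain ⟨π, hπp, hπ⟩ := hp.exists_mem_prime_of_ne_bot hp0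
    have hπ' : (Ideal.span {π}).IsPrime := (Ideal.span_singleton_prime hπ.ne_zero).2 hπ
    obtain ⟨j, hj⟩ := dim_nat hd _ hπ'.ne_top
    have h1 := dim_lt hd (q := ⊥) (q' := Ideal.span {π}) hπ'.ne_top (bot_lt_iff_ne_bot.2 (by simpa using hπ.ne_zero)) hbot hj.ge
    have h2 := dim_lt hd (q := Ideal.span {π}) (q' := p) hp.ne_top (lt_of_le_of_ne ((Ideal.span_singleton_le_iff_mem _).2 hπp)
      (fun h => hpr π hπ (h ▸ hIp))) hj.le hpe.ge
    omega
  have hmne : ∀ q : Ideal S, q.IsPrime → q ≠ maximalIdeal S → ¬ maximalIdeal S ≤ q :=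
    fun q hq hne hle => hne (le_antisymm (le_maximalIdeal hq.ne_top) hle)
  -- u
  obtain ⟨u, hum, hu⟩ := avoid (maximalIdeal S) ((I.minimalPrimes \ {maximalIdeal S}) ∪ {⊥})
    (((Ideal.finite_minimalPrimes_of_isNoetherianRing S I).subset Set.sdiff_subset).union (Set.finite_singleton _)) (by
      rintro q (hq | hq)
      · exact hq.1.1.1
      · rw [Set.mem_singleton_iff.1 hq]; exact hbotp) (by
      rintro q (hq | hq)
      · exact hmne q hq.1.1.1 hq.2
      · rw [Set.mem_singleton_iff.1 hq]
        intro h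
        exact hp0 (le_bot_iff.1 (hpm.trans h)))
  have hu0 : u ≠ 0 := fun h => hu ⊥ (Or.inr rfl) (by rw [h]; exact Ideal.zero_mem _)
  have huW : ∀ y, u * y ∈ (⊥ : Ideal S) → y ∈ (⊥ : Ideal S) := by
    intro y hy
    rw [Ideal.mem_bot] at hy ⊢
    exact (mul_eq_zero.1 hy).resolve_left hu0
  have hDu : Dp (d - 1) ((⊥ : Ideal S) ⊔ Ideal.span {u}) := by
    have := hch.Dp d 0 (by omega)
    rw [hch.zero] at this
    exact this.quot huW
  -- v
  obtain ⟨v, hvm, hv⟩ := avoid (maximalIdeal S) (((I ⊔ Ideal.span {u}).minimalPrimes \ {maximalIdeal S}) ∪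
      (associatedPrimes S (S ⧸ ((⊥ : Ideal S) ⊔ Ideal.span {u})) ∪ {p}))
    (((Ideal.finite_minimalPrimes_of_isNoetherianRing S _).subset Set.sdiff_subset).union ((associatedPrimes.finite S _).union
      (Set.finite_singleton _))) (by
      rintro q (hq | hq | hq)
      · exact hq.1.1.1
      · exact hq.isPrime
      · rw [Set.mem_singleton_iff.1 hq]; exact hp) (by
      rintro q (hq | hq | hq)
      · exact hmne q hq.1.1.1 hq.2
      · refine hmne q hq.isPrime ?_
        rintro rfl
        have := hDu.ass _ _ hq
        rw [dim_max] at this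
        have : d - 1 ≤ 0 := by exact_mod_cast this
        omega
      · rw [Set.mem_singleton_iff.1 hq]
        exact hmne p hp hpne)
  have hvp : v ∉ p := hv p (Or.inr (Or.inr rfl))
  have hvW := reg_of_avoid (K := (⊥ : Ideal S) ⊔ Ideal.span {u}) (x := v) (fun q hq => hv q (Or.inr (Or.inl hq)))
  have hDv := hDu.quot hvW
  have hdim : ∀ q : Ideal S, q.IsPrime → I ≤ q → u ∈ q → v ∈ q → ringKrullDim (S ⧸ q) ≤ e := by
    intro q hq hIq huq hvq
    by_cases hqm : q = maximalIdeal S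
    · rw [hqm, dim_max]; exact_mod_cast Nat.zero_le e
    obtain ⟨q1, hq1, hq1q⟩ := Ideal.exists_minimalPrimes_le (I := I ⊔ Ideal.span {u}) (J := q)
      (sup_le hIq ((Ideal.span_singleton_le_iff_mem _).2 huq))
    have hq1p : q1.IsPrime := hq1.1.1
    have hq1m : q1 ≠ maximalIdeal S := by
      rintro rfl
      exact hqm (le_antisymm (le_maximalIdeal hq.ne_top) hq1q)
    have hvq1 : v ∉ q1 := hv q1 (Or.inl ⟨hq1, hq1m⟩)
    have hIq1 : I ≤ q1 := le_sup_left.trans hq1.1.2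
    have huq1 : u ∈ q1 := hq1.1.2 (Ideal.mem_sup_right (Ideal.mem_span_singleton_self u))
    obtain ⟨q0, hq0, hq0q⟩ := Ideal.exists_minimalPrimes_le (I := I) (J := q1) hIq1
    have hq0p : q0.IsPrime := hq0.1.1
    have hq0m : q0 ≠ maximalIdeal S := by
      rintro rfl
      exact hq1m (le_antisymm (le_maximalIdeal hq1p.ne_top) hq0q)
    have huq0 : u ∉ q0 := hu q0 (Or.inl ⟨hq0, hq0m⟩)
    obtain ⟨j, hj⟩ := dim_nat hd q hq.ne_top
    obtain ⟨j1, hj1⟩ := dim_nat hd q1 hq1p.ne_top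
    have h1 := dim_lt hd hq.ne_top (lt_of_le_of_ne hq1q (fun h => hvq1 (h ▸ hvq))) hj1.le hj.ge
    have h2 := dim_lt hd hq1p.ne_top (lt_of_le_of_ne hq0q (fun h => huq0 (h ▸ huq1))) ((dim_mono hq0.1.2).trans he.le) hj1.ge
    rw [hj]
    have : j ≤ e := by omega
    exact_mod_cast this
  obtain ⟨as, hlen, hasI, hW⟩ := seq_exists hI hdim (d - 2 - e) ((⊥ : Ideal S) ⊔ Ideal.span {u} ⊔ Ideal.span {v})
    (Ideal.mem_sup_left (Ideal.mem_sup_right (Ideal.mem_span_singleton_self u))) (Ideal.mem_sup_right (Ideal.mem_span_singleton_self v)) (by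
    rw [show d - 2 - e + e = d - 1 - 1 by omega]; exact hDv)
  have hWall : WR ⊥ (u :: v :: as) := ⟨huW, hvW, hW⟩
  have hallm : ∀ x ∈ u :: v :: as, x ∈ maximalIdeal S := by
    intro x hx
    rcases List.mem_cons.1 hx with rfl | hx
    · exact hum
    rcases List.mem_cons.1 hx with rfl | hx
    · exact hvm
    exact hI (hasI x hx)
  have hWas : WR ⊥ as := by
    have : WR ⊥ (as ++ [u, v]) := hWall.perm (List.perm_append_comm (l₁ := [u, v]) (l₂ := as)) hallm
    exact (WR.append.1 this).1
  have hasdim : ringKrullDim (S ⧸ Ideal.ofList as) ≤ ((e + 2 : ℕ) : WithBot ℕ∞) := by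
    have h1 := hWas.dim
    rw [bot_sup_eq, hlen] at h1
    have hne : Ideal.ofList as ≠ ⊤ := by
      intro h
      have : Ideal.ofList as ≤ maximalIdeal S := Ideal.span_le.2 (fun x hx => hI (hasI x hx))
      rw [h, top_le_iff] at this
      exact (maximalIdeal.isMaximal S).ne_top this
    obtain ⟨j, hj⟩ := dim_nat hd _ hne
    rw [hj] at h1 ⊢
    have h2 : j + (d - 2 - e) ≤ d := by exact_mod_cast h1.trans hbot
    have : j ≤ e + 2 := by omega
    exact_mod_cast this
  match as, hlen, hasI, hWall, hallm, hasdim with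
  | [], hlen, _, _, _, _ => simp at hlen; omega
  | [_], hlen, _, _, _, _ => simp at hlen; omega
  | a :: b :: l, hlen, hasI, hWall, hallm, hasdim =>
    have hperm : (u :: v :: a :: b :: l).Perm (l ++ [a, b, u, v]) := by
      refine List.Perm.trans ?_ (List.perm_append_comm (l₁ := [a, b, u, v]) (l₂ := l))
      refine List.Perm.append_right l (l₁ := [u, v, a, b]) (l₂ := [a, b, u, v]) ?_
      exact List.perm_append_comm (l₁ := [u, v]) (l₂ := [a, b])
    refine case2_core hch hI p hIp l a b u v (hWall.perm hperm hallm) (fun x hx => hallm x (hperm.mem_iff.2 hx)) ?_ ?_ ?_ hvp ?_ hcof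
    · intro j hj; exact hasI j (by simp [hj])
    · exact hasI a (by simp)
    · exact hasI b (by simp)
    · intro q hq hqp hlq haq hbq
      by_contra hn
      have h1 : Ideal.ofList (a :: b :: l) ≤ q := by
        refine Ideal.span_le.2 ?_
        intro x hx
        rcases List.mem_cons.1 hx with rfl | hx
        · exact haq
        rcases List.mem_cons.1 hx with rfl | hx
        · exact hbq
        exact hlq x hx
      have h2 := dim_lt hd hp.ne_top (lt_of_le_of_ne hqp (fun h => hn h.ge)) ((dim_mono h1).trans hasdim) hpe.ge
      omega

end Sel

end Part23

section Part24
open CategoryTheory IsLocalRing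

section CaseOne
variable {S : Type u} [CommRing S] [IsNoetherianRing S]

lemma case1_core {D : Type u} [AddCommGroup D] [Module S D] (t : D) (g : S)
    (hg : Function.Bijective (LinearMap.lsmul S D g))
    (hsurj : ∀ e : D, ∃ (k : ℕ) (s : S), g^k • e = s • t)
    (hinj : ∀ s : S, s • t = 0 → s = 0) (P : Ideal S) [hP : P.IsPrime] (hgP : g ∉ P)
    (hE : ∀ i, Subsingleton (EX S (S ⧸ P) D i)) : False := by
  have hgs : ∀ e : D, ∃ e' : D, g • e' = e := fun e => hg.2 e
  -- divide by powers of g inside b D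
  have hdiv : ∀ (b : Ideal S) (e : D) (k : ℕ), g^k • e ∈ b • (⊤ : Submodule S D) → e ∈ b • (⊤ : Submodule S D) := by
    intro b e k
    induction k generalizing e with
    | zero => intro h; simpa using h
    | succ k ih =>
      intro h
      apply ih
      rw [pow_succ', mul_smul] at h
      generalize g^k • e = f at h
      have : ∀ x ∈ b • (⊤ : Submodule S D), ∃ z ∈ b • (⊤ : Submodule S D), g • z = x := by
        intro x hx
        induction hx using Submodule.smul_induction_on' with
        | smul r hr n hn =>
          obtain ⟨n', hn'⟩ := hgs n
          exact ⟨r • n', Submodule.smul_mem_smul hr trivial, by rw [smul_comm, hn']⟩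
        | add x _ y _ hx hy =>
          obtain ⟨a, ha, rfl⟩ := hx
          obtain ⟨c, hc, rfl⟩ := hy
          exact ⟨a + c, Submodule.add_mem _ ha hc, smul_add _ _ _⟩
      obtain ⟨z, hz, hzx⟩ := this _ h
      rw [← hg.1 hzx]; exact hz
  have hmemb : ∀ (b : Ideal S) (e : D), e ∈ b • (⊤ : Submodule S D) → ∃ (n : ℕ), ∃ s ∈ b, g^n • e = s • t := by
    intro b e he
    induction he using Submodule.smul_induction_on' with
    | smul r hr n hn =>
      obtain ⟨k, s, hs⟩ := hsurj n
      exact ⟨k, r * s, Ideal.mul_mem_right _ _ hr, by rw [smul_comm, hs, mul_smul]⟩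
    | add x _ y _ hx hy =>
      obtain ⟨a, s, hs, h1⟩ := hx
      obtain ⟨c, s', hs', h2⟩ := hy
      refine ⟨a + c, g^c * s + g^a * s', Ideal.add_mem _ (Ideal.mul_mem_left _ _ hs) (Ideal.mul_mem_left _ _ hs'), ?_⟩
      rw [smul_add, add_smul, mul_smul, mul_smul, ← h1, ← h2, ← mul_smul, ← mul_smul, pow_add, mul_comm (g^a)]
  let T : Set (Ideal S) := {b | b ≤ P ∧ ∀ i, Subsingleton (EX S (S ⧸ P) (D ⧸ (b • (⊤ : Submodule S D))) i)}
  have hT : T.Nonempty := by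
    refine ⟨⊥, bot_le, fun i => ?_⟩
    have e : D ≃ₗ[S] (D ⧸ ((⊥ : Ideal S) • (⊤ : Submodule S D))) :=
      (Submodule.quotEquivOfEqBot _ (Submodule.bot_smul _)).symm
    exact ((EX.postEquiv (N := S ⧸ P) e i).toEquiv.subsingleton_congr).1 (hE i)
  obtain ⟨b, ⟨hbP, hb⟩, hmax⟩ := set_has_maximal_iff_noetherian.2 (inferInstance : IsNoetherian S S) T hT
  set W := b • (⊤ : Submodule S D) with hW
  let b' : Ideal S := W.comap (LinearMap.toSpanSingleton S D t)
  have hb' : ∀ s, s ∈ b' ↔ s • t ∈ W := fun s => Iff.rfl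
  obtain ⟨y, hyP, hy⟩ := avoid P (associatedPrimes S (S ⧸ b')) (associatedPrimes.finite S _) (fun p hp => hp.isPrime) (by
    intro q hq hle
    obtain ⟨hqp, x, hx⟩ := (ass_iff q).1 hq
    obtain ⟨s, rfl⟩ := Ideal.Quotient.mk_surjective x
    have hx' : ∀ a, a ∈ q ↔ a * s ∈ b' := by
      intro a; rw [hx a, ← Ideal.Quotient.eq_zero_iff_mem]; rfl
    let f : S ⧸ P →ₗ[S] D ⧸ W := cycHom P (W.mkQ (s • t)) (by
      intro r hr
      rw [← map_smul, Submodule.mkQ_apply, Submodule.Quotient.mk_eq_zero, ← mul_smul]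
      exact (hx' r).1 (hle hr))
    have hf : f = 0 := by
      have := hb 0
      have := (EX.zeroEquiv (R := S) (N := S ⧸ P) (L := D ⧸ W)).symm.toEquiv.subsingleton
      exact Subsingleton.elim _ _
    have h1 : f (Submodule.Quotient.mk 1) = 0 := by rw [hf]; rfl
    rw [cycHom_mk, one_smul, Submodule.mkQ_apply, Submodule.Quotient.mk_eq_zero] at h1
    apply hqp.ne_top
    rw [Ideal.eq_top_iff_one, hx', one_mul]
    exact h1)
  have hyreg := reg_of_avoid hy
  have hynzd : ∀ e : D, y • e ∈ W → e ∈ W := by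
    intro e he
    obtain ⟨k, s, hs⟩ := hsurj e
    apply hdiv b e k
    rw [← hW, hs]
    apply hyreg s
    rw [hb', mul_smul, ← hs, smul_comm]
    exact W.smul_mem _ he
  have hyb : y ∉ b := by
    intro hyb
    have ht : t ∈ W := hynzd t (Submodule.smul_mem_smul hyb trivial)
    obtain ⟨n, s, hs, h⟩ := hmemb b t ht
    have : g^n - s = 0 := hinj _ (by rw [sub_smul, h, sub_self])
    exact hgP (hP.mem_of_pow_mem n (by rw [sub_eq_zero.1 this]; exact hbP hs))
  let c := b ⊔ Ideal.span {y}
  have hbc : b < c := lt_of_le_of_ne le_sup_left (fun h => hyb (by rw [h]; exact Ideal.mem_sup_right (Ideal.mem_span_singleton_self y)))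
  have hWc : W ≤ c • (⊤ : Submodule S D) := Submodule.smul_mono_left le_sup_left
  refine hmax c ⟨sup_le hbP ((Ideal.span_singleton_le_iff_mem _).2 hyP), fun i => ?_⟩ hbc
  refine EX.sub_right (f := LinearMap.lsmul S (D ⧸ W) y) (g := Submodule.factor hWc) ?_ ?_ (Submodule.factor_surjective hWc) i (hb i) (hb (i+1))
  · rw [← LinearMap.ker_eq_bot, LinearMap.ker_eq_bot']
    intro m hm
    obtain ⟨e, rfl⟩ := Submodule.mkQ_surjective _ m
    rw [LinearMap.lsmul_apply, ← map_smul, Submodule.mkQ_apply, Submodule.Quotient.mk_eq_zero] at hm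
    rw [Submodule.mkQ_apply, Submodule.Quotient.mk_eq_zero]
    exact hynzd e hm
  · intro m
    obtain ⟨e, rfl⟩ := Submodule.mkQ_surjective _ m
    have : Submodule.factor hWc (W.mkQ e) = (c • (⊤ : Submodule S D)).mkQ e := rfl
    rw [this, Submodule.mkQ_apply, Submodule.Quotient.mk_eq_zero]
    constructor
    · intro h
      rw [show c = b ⊔ Ideal.span {y} from rfl, Submodule.sup_smul, Submodule.mem_sup] at h
      obtain ⟨w, hw, v, hv, rfl⟩ := h
      rw [Submodule.ideal_span_singleton_smul] at hv
      obtain ⟨v', -, rfl⟩ := (Submodule.mem_smul_pointwise_iff_exists _ _ _).1 hv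
      refine ⟨W.mkQ v', ?_⟩
      rw [LinearMap.lsmul_apply, map_add, ← map_smul, Submodule.mkQ_apply W w, (Submodule.Quotient.mk_eq_zero W).2 hw, zero_add]
    · rintro ⟨m, hm⟩
      obtain ⟨e', rfl⟩ := Submodule.mkQ_surjective _ m
      rw [LinearMap.lsmul_apply, ← map_smul, ← sub_eq_zero, ← map_sub, Submodule.mkQ_apply, Submodule.Quotient.mk_eq_zero] at hm
      have h2 : y • e' ∈ c • (⊤ : Submodule S D) := Submodule.smul_mem_smul (Ideal.mem_sup_right (Ideal.mem_span_singleton_self y)) trivial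
      have h3 := Submodule.sub_mem _ h2 (hWc hm)
      rwa [sub_sub_cancel] at h3

lemma case1_red {J : Ideal S} [IsDomain S] [UniqueFactorizationMonoid S] (hJ : ∀ π : S, Prime π → ¬ J ≤ Ideal.span {π})
    (k : ℕ) (x : FractionRing S) (hx : ∀ r ∈ J^k, ∃ s : S, algebraMap S (FractionRing S) s = r • x) :
    ∃ s : S, algebraMap S (FractionRing S) s = x := by
  obtain ⟨a, b, hab, rfl⟩ := IsFractionRing.exists_reduced_fraction S x
  by_cases hb : IsUnit (b : S)
  · obtain ⟨v, hv⟩ := hb.exists_right_inv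
    refine ⟨a * v, ?_⟩
    rw [IsLocalization.eq_mk'_iff_mul_eq, ← map_mul, mul_assoc, mul_comm v, hv, mul_one]
  exfalso
  obtain ⟨π, hπ, hdvd⟩ := WfDvdMonoid.exists_irreducible_factor hb (nonZeroDivisors.coe_ne_zero b)
  have hπ' := hπ.prime
  have hna : ¬ π ∣ a := fun h => hπ.not_isUnit (hab h hdvd)
  have hJk : J^k ≤ Ideal.span {π} := by
    intro r hr
    obtain ⟨s, hs⟩ := hx r hr
    rw [Algebra.smul_def, IsLocalization.mul_mk'_eq_mk'_of_mul, IsLocalization.eq_mk'_iff_mul_eq, ← map_mul] at hs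
    have := IsFractionRing.injective S (FractionRing S) hs
    rw [Ideal.mem_span_singleton]
    exact (hπ'.dvd_or_dvd (this ▸ Dvd.dvd.mul_left hdvd s : π ∣ r * a)).resolve_right hna
  have : (Ideal.span {π}).IsPrime := (Ideal.span_singleton_prime hπ.ne_zero).2 hπ'
  exact hJ π hπ' (Ideal.IsPrime.le_of_pow_le hJk)

lemma case1 [IsLocalRing S] [IsDomain S] [UniqueFactorizationMonoid S] {I J : Ideal S} {g : S} (hI : I = Ideal.span {g} * J)
    (hI0 : I ≠ ⊥) (hgm : g ∈ maximalIdeal S) (hg0 : g ≠ 0) (hJ : ∀ π : S, Prime π → ¬ J ≤ Ideal.span {π})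
    (P : Ideal S) [hP : P.IsPrime] (hIP : I ≤ P) (hgP : g ∉ P) (hcof : ExtFin (R := S) (S ⧸ I) (Hc I 1 S)) : False := by
  let K := FractionRing S
  let ι : S →ₗ[S] K := Algebra.linearMap S K
  have hι : Function.Injective ι := IsFractionRing.injective S K
  have hbij : ∀ r : S, r ≠ 0 → Function.Bijective (LinearMap.lsmul S K r) := by
    intro r hr
    have hr' : algebraMap S K r ≠ 0 := by simpa using hr
    constructor
    · intro x y hxy
      simp only [LinearMap.lsmul_apply, Algebra.smul_def] at hxy
      exact mul_left_cancel₀ hr' hxy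
    · intro x
      exact ⟨(algebraMap S K r)⁻¹ * x, by simp only [LinearMap.lsmul_apply, Algebra.smul_def]; exact mul_inv_cancel_left₀ hr' x⟩
  obtain ⟨r, hrI, hr0⟩ := Submodule.exists_mem_ne_zero_of_ne_bot hI0
  have hK : ∀ n i, Subsingleton (EX S (S ⧸ I^n) K i) := fun n i =>
    EX.subsingleton_of_unit r n (fun x => quot_kill _ (Ideal.pow_mem_pow hrI n) x) (hbij r hr0) i
  have hD := extFin_satD (I := I) hι (fun n => hK n 0) (fun n => hK n 1) hcof
  let D := satD I ι
  have hgb : Function.Bijective (LinearMap.lsmul S D g) := by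
    constructor
    · intro x y hxy
      exact Subtype.ext ((hbij g hg0).1 (congrArg Subtype.val hxy))
    · rintro ⟨x, hx⟩
      obtain ⟨z, hz⟩ := (hbij g hg0).2 x
      obtain ⟨k, hk⟩ := mem_satD.1 hx
      refine ⟨⟨z, mem_satD.2 ⟨k+1, ?_⟩⟩, Subtype.ext hz⟩
      intro r hr
      have hpow : I^(k+1) = Ideal.span {g} * (J * I^k) := by rw [pow_succ', ← mul_assoc, ← hI]
      rw [hpow] at hr
      obtain ⟨w, hw, rfl⟩ := Ideal.mem_span_singleton_mul.1 hr
      have : (g * w) • z = w • x := by rw [mul_comm, mul_smul]; exact congrArg _ hz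
      rw [this]
      exact hk w (Ideal.mul_le_right (I := J) (J := I^k) hw)
  have h0 : ∀ i, Subsingleton (EX S (S ⧸ I) D i) := by
    intro i
    have := hD i
    have hsm : ∀ x : EX S (S ⧸ I) D i, ∃ y : EX S (S ⧸ I) D i, g • y = x := by
      intro x
      let e := EX.postEquiv (R := S) (N := S ⧸ I) (LinearEquiv.ofBijective _ hgb) i
      refine ⟨e.symm x, ?_⟩
      have he : ∀ x, e x = g • x := fun x => LinearMap.congr_fun (EX.post_smul_id (L := D) (N := S ⧸ I) g i) x
      rw [← he, LinearEquiv.apply_symm_apply]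
    have hbot := Submodule.eq_bot_of_le_smul_of_le_jacobson_bot (maximalIdeal S) (⊤ : Submodule S (EX S (S ⧸ I) D i))
      Module.Finite.fg_top (by
        intro x _
        obtain ⟨y, rfl⟩ := hsm x
        exact Submodule.smul_mem_smul hgm trivial) (IsLocalRing.maximalIdeal_le_jacobson _)
    exact (Submodule.subsingleton_iff S).1 (subsingleton_of_bot_eq_top hbot.symm)
  have h1 : ∀ i, Subsingleton (EX S (S ⧸ P) D i) := fun i =>
    EX.subsingleton_serre (I := I) i (fun j _ => h0 j) i le_rfl (S ⧸ P) 1 (fun r hr x => quot_kill r (hIP (by simpa using hr)) x)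
  refine case1_core (D := D) ⟨ι 1, le_satD ⟨1, rfl⟩⟩ g hgb ?_ ?_ P hgP h1
  · rintro ⟨x, hx⟩
    obtain ⟨k, hk⟩ := mem_satD.1 hx
    obtain ⟨s, hs⟩ := case1_red hJ k (g^k • x) (by
      intro r hr
      obtain ⟨s, hs⟩ := hk (g^k * r) (by
        rw [hI, mul_pow]
        exact Ideal.mul_mem_mul (Ideal.pow_mem_pow (Ideal.mem_span_singleton_self g) k) hr)
      exact ⟨s, by rw [← mul_smul, mul_comm r]; exact hs⟩)
    refine ⟨k, s, Subtype.ext ?_⟩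
    change g^k • x = s • ι 1
    rw [← map_smul, smul_eq_mul, mul_one]
    exact hs.symm
  · intro s hs
    have h2 : s • ι 1 = 0 := congrArg Subtype.val hs
    rw [← map_smul, smul_eq_mul, mul_one] at h2
    exact hι (h2.trans (map_zero ι).symm)

lemma gcd_decomp [IsDomain S] [IsLocalRing S] (I : Ideal S) (hI0 : I ≠ ⊥) :
    ∃ (g : S) (J : Ideal S), g ≠ 0 ∧ I = Ideal.span {g} * J ∧ ∀ π : S, Prime π → ¬ J ≤ Ideal.span {π} := by
  let T : Set (Ideal S) := {J | ∃ g : S, g ≠ 0 ∧ I = Ideal.span {g} * J}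
  obtain ⟨J, ⟨g, hg, hIJ⟩, hmax⟩ := set_has_maximal_iff_noetherian.2 (inferInstance : IsNoetherian S S) T
    ⟨I, 1, one_ne_zero, by rw [Ideal.span_singleton_one, Ideal.one_eq_top.symm, one_mul]⟩
  refine ⟨g, J, hg, hIJ, fun π hπ hle => ?_⟩
  have hJ0 : J ≠ ⊥ := by rintro rfl; exact hI0 (by rw [hIJ, Ideal.mul_bot])
  obtain ⟨J', hJ'⟩ : Ideal.span {π} ∣ J := by
    let J' : Ideal S := J.comap (LinearMap.lsmul S S π)
    refine ⟨J', le_antisymm ?_ ?_⟩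
    · intro x hx
      obtain ⟨w, rfl⟩ := Ideal.mem_span_singleton.1 (hle hx)
      exact Ideal.mul_mem_mul (Ideal.mem_span_singleton_self π) hx
    · intro x hx
      obtain ⟨w, hw, rfl⟩ := Ideal.mem_span_singleton_mul.1 hx
      exact hw
  refine hmax J' ⟨g * π, mul_ne_zero hg hπ.ne_zero, ?_⟩ (lt_of_le_of_ne (hJ'.le.trans Ideal.mul_le_right) ?_)
  · rw [hIJ, hJ', ← mul_assoc, Ideal.span_singleton_mul_span_singleton]
  · intro h
    apply hJ0
    apply Submodule.eq_bot_of_le_smul_of_le_jacobson_bot (maximalIdeal S) J (IsNoetherian.noetherian J) ?_ (IsLocalRing.maximalIdeal_le_jacobson _)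
    rw [← h] at hJ'
    calc J = Ideal.span {π} * J := hJ'
      _ ≤ _ := Ideal.mul_mono_left ((Ideal.span_singleton_le_iff_mem _).2 ((mem_maximalIdeal π).2 hπ.not_isUnit))

lemma rad_principal [IsDomain S] [UniqueFactorizationMonoid S] (g : S) (hg : g ≠ 0) :
    ∃ x : S, (Ideal.span {g}).radical = Ideal.span {x} := by
  obtain ⟨y, n, hy, hyg, hgy⟩ := exists_squarefree_dvd_pow_of_ne_zero hg
  refine ⟨y, le_antisymm ?_ ?_⟩
  · rintro x ⟨m, hm⟩
    rw [Ideal.mem_span_singleton] at hm ⊢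
    exact hy.isRadical m x (hyg.trans hm)
  · rw [Ideal.span_singleton_le_iff_mem]
    exact ⟨n, Ideal.mem_span_singleton.2 hgy⟩
end CaseOne

end Part24

/-- Let `(S, n)` be a regular complete local ring (a complete Noetherian local
ring whose maximal ideal is generated by `dim S` elements).  Then an ideal `I` of `S` lies in
`𝓘(S)` if and only if either `Rad(I) = xS` for some `x ∈ S`, or `0 ≤ dim S/I ≤ 1`. -/
theorem memCofiniteClass_iff_of_regular {S : Type u} [CommRing S] [IsNoetherianRing S]
    [IsLocalRing S] [IsAdicComplete (IsLocalRing.maximalIdeal S) S]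
    (hreg : ∃ s : Finset S, Ideal.span (s : Set S) = IsLocalRing.maximalIdeal S ∧
      (s.card : WithBot ℕ∞) = ringKrullDim S)
    (I : Ideal S) :
    MemCofiniteClass S I ↔
      ((∃ x : S, I.radical = Ideal.span {x}) ∨
        (0 ≤ ringKrullDim (S ⧸ I) ∧ ringKrullDim (S ⧸ I) ≤ 1)) := by
  obtain ⟨s, hs, hcard⟩ := hreg
  have hS : Reg s.card S := by
    refine ⟨⟨fun i => (s.equivFin.symm i : S), ?_⟩, hcard.symm⟩
    rw [← hs]
    congr 1
    ext x
    constructor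
    · rintro ⟨i, rfl⟩; exact (s.equivFin.symm i).2
    · intro hx; exact ⟨s.equivFin ⟨x, hx⟩, by simp⟩
  have hdom := reg_dom _ S hS
  have hufd := reg_ufd _ hS
  constructor
  · intro h
    have hcof : ∀ (M : Type u) [AddCommGroup M] [Module S M] [Module.Finite S M], ExtFin (R := S) (S ⧸ I) (Hc I 1 M) := by
      intro M _ _ hM
      exact (isCofinite_Hc_iff 1).1 (h (ModuleCat.of S M) hM 1)
    by_cases hI0 : I = ⊥
    · left
      refine ⟨0, ?_⟩
      rw [hI0, Ideal.span_singleton_zero]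
      exact (Ideal.isPrime_bot (α := S)).radical
    by_cases hI1 : I = ⊤
    · left
      exact ⟨1, by rw [hI1, Ideal.radical_top, Ideal.span_singleton_one]⟩
    obtain ⟨g, J, hg0, hIJ, hJ⟩ := gcd_decomp I hI0
    by_cases hg : IsUnit g
    · right
      rw [Ideal.span_singleton_eq_top.2 hg, Ideal.top_mul] at hIJ
      subst hIJ
      have : Nontrivial (S ⧸ I) := Ideal.Quotient.nontrivial_iff.2 hI1
      refine ⟨ringKrullDim_nonneg_of_nontrivial, ?_⟩
      obtain ⟨j, hj⟩ := dim_nat hS.2 I hI1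
      rcases j with _ | _ | e
      · rw [hj]; norm_num
      · rw [hj]; norm_num
      · exact (case2 _ hS I e hj hI0 hJ hcof).elim
    · left
      by_cases hgr : g ∈ I.radical
      · obtain ⟨x, hx⟩ := rad_principal g hg0
        refine ⟨x, ?_⟩
        rw [← hx]
        apply le_antisymm
        · apply Ideal.radical_mono
          rw [hIJ]; exact Ideal.mul_le_left
        · exact Ideal.radical_le_radical_iff.2 ((Ideal.span_singleton_le_iff_mem _).2 hgr)
      · rw [Ideal.radical_eq_sInf, Ideal.mem_sInf] at hgr
        push Not at hgr
        obtain ⟨P, ⟨hIP, hP⟩, hgP⟩ := hgr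
        exact (case1 hIJ hI0 ((IsLocalRing.mem_maximalIdeal g).2 hg) hg0 hJ P hIP hgP (hcof S)).elim
  · intro h M hM i
    refine (isCofinite_Hc_iff (M := M) i).2 ?_
    rcases h with ⟨x, hx⟩ | ⟨_, h⟩
    · exact partA x hx M i
    · exact partB h M i
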